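/- arXiv:1309.4299 — 2 statements merged into one kernel-verified Lean document; each statement's English description precedes it below -/
import Mathlib

section
/- Let u be a smooth solution of (−Δ)^{3/2}u = 2e^{3u} with finite volume. Then: (a) for every ε > 0 there exists R > 0 such that −v(x) ≥ (α − ε) log|x| for all |x| ≥ R; and (b) |∇v(x)| → 0 and the second derivatives D²v(x) → 0 as |x| → ∞. -/
open MeasureTheory Real Filter

noncomputable section

abbrev E3 := EuclideanSpace ℝ (Fin 3)

/-- The Laplacian of `f : ℝ³ → ℝ` as the sum of second partial derivatives. -/
def lap (f : E3 → ℝ) (x : E3) : ℝ :=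
  ∑ i, fderiv ℝ (fun y => fderiv ℝ f y (EuclideanSpace.single i 1)) x (EuclideanSpace.single i 1)

/-- The half Laplacian `(-Δ)^{1/2} φ` of a Schwartz function on ℝ³, defined as a
principal value: `(1/π²) lim_{ε→0⁺} ∫_{|x−y|>ε} (φ(x)−φ(y))/|x−y|⁴ dy`. -/
def halfLap (φ : SchwartzMap E3 ℝ) (x : E3) : ℝ :=
  limUnder (nhdsWithin (0:ℝ) (Set.Ioi 0)) fun ε =>
    (1 / π ^ 2) * ∫ y in {y : E3 | ε < ‖x - y‖}, (φ x - φ y) / ‖x - y‖ ^ 4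

/-- `w ∈ L_{1/2}(ℝ³)`. -/
def MemL12 (w : E3 → ℝ) : Prop :=
  LocallyIntegrable w volume ∧ Integrable (fun x => |w x| / (1 + ‖x‖ ^ 4)) volume

/-- `u` is a smooth solution of `(-Δ)^{3/2} u = 2 e^{3u}` in ℝ³ with finite volume. -/
def IsSolution (u : E3 → ℝ) : Prop :=
  ContDiff ℝ (⊤ : ℕ∞) u ∧ MemL12 (lap u) ∧ Integrable (fun x => exp (3 * u x)) volume ∧
    ∀ φ : SchwartzMap E3 ℝ,
      ∫ x, (-(lap u x)) * halfLap φ x = 2 * ∫ x, exp (3 * u x) * φ x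

/-- `u` is a spherical solution. -/
def IsSpherical (u : E3 → ℝ) : Prop :=
  ∃ lam : ℝ, 0 < lam ∧ ∃ x₀ : E3, ∀ x, u x = log (2 * lam / (1 + lam ^ 2 * ‖x - x₀‖ ^ 2))

/-- `α = (1/π²) ∫ e^{3u}`. -/
def solAlpha (u : E3 → ℝ) : ℝ := (1 / π ^ 2) * ∫ y, exp (3 * u y)

/-- `v(x) = (1/π²) ∫ log(|y|/|x−y|) e^{3u(y)} dy`. -/
def solV (u : E3 → ℝ) (x : E3) : ℝ :=
  (1 / π ^ 2) * ∫ y, log (‖y‖ / ‖x - y‖) * exp (3 * u y)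

end

open scoped Topology

/-- The kernel `‖z‖ ^ (-p)` cut off outside the unit ball. -/
noncomputable def cutKer (p : ℝ) (z : E3) : ℝ := (Metric.ball (0 : E3) 1).indicator (fun z => ‖z‖ ^ (-p)) z

lemma cutKer_nonneg (p : ℝ) (z : E3) : 0 ≤ cutKer p z :=
  Set.indicator_nonneg (fun _ _ => by positivity) z

lemma cutKer_of_mem {p : ℝ} {z : E3} (hz : ‖z‖ < 1) : cutKer p z = ‖z‖ ^ (-p) := by
  simp [cutKer, hz]

lemma integrable_cutKer {p : ℝ} (hp : p < 3) : Integrable (cutKer p) := by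
  have h : IntegrableOn (fun z : E3 => ‖z‖ ^ (-p)) (Metric.ball 0 1) := by
    apply integrableOn_ball_of_norm_le_rpow (C := 1) (α := p)
    · simpa using hp
    · refine ae_of_all _ fun x => ?_
      rw [Real.norm_of_nonneg (by positivity), one_mul]
    · exact Measurable.aestronglyMeasurable (by fun_prop)
    · simp
  exact h.integrable_indicator Metric.isOpen_ball.measurableSet

lemma integrable_cutKer_sub {p : ℝ} (hp : p < 3) (x : E3) :
    Integrable (fun y => cutKer p (x - y)) :=
  (integrable_cutKer hp).comp_sub_left x

lemma integral_cutKer_sub (p : ℝ) (x : E3) :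
    ∫ y, cutKer p (x - y) = ∫ y, cutKer p y :=
  integral_sub_left_eq_self _ volume x

lemma rpow_neg_le_cutKer_add_one {p : ℝ} (hp : 0 ≤ p) (z : E3) :
    ‖z‖ ^ (-p) ≤ cutKer p z + 1 := by
  by_cases hz : ‖z‖ < 1
  · rw [cutKer_of_mem hz]; linarith
  · have := Real.rpow_le_one_of_one_le_of_nonpos (not_lt.1 hz) (neg_nonpos.2 hp)
    linarith [cutKer_nonneg p z]

lemma mul_rpow_neg_le_cutKer {p : ℝ} (hp : 0 ≤ p) {a S : ℝ} (ha : 0 ≤ a) {z : E3}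
    (hS : ‖z‖ < 1 → a ≤ S) (hS0 : 0 ≤ S) :
    a * ‖z‖ ^ (-p) ≤ S * cutKer p z + a := by
  by_cases hz : ‖z‖ < 1
  · rw [cutKer_of_mem hz]
    have := mul_le_mul_of_nonneg_right (hS hz) (show 0 ≤ ‖z‖ ^ (-p) by positivity)
    linarith
  · have := Real.rpow_le_one_of_one_le_of_nonpos (not_lt.1 hz) (neg_nonpos.2 hp)
    nlinarith [mul_nonneg hS0 (cutKer_nonneg p z)]

lemma exists_bound_on_ball {f : E3 → ℝ} (hf : Continuous f) (x : E3) (r : ℝ) :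
    ∃ S, 0 ≤ S ∧ ∀ y, ‖x - y‖ ≤ r → f y ≤ S := by
  obtain ⟨S, hS⟩ := (isCompact_closedBall x r).bddAbove_image hf.continuousOn
  refine ⟨max S 0, le_max_right _ _, fun y hy => (hS ⟨y, ?_, rfl⟩).trans (le_max_left _ _)⟩
  rwa [Metric.mem_closedBall', dist_eq_norm]

lemma integrable_mul_rpow_neg {f : E3 → ℝ} (hf : Continuous f) (hf0 : ∀ x, 0 ≤ f x)
    (hfi : Integrable f) {p : ℝ} (hp0 : 0 ≤ p) (hp : p < 3) (x : E3) :
    Integrable (fun y => f y * ‖x - y‖ ^ (-p)) := by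
  obtain ⟨S, hS0, hS⟩ := exists_bound_on_ball hf x 1
  refine (((integrable_cutKer_sub hp x).const_mul S).add hfi).mono' ?_ (ae_of_all _ fun y => ?_)
  · exact (hf.measurable.mul (by fun_prop)).aestronglyMeasurable
  · have := hf0 y
    rw [Real.norm_of_nonneg (by positivity)]
    exact mul_rpow_neg_le_cutKer hp0 (hf0 y) (fun h => hS y h.le) hS0

lemma integral_mul_rpow_neg_le {f : E3 → ℝ} (hf : Continuous f) (hf0 : ∀ x, 0 ≤ f x)
    (hfi : Integrable f) {p : ℝ} (hp0 : 0 ≤ p) (hp : p < 3) {S : ℝ} (hS0 : 0 ≤ S)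
    (x : E3) (hS : ∀ y, ‖x - y‖ < 1 → f y ≤ S) :
    ∫ y, f y * ‖x - y‖ ^ (-p) ≤ S * (∫ z, cutKer p z) + ∫ y, f y := by
  rw [← integral_cutKer_sub p x, ← integral_const_mul, ← integral_add
    ((integrable_cutKer_sub hp x).const_mul S) hfi]
  exact integral_mono (integrable_mul_rpow_neg hf hf0 hfi hp0 hp x)
    (((integrable_cutKer_sub hp x).const_mul S).add hfi)
    fun y => mul_rpow_neg_le_cutKer hp0 (hf0 y) (hS y) hS0

/-- The Riesz-type potential `∫ f y / ‖x - y‖²`. -/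
noncomputable def pot (f : E3 → ℝ) (x : E3) : ℝ := ∫ y, f y / ‖x - y‖ ^ 2

lemma div_sq_eq (a : ℝ) (z : E3) : a / ‖z‖ ^ 2 = a * ‖z‖ ^ (-(2 : ℝ)) := by
  rw [Real.rpow_neg (norm_nonneg _), div_eq_mul_inv]; norm_cast

lemma integrable_div_sq {f : E3 → ℝ} (hf : Continuous f) (hf0 : ∀ x, 0 ≤ f x)
    (hfi : Integrable f) (x : E3) : Integrable (fun y => f y / ‖x - y‖ ^ 2) := by
  simp only [div_sq_eq]
  exact integrable_mul_rpow_neg hf hf0 hfi (by norm_num) (by norm_num) x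

lemma pot_nonneg {f : E3 → ℝ} (hf0 : ∀ x, 0 ≤ f x) (x : E3) : 0 ≤ pot f x :=
  integral_nonneg fun y => by have := hf0 y; positivity

lemma integrable_conv_cutKer {f : E3 → ℝ} (hfi : Integrable f) {p : ℝ} (hp : p < 3) :
    Integrable (fun q : E3 × E3 => f q.2 * cutKer p (q.1 - q.2)) (volume.prod volume) :=
  hfi.convolution_integrand (ContinuousLinearMap.mul ℝ ℝ) (integrable_cutKer hp)

lemma pot_le_conv_add {f : E3 → ℝ} (hf : Continuous f) (hf0 : ∀ x, 0 ≤ f x)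
    (hfi : Integrable f) (x : E3) :
    pot f x ≤ (∫ y, f y * cutKer 2 (x - y)) + ∫ y, f y := by
  obtain ⟨S, hS0, hS⟩ := exists_bound_on_ball hf x 1
  have hi : Integrable (fun y => f y * cutKer 2 (x - y)) := by
    refine ((integrable_cutKer_sub (p := 2) (by norm_num) x).const_mul S).mono'
      (hfi.aestronglyMeasurable.mul
        (integrable_cutKer_sub (p := 2) (by norm_num) x).aestronglyMeasurable)
      (ae_of_all _ fun y => ?_)
    rw [norm_mul, Real.norm_of_nonneg (hf0 y), Real.norm_of_nonneg (cutKer_nonneg _ _)]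
    by_cases h : ‖x - y‖ < 1
    · exact mul_le_mul_of_nonneg_right (hS y h.le) (cutKer_nonneg _ _)
    · simp [cutKer, h]
  rw [pot, ← integral_add hi hfi]
  refine integral_mono (integrable_div_sq hf hf0 hfi x) (hi.add hfi) fun y => ?_
  simp only [div_sq_eq]
  have := mul_le_mul_of_nonneg_left
    (rpow_neg_le_cutKer_add_one (p := 2) (by norm_num) (x - y)) (hf0 y)
  linarith

lemma exists_tail_le {f : E3 → ℝ} (hfi : Integrable f) {δ : ℝ} (hδ : 0 < δ) :
    ∃ R : ℝ, 0 < R ∧ ∫ y in {y : E3 | R ≤ ‖y‖}, f y ≤ δ := by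
  have h := tendsto_setIntegral_of_antitone (μ := volume) (f := f)
    (s := fun n : ℕ => {y : E3 | (n : ℝ) ≤ ‖y‖})
    (fun n => measurableSet_le measurable_const measurable_norm)
    (fun m n hmn y (hy : (n : ℝ) ≤ ‖y‖) => le_trans (by exact_mod_cast hmn) hy)
    ⟨0, hfi.integrableOn⟩
  have he : ⋂ n : ℕ, {y : E3 | (n : ℝ) ≤ ‖y‖} = ∅ := by
    refine Set.eq_empty_of_forall_notMem fun y hy => ?_
    obtain ⟨n, hn⟩ := exists_nat_gt ‖y‖
    exact absurd (Set.mem_iInter.1 hy n) (not_le.2 hn)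
  rw [he, setIntegral_empty] at h
  obtain ⟨n, hn, hn1⟩ := ((h.eventually_le_const hδ).and (eventually_ge_atTop 1)).exists
  exact ⟨n, by exact_mod_cast hn1, hn⟩

lemma mul_exp_average_le {A : Set E3} {f L : E3 → ℝ} (hf0 : ∀ x, 0 ≤ f x)
    (hfi : IntegrableOn f A) (hfL : IntegrableOn (fun y => f y * L y) A)
    (hfe : IntegrableOn (fun y => f y * exp (L y)) A) (hη : 0 < ∫ y in A, f y) :
    (∫ y in A, f y) * exp ((∫ y in A, f y)⁻¹ * ∫ y in A, f y * L y) ≤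
      ∫ y in A, f y * exp (L y) := by
  set η := ∫ y in A, f y
  set m := η⁻¹ * ∫ y in A, f y * L y with hm
  have h1 : ∫ y in A, exp m * ((1 - m) * f y + f y * L y) ≤ ∫ y in A, f y * exp (L y) := by
    refine integral_mono (((hfi.const_mul _).add hfL).const_mul _) hfe fun y => ?_
    have h2 : exp m * (1 + (L y - m)) ≤ exp (L y) := by
      have := mul_le_mul_of_nonneg_left (add_one_le_exp (L y - m)) (exp_pos m).le
      rw [← exp_add] at this
      ring_nf at this ⊢
      linarith
    have := mul_le_mul_of_nonneg_left h2 (hf0 y)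
    dsimp only
    linarith
  rw [integral_const_mul, integral_add (hfi.const_mul _) hfL, integral_const_mul] at h1
  have h3 : ∫ y in A, f y * L y = η * m := by rw [hm]; field_simp
  rw [h3] at h1
  linarith [show exp m * ((1 - m) * η + η * m) = η * exp m by ring]

lemma log_one_add_nonneg (z : E3) : 0 ≤ log (1 + 1 / ‖z‖ ^ 2) :=
  log_nonneg (by have : 0 ≤ 1 / ‖z‖ ^ 2 := by positivity
                 linarith)

lemma log_one_add_le (z : E3) : log (1 + 1 / ‖z‖ ^ 2) ≤ 1 / ‖z‖ ^ 2 := by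
  have : 0 ≤ 1 / ‖z‖ ^ 2 := by positivity
  linarith [log_le_sub_one_of_pos (show 0 < 1 + 1 / ‖z‖ ^ 2 by linarith)]

lemma integrable_mul_log {f : E3 → ℝ} (hf : Continuous f) (hf0 : ∀ x, 0 ≤ f x)
    (hfi : Integrable f) (x : E3) : Integrable (fun y => f y * log (1 + 1 / ‖x - y‖ ^ 2)) := by
  refine (integrable_div_sq hf hf0 hfi x).mono' ?_ (ae_of_all _ fun y => ?_)
  · exact (hf.measurable.mul (by fun_prop)).aestronglyMeasurable
  · rw [Real.norm_of_nonneg (mul_nonneg (hf0 y) (log_one_add_nonneg _))]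
    have := mul_le_mul_of_nonneg_left (log_one_add_le (x - y)) (hf0 y)
    rwa [mul_one_div] at this

lemma exists_pow_le_pot {u : E3 → ℝ} (hu : Continuous u)
    (hfi : Integrable fun x => exp (3 * u x)) {C K : ℝ} (hK : 0 ≤ K)
    (h : ∀ x, u x ≤ C + K * ∫ y, exp (3 * u y) * log (1 + 1 / ‖x - y‖ ^ 2)) :
    ∃ R C' : ℝ, 0 < R ∧ 0 ≤ C' ∧ ∀ x, R ≤ ‖x‖ →
      exp (3 * u x) ^ 5 ≤ C' * (1 + pot (fun y => exp (3 * u y)) x) := by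
  set f : E3 → ℝ := fun x => exp (3 * u x) with hfdef
  have hf : Continuous f := by fun_prop
  have hfpos : ∀ x, 0 < f x := fun x => exp_pos _
  have hf0 : ∀ x, 0 ≤ f x := fun x => (hfpos x).le
  set M := ∫ y, f y
  have hM : 0 ≤ M := integral_nonneg hf0
  obtain ⟨R, hR, hRη⟩ := exists_tail_le hfi (δ := 1 / (15 * K + 1)) (by positivity)
  set A := {y : E3 | R ≤ ‖y‖} with hA
  have hAm : MeasurableSet A := measurableSet_le measurable_const measurable_norm
  set η := ∫ y in A, f y
  have hη : 0 < η := by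
    refine (setIntegral_pos_iff_support_of_nonneg_ae (ae_of_all _ hf0) hfi.integrableOn).2 ?_
    have hs : Function.support f = Set.univ := by
      ext x; simp [(hfpos x).ne']
    rw [hs, Set.univ_inter]
    refine lt_of_lt_of_le ?_ (measure_mono (show {y : E3 | R < ‖y‖} ⊆ A from
      fun y (hy : R < ‖y‖) => hy.le))
    refine (isOpen_lt continuous_const continuous_norm).measure_pos volume ?_
    refine ⟨EuclideanSpace.single 0 (R + 1), ?_⟩
    simp only [Set.mem_ofPred_eq, PiLp.norm_single, norm_eq_abs]
    rw [abs_of_pos (by linarith)]; linarith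
  have hKη : 15 * K ≤ η⁻¹ := by
    have := one_div_le_one_div_of_le hη hRη
    rw [one_div_one_div, one_div] at this
    linarith
  refine ⟨R + 1, exp (15 * (C + K * M)) * η⁻¹ * (M + 1), by linarith, by positivity, fun x hx => ?_⟩
  set L : E3 → ℝ := fun y => log (1 + 1 / ‖x - y‖ ^ 2)
  have hfL : Integrable fun y => f y * L y := integrable_mul_log hf hf0 hfi x
  have hQ := integrable_div_sq hf hf0 hfi x
  have hLe : ∀ y, f y * exp (L y) = f y + f y / ‖x - y‖ ^ 2 := fun y => by
    simp only [L]
    rw [exp_log (by positivity)]; ring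
  have hfe : Integrable fun y => f y * exp (L y) := by
    simp only [hLe]; exact hfi.add hQ
  have hJ := mul_exp_average_le hf0 hfi.integrableOn hfL.integrableOn (A := A) hfe.integrableOn hη
  have h1 : ∫ y in A, f y * exp (L y) ≤ M + pot f x := by
    refine (setIntegral_le_integral hfe (ae_of_all _ fun y => by have := hf0 y; positivity)).trans ?_
    simp only [hLe]
    rw [integral_add hfi hQ, pot]
  have hI0 : 0 ≤ ∫ y in A, f y * L y :=
    integral_nonneg fun y => mul_nonneg (hf0 y) (log_one_add_nonneg _)
  have h2 : ∫ y, f y * L y ≤ M + ∫ y in A, f y * L y := by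
    rw [← integral_add_compl hAm hfL, add_comm]
    refine add_le_add_left ?_ _
    refine le_trans (setIntegral_mono_on hfL.integrableOn hfi.integrableOn hAm.compl fun y hy => ?_)
      (setIntegral_le_integral hfi (ae_of_all _ hf0))
    have hy' : ‖y‖ < R := not_le.1 hy
    have h3 : 1 ≤ ‖x - y‖ := by linarith [norm_sub_norm_le x y]
    have h4 : 1 / ‖x - y‖ ^ 2 ≤ 1 := by
      rw [div_le_one (by positivity)]; exact one_le_pow₀ h3
    have := mul_le_mul_of_nonneg_left ((log_one_add_le (x - y)).trans h4) (hf0 y)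
    linarith
  have h5 : 5 * (3 * u x) ≤ 15 * (C + K * M) + η⁻¹ * ∫ y in A, f y * L y := by
    have := mul_le_mul_of_nonneg_left h2 hK
    have := mul_le_mul_of_nonneg_right hKη hI0
    have := h x
    simp only [L, hfdef] at *
    linarith
  calc f x ^ 5 = exp (5 * (3 * u x)) := by rw [hfdef, ← exp_nat_mul]; norm_num
    _ ≤ exp (15 * (C + K * M)) * (η⁻¹ * (η * exp (η⁻¹ * ∫ y in A, f y * L y))) := by
      rw [inv_mul_cancel_left₀ hη.ne', ← exp_add]; exact exp_le_exp.2 h5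
    _ ≤ exp (15 * (C + K * M)) * (η⁻¹ * ((M + 1) * (1 + pot f x))) := by
      have h6 : M + pot f x ≤ (M + 1) * (1 + pot f x) := by nlinarith [pot_nonneg hf0 x]
      exact mul_le_mul_of_nonneg_left (mul_le_mul_of_nonneg_left ((hJ.trans h1).trans h6)
        (by positivity)) (by positivity)
    _ = _ := by ring

lemma exists_bound_of_pow_le_pot {f : E3 → ℝ} (hf : Continuous f) (hf0 : ∀ x, 0 ≤ f x)
    (hfi : Integrable f) {R C : ℝ} (hC : 0 ≤ C)
    (h : ∀ x, R ≤ ‖x‖ → f x ^ 5 ≤ C * (1 + pot f x)) : ∃ S, 0 ≤ S ∧ ∀ x, f x ≤ S := by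
  set M := ∫ y, f y
  have hM : 0 ≤ M := integral_nonneg hf0
  set G : E3 → ℝ := fun x => ∫ y, f y * cutKer 2 (x - y)
  have hp := integrable_conv_cutKer hfi (p := 2) (by norm_num)
  have hG : Integrable G := hp.integral_prod_left
  have hG0 : ∀ x, 0 ≤ G x := fun x => integral_nonneg fun y => mul_nonneg (hf0 y) (cutKer_nonneg _ _)
  set V := volume.real (Metric.ball (0 : E3) 1)
  set T := ∫ x, G x
  set κ := ∫ z : E3, cutKer (5 / 2) z
  have hQ : ∀ x, R + 1 ≤ ‖x‖ → pot f x ≤ C * ((1 + M) * V + T) + κ + M := by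
    intro x hx
    set B := Metric.ball x 1
    have hB : MeasurableSet B := Metric.isOpen_ball.measurableSet
    have hBf : volume B < ⊤ := measure_ball_lt_top
    have h5i : IntegrableOn (fun y => f y ^ 5) B :=
      ((hf.pow 5).continuousOn.integrableOn_compact (isCompact_closedBall x 1)).mono_set
        Metric.ball_subset_closedBall
    have hci : IntegrableOn (fun _ : E3 => C * (1 + M)) B := integrableOn_const hBf.ne
    have h5 : ∫ y in B, f y ^ 5 ≤ C * ((1 + M) * V + T) := by
      calc ∫ y in B, f y ^ 5 ≤ ∫ y in B, (C * (1 + M) + C * G y) := by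
            refine setIntegral_mono_on h5i (hci.add (hG.const_mul C).integrableOn) hB fun y hy => ?_
            have hy1 : ‖x - y‖ < 1 := by rwa [← dist_eq_norm, ← Metric.mem_ball']
            have hy2 : R ≤ ‖y‖ := by linarith [norm_sub_norm_le x y]
            have := mul_le_mul_of_nonneg_left (pot_le_conv_add hf hf0 hfi y) hC
            have := h y hy2
            simp only [G, M]
            linarith
        _ = C * (1 + M) * V + C * ∫ y in B, G y := by
            rw [integral_add hci (hG.const_mul C).integrableOn, integral_const_mul C G,
              setIntegral_const, smul_eq_mul, measureReal_def, Measure.addHaar_ball_center]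
            simp only [V, measureReal_def]
            ring
        _ ≤ _ := by
            have := setIntegral_le_integral (s := B) hG (ae_of_all _ hG0)
            have := mul_le_mul_of_nonneg_left this hC
            linarith
    have hκi := integrable_cutKer_sub (p := 5 / 2) (by norm_num) x
    have h5i' : Integrable (B.indicator fun y => f y ^ 5) := h5i.integrable_indicator hB
    calc pot f x ≤ ∫ y, (B.indicator (fun y => f y ^ 5) y + cutKer (5 / 2) (x - y) + f y) := by
          refine integral_mono (integrable_div_sq hf hf0 hfi x) ((h5i'.add hκi).add hfi) fun y => ?_
          rw [div_sq_eq]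
          by_cases hy : ‖x - y‖ < 1
          · have hyB : y ∈ B := by rwa [Metric.mem_ball', dist_eq_norm]
            rw [Set.indicator_of_mem hyB, cutKer_of_mem hy]
            have hfy := hf0 y
            rcases eq_or_lt_of_le (norm_nonneg (x - y)) with h0 | h0
            · rw [← h0, Real.zero_rpow (by norm_num), Real.zero_rpow (by norm_num)]
              have : 0 ≤ f y ^ 5 := by positivity
              linarith
            rcases le_total (f y) (‖x - y‖ ^ (-(1 / 2) : ℝ)) with hle | hle
            · have := mul_le_mul_of_nonneg_right hle
                (show 0 ≤ ‖x - y‖ ^ (-2 : ℝ) by positivity)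
              rw [← Real.rpow_add h0] at this
              norm_num at this ⊢
              have : 0 ≤ f y ^ 5 := by positivity
              linarith
            · have h4 : ‖x - y‖ ^ (-2 : ℝ) ≤ f y ^ 4 := by
                have := pow_le_pow_left₀ (by positivity) hle 4
                rw [← Real.rpow_natCast, ← Real.rpow_mul h0.le] at this
                norm_num at this ⊢
                exact this
              have := mul_le_mul_of_nonneg_left h4 hfy
              have : 0 ≤ ‖x - y‖ ^ (-(5 / 2) : ℝ) := by positivity
              nlinarith
          · have := mul_le_mul_of_nonneg_left (rpow_neg_le_cutKer_add_one (p := 2) (by norm_num) (x - y)) (hf0 y)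
            have h0 : cutKer 2 (x - y) = 0 := by simp [cutKer, hy]
            have h1 : 0 ≤ B.indicator (fun y => f y ^ 5) y :=
              Set.indicator_nonneg (fun y _ => by have := hf0 y; positivity) y
            have h2 := cutKer_nonneg (5 / 2) (x - y)
            rw [h0] at this
            linarith
      _ = (∫ y in B, f y ^ 5) + κ + M := by
          refine (integral_add (h5i'.add hκi) hfi).trans ?_
          rw [integral_add' h5i' hκi, integral_indicator hB, integral_cutKer_sub]
      _ ≤ _ := by linarith
  obtain ⟨S, hS0, hS⟩ := exists_bound_on_ball hf 0 (R + 1)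
  set N := C * ((1 + M) * V + T) + κ + M
  refine ⟨max S (1 + C * (1 + N)), le_max_of_le_left hS0, fun x => ?_⟩
  rcases le_total (R + 1) ‖x‖ with hx | hx
  · refine le_max_of_le_right ?_
    have h1 := h x (by linarith)
    have h2 := mul_le_mul_of_nonneg_left (hQ x hx) hC
    have h3 : f x ≤ 1 + f x ^ 5 := by
      rcases le_total (f x) 1 with h4 | h4
      · have : 0 ≤ f x ^ 5 := by have := hf0 x; positivity
        linarith
      · linarith [le_self_pow₀ h4 (show (5 : ℕ) ≠ 0 by norm_num)]
    linarith
  · exact le_max_of_le_left (hS x (by simpa using hx))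

lemma div_norm_eq (a : ℝ) (z : E3) : a / ‖z‖ = a * ‖z‖ ^ (-(1 : ℝ)) := by
  rw [Real.rpow_neg (norm_nonneg _), Real.rpow_one, div_eq_mul_inv]

lemma integrable_div_norm {f : E3 → ℝ} (hf : Continuous f) (hf0 : ∀ x, 0 ≤ f x)
    (hfi : Integrable f) (x : E3) : Integrable (fun y => f y / ‖x - y‖) := by
  simp only [div_norm_eq]
  exact integrable_mul_rpow_neg hf hf0 hfi (by norm_num) (by norm_num) x

lemma exists_pot_le {f : E3 → ℝ} (hf : Continuous f) (hf0 : ∀ x, 0 ≤ f x)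
    (hfi : Integrable f) {S : ℝ} (hS0 : 0 ≤ S) (hS : ∀ x, f x ≤ S) :
    ∃ q, 0 ≤ q ∧ ∀ x, pot f x ≤ q := by
  refine ⟨S * (∫ z, cutKer 2 z) + ∫ y, f y, ?_, fun x => ?_⟩
  · have : 0 ≤ ∫ z, cutKer 2 z := integral_nonneg fun z => cutKer_nonneg 2 z
    have : 0 ≤ ∫ y, f y := integral_nonneg hf0
    positivity
  · simp only [pot, div_sq_eq]
    exact integral_mul_rpow_neg_le hf hf0 hfi (by norm_num) (by norm_num) hS0 x fun y _ => hS y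

lemma tendsto_norm_sub_atTop (y : E3) :
    Tendsto (fun x : E3 => ‖x - y‖) (comap (fun x : E3 => ‖x‖) atTop) atTop := by
  refine tendsto_atTop_mono (f := fun x : E3 => ‖x‖ - ‖y‖) (fun x => norm_sub_norm_le x y) ?_
  exact tendsto_atTop_add_const_right _ _ tendsto_comap

lemma tendsto_pot_zero {f : E3 → ℝ} (hf : Continuous f) (hf0 : ∀ x, 0 ≤ f x)
    (hfi : Integrable f) {S : ℝ} (hS0 : 0 ≤ S) (hS : ∀ x, f x ≤ S) :
    Tendsto (pot f) (comap (fun x : E3 => ‖x‖) atTop) (𝓝 0) := by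
  set κ := S * (∫ z : E3, cutKer (5 / 2) z) + ∫ y, f y with hκd
  have hκ : 0 ≤ κ := by
    have : 0 ≤ ∫ z, cutKer (5 / 2) z := integral_nonneg fun z => cutKer_nonneg (5 / 2) z
    have : 0 ≤ ∫ y, f y := integral_nonneg hf0
    positivity
  refine tendsto_order.2 ⟨fun a ha => Eventually.of_forall fun x => ha.trans_le (pot_nonneg hf0 x),
    fun ε hε => ?_⟩
  obtain ⟨l, hl, hlκ⟩ : ∃ l : ℝ, 0 < l ∧ l * κ < ε / 2 := by
    refine ⟨ε / (2 * (κ + 1)), by positivity, ?_⟩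
    rw [div_mul_eq_mul_div, div_lt_div_iff₀ (by positivity) (by norm_num)]
    nlinarith
  have hmin : ∀ z : E3, ‖z‖ ^ (-2 : ℝ) ≤ l * ‖z‖ ^ (-(5 / 2) : ℝ) + min (‖z‖ ^ (-2 : ℝ)) (l ^ (-4 : ℝ)) := by
    intro z
    have hp : 0 ≤ ‖z‖ ^ (-(5 / 2) : ℝ) := by positivity
    rcases le_total (‖z‖ ^ (-2 : ℝ)) (l ^ (-4 : ℝ)) with h | h
    · rw [min_eq_left h]; have := mul_nonneg hl.le hp; linarith
    · rw [min_eq_right h]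
      rcases eq_or_lt_of_le (norm_nonneg z) with h0 | h0
      · rw [← h0, Real.zero_rpow (by norm_num), Real.zero_rpow (by norm_num)]
        have : 0 < l ^ (-4 : ℝ) := by positivity
        linarith
      have h1 : ‖z‖ ^ (1 / 2 : ℝ) ≤ l := by
        have := Real.rpow_le_rpow_of_nonpos (by positivity) h (show (-1 / 4 : ℝ) ≤ 0 by norm_num)
        rw [← Real.rpow_mul h0.le, ← Real.rpow_mul hl.le] at this
        norm_num at this ⊢
        exact this
      have h2 := mul_le_mul_of_nonneg_right h1 hp
      rw [← Real.rpow_add h0] at h2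
      have : 0 < l ^ (-4 : ℝ) := by positivity
      rw [show (1 / 2 + -(5 / 2) : ℝ) = -2 by norm_num] at h2
      linarith
  set g : E3 → E3 → ℝ := fun x y => f y * min (‖x - y‖ ^ (-2 : ℝ)) (l ^ (-4 : ℝ))
  have hgm : ∀ x, AEStronglyMeasurable (g x) := fun x =>
    (hf.measurable.mul (by fun_prop)).aestronglyMeasurable
  have hgb : ∀ x y, ‖g x y‖ ≤ f y * l ^ (-4 : ℝ) := fun x y => by
    have := hf0 y
    rw [Real.norm_of_nonneg (by positivity)]
    exact mul_le_mul_of_nonneg_left (min_le_right _ _) this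
  have hgt : Tendsto (fun x => ∫ y, g x y) (comap (fun x : E3 => ‖x‖) atTop) (𝓝 0) := by
    have := tendsto_integral_filter_of_dominated_convergence (μ := volume)
      (l := comap (fun x : E3 => ‖x‖) atTop) (F := g) (f := fun _ => 0) _
      (Eventually.of_forall hgm) (Eventually.of_forall fun x => ae_of_all _ (hgb x))
      (hfi.mul_const _) (ae_of_all _ fun y => ?_)
    · simpa using this
    · have h1 := (tendsto_rpow_neg_atTop (show (0 : ℝ) < 2 by norm_num)).comp
        (tendsto_norm_sub_atTop y)
      have h2 := (h1.min (tendsto_const_nhds (x := l ^ (-4 : ℝ)))).const_mul (f y)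
      rw [min_eq_left (by positivity), mul_zero] at h2
      exact h2
  filter_upwards [hgt.eventually_lt_const (show 0 < ε / 2 by positivity)] with x hx
  have hi := integrable_mul_rpow_neg hf hf0 hfi (p := 5 / 2) (by norm_num) (by norm_num) x
  have hb := integral_mul_rpow_neg_le hf hf0 hfi (p := 5 / 2) (by norm_num) (by norm_num) hS0 x
    fun y _ => hS y
  have hgi : Integrable (g x) := (hfi.mul_const _).mono' (hgm x) (ae_of_all _ (hgb x))
  calc pot f x ≤ ∫ y, (l * (f y * ‖x - y‖ ^ (-(5 / 2) : ℝ)) + g x y) := by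
        refine integral_mono (integrable_div_sq hf hf0 hfi x) ((hi.const_mul l).add hgi) fun y => ?_
        have := mul_le_mul_of_nonneg_left (hmin (x - y)) (hf0 y)
        simp only [div_sq_eq, g]
        linarith
    _ = l * (∫ y, f y * ‖x - y‖ ^ (-(5 / 2) : ℝ)) + ∫ y, g x y := by
        rw [integral_add (hi.const_mul l) hgi, integral_const_mul]
    _ < ε := by
        have := mul_le_mul_of_nonneg_left hb hl.le
        linarith

lemma tendsto_integral_div_norm_zero {f : E3 → ℝ} (hf : Continuous f) (hf0 : ∀ x, 0 ≤ f x)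
    (hfi : Integrable f) {S : ℝ} (hS0 : 0 ≤ S) (hS : ∀ x, f x ≤ S) :
    Tendsto (fun x => ∫ y, f y / ‖x - y‖) (comap (fun x : E3 => ‖x‖) atTop) (𝓝 0) := by
  set M := ∫ y, f y
  have hM : 0 ≤ M := integral_nonneg hf0
  refine tendsto_order.2 ⟨fun a ha => Eventually.of_forall fun x =>
    ha.trans_le (integral_nonneg fun y => by have := hf0 y; positivity), fun ε hε => ?_⟩
  obtain ⟨l, hl, hlM⟩ : ∃ l : ℝ, 0 < l ∧ l * M < ε / 2 := by
    refine ⟨ε / (2 * (M + 1)), by positivity, ?_⟩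
    rw [div_mul_eq_mul_div, div_lt_div_iff₀ (by positivity) (by norm_num)]
    nlinarith
  filter_upwards [(tendsto_pot_zero hf hf0 hfi hS0 hS).eventually_lt_const
    (show 0 < l * ε / 2 by positivity)] with x hx
  have hi := integrable_div_sq hf hf0 hfi x
  have h1 : ∫ y, f y / ‖x - y‖ ≤ ∫ y, (l * f y + l⁻¹ * (f y / ‖x - y‖ ^ 2)) := by
    refine integral_mono (integrable_div_norm hf hf0 hfi x) ((hfi.const_mul l).add (hi.const_mul _))
      fun y => ?_
    have h2 : ‖x - y‖⁻¹ ≤ l + l⁻¹ * (‖x - y‖⁻¹) ^ 2 := by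
      set a := ‖x - y‖⁻¹
      have h3 : 0 ≤ l⁻¹ * (l - a) ^ 2 := by positivity
      have h4 : l⁻¹ * (l - a) ^ 2 = l - 2 * a + l⁻¹ * a ^ 2 := by field_simp; ring
      have : 0 ≤ a := by positivity
      linarith
    have := mul_le_mul_of_nonneg_left h2 (hf0 y)
    simp only [div_eq_mul_inv, inv_pow] at this ⊢
    linarith
  rw [integral_add (hfi.const_mul l) (hi.const_mul _), integral_const_mul, integral_const_mul] at h1
  have h5 : l⁻¹ * pot f x < ε / 2 := by
    rw [inv_mul_lt_iff₀ hl]; linarith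
  simp only [pot] at h5
  linarith

lemma abs_log_div_le {a b : ℝ} (ha : 0 ≤ a) (hb : 0 ≤ b) :
    |log (b / a)| ≤ |a - b| * (1 / a + 1 / b) := by
  rcases eq_or_lt_of_le ha with h | ha
  · subst h; simp; positivity
  rcases eq_or_lt_of_le hb with h | hb
  · subst h; simp; positivity
  have h1 := log_le_sub_one_of_pos (div_pos hb ha)
  have h2 := log_le_sub_one_of_pos (div_pos ha hb)
  rw [← inv_div b a, log_inv, inv_div] at h2
  have e1 : b / a - 1 ≤ |a - b| * (1 / a) := by
    rw [mul_one_div, le_div_iff₀ ha, sub_mul, div_mul_cancel₀ _ ha.ne']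
    linarith [neg_abs_le (a - b)]
  have e2 : a / b - 1 ≤ |a - b| * (1 / b) := by
    rw [mul_one_div, le_div_iff₀ hb, sub_mul, div_mul_cancel₀ _ hb.ne']
    linarith [le_abs_self (a - b)]
  have p1 : 0 ≤ |a - b| * (1 / a) := by positivity
  have p2 : 0 ≤ |a - b| * (1 / b) := by positivity
  rw [abs_le, mul_add]
  constructor <;> linarith

/-- The logarithmic potential `∫ log (‖y‖ / ‖x - y‖) f y`. -/
noncomputable def logPot (f : E3 → ℝ) (x : E3) : ℝ := ∫ y, log (‖y‖ / ‖x - y‖) * f y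

lemma integrable_logPot {f : E3 → ℝ} (hf : Continuous f) (hf0 : ∀ x, 0 ≤ f x)
    (hfi : Integrable f) (x : E3) : Integrable (fun y => log (‖y‖ / ‖x - y‖) * f y) := by
  refine (((integrable_div_norm hf hf0 hfi x).add (integrable_div_norm hf hf0 hfi 0)).const_mul
    ‖x‖).mono' ((Measurable.mul (by fun_prop) hf.measurable).aestronglyMeasurable)
    (ae_of_all _ fun y => ?_)
  rw [norm_mul, Real.norm_of_nonneg (hf0 y), norm_eq_abs]
  have h1 := abs_log_div_le (norm_nonneg (x - y)) (norm_nonneg y)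
  have h2 : |‖x - y‖ - ‖y‖| ≤ ‖x‖ := by
    have := abs_norm_sub_norm_le (x - y) (-y)
    simpa using this
  have h3 := mul_le_mul_of_nonneg_right h2 (show 0 ≤ 1 / ‖x - y‖ + 1 / ‖y‖ by positivity)
  have := mul_le_mul_of_nonneg_right (h1.trans h3) (hf0 y)
  simp only [Pi.add_apply, zero_sub, norm_neg]
  refine this.trans (le_of_eq ?_)
  ring

/-- The kernel `z / ‖z‖²`. -/
noncomputable def invKer (z : E3) : E3 := (1 / ‖z‖ ^ 2) • z

lemma norm_invKer (z : E3) : ‖invKer z‖ = 1 / ‖z‖ := by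
  rw [invKer, norm_smul, Real.norm_of_nonneg (by positivity)]
  rcases eq_or_ne ‖z‖ 0 with h | h
  · simp [h]
  · field_simp

lemma norm_invKer_sub {z w : E3} (hz : z ≠ 0) (hw : w ≠ 0) :
    ‖invKer z - invKer w‖ = ‖z - w‖ / (‖z‖ * ‖w‖) := by
  have hz' := norm_pos_iff.2 hz
  have hw' := norm_pos_iff.2 hw
  rw [← sq_eq_sq₀ (norm_nonneg _) (by positivity), norm_sub_sq_real, div_pow, norm_sub_sq_real,
    norm_invKer, norm_invKer, invKer, invKer, inner_smul_left, inner_smul_right]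
  simp only [conj_trivial]
  field_simp
  ring

lemma abs_log_norm_add_sub_le {z h : E3} (hz : z ≠ 0) (hzh : z + h ≠ 0) :
    |log ‖z + h‖ - log ‖z‖ - inner ℝ (invKer z) h| ≤
      ‖h‖ ^ 2 * (2 * (1 / ‖z‖ ^ 2 + 1 / ‖z + h‖ ^ 2)) := by
  have ha := norm_pos_iff.2 hz
  have hb := norm_pos_iff.2 hzh
  have ht := abs_real_inner_le_norm z h
  have hsq := norm_add_sq_real z h
  have hab : |‖z‖ - ‖z + h‖| ≤ ‖h‖ := by
    have := abs_norm_sub_norm_le z (z + h)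
    simpa using this
  rw [invKer, inner_smul_left]
  simp only [conj_trivial]
  set t := inner ℝ z h
  set a := ‖z‖
  set b := ‖z + h‖
  set n := ‖h‖
  have hn : 0 ≤ n := norm_nonneg _
  have hl : log b - log a = 1 / 2 * log (b ^ 2 / a ^ 2) := by
    rw [log_div (by positivity) (by positivity), log_pow, log_pow]; push_cast; ring
  have h1 := log_le_sub_one_of_pos (show 0 < b ^ 2 / a ^ 2 by positivity)
  have h2 := log_le_sub_one_of_pos (show 0 < a ^ 2 / b ^ 2 by positivity)
  rw [← inv_div (b ^ 2), log_inv, inv_div] at h2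
  have p1 : 0 ≤ n ^ 2 * (1 / a ^ 2) := by positivity
  have p2 : 0 ≤ n ^ 2 * (1 / b ^ 2) := by positivity
  have e1 : b ^ 2 / a ^ 2 - 1 = 2 * (1 / a ^ 2 * t) + n ^ 2 * (1 / a ^ 2) := by
    rw [hsq]; field_simp; ring
  have e2 : 1 - a ^ 2 / b ^ 2 = 2 * (1 / a ^ 2 * t) + n ^ 2 * (1 / b ^ 2)
      + 2 * (t * (a ^ 2 - b ^ 2) / (a ^ 2 * b ^ 2)) := by
    have : n ^ 2 = b ^ 2 - a ^ 2 - 2 * t := by linarith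
    rw [this]; field_simp; ring
  have h3 : |t * (a ^ 2 - b ^ 2) / (a ^ 2 * b ^ 2)| ≤ n ^ 2 * (2 * (1 / b ^ 2) + 1 / a ^ 2) := by
    have h4 : |t * (a ^ 2 - b ^ 2)| ≤ (a * n) * (n * (a + b)) := by
      rw [abs_mul, sq_sub_sq, mul_comm (a + b), abs_mul (a - b), abs_of_pos (add_pos ha hb)]
      gcongr
    rw [abs_div, abs_of_pos (show 0 < a ^ 2 * b ^ 2 by positivity), div_le_iff₀ (by positivity)]
    refine h4.trans ?_
    have : n ^ 2 * (2 * (1 / b ^ 2) + 1 / a ^ 2) * (a ^ 2 * b ^ 2) = n ^ 2 * (2 * a ^ 2 + b ^ 2) := by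
      field_simp
    rw [this, show a * n * (n * (a + b)) = n ^ 2 * (a ^ 2 + a * b) by ring]
    refine mul_le_mul_of_nonneg_left ?_ (sq_nonneg n)
    nlinarith [sq_nonneg (a - b)]
  have h5 := neg_abs_le (t * (a ^ 2 - b ^ 2) / (a ^ 2 * b ^ 2))
  rw [hl, abs_le]
  constructor <;> linarith

lemma integrable_invKer {f : E3 → ℝ} (hf : Continuous f) (hf0 : ∀ x, 0 ≤ f x)
    (hfi : Integrable f) (x : E3) : Integrable (fun y => f y • invKer (x - y)) := by
  refine (integrable_div_norm hf hf0 hfi x).mono' ?_ (ae_of_all _ fun y => ?_)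
  · refine Measurable.aestronglyMeasurable (hf.measurable.smul ?_)
    unfold invKer
    fun_prop
  · rw [norm_smul, Real.norm_of_nonneg (hf0 y), norm_invKer, mul_one_div]

lemma norm_integral_invKer_le {f : E3 → ℝ} (hf0 : ∀ x, 0 ≤ f x) (x : E3) :
    ‖∫ y, f y • invKer (x - y)‖ ≤ ∫ y, f y / ‖x - y‖ := by
  refine (norm_integral_le_integral_norm _).trans (le_of_eq ?_)
  congr 1
  ext y
  rw [norm_smul, Real.norm_of_nonneg (hf0 y), norm_invKer, mul_one_div]

lemma ae_ne (x : E3) : ∀ᵐ y : E3, y ≠ x := by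
  simp [ae_iff]

lemma norm_integral_invKer_sub_le {f : E3 → ℝ} (hf : Continuous f) (hf0 : ∀ x, 0 ≤ f x)
    (hfi : Integrable f) (x x' : E3) :
    ‖(∫ y, f y • invKer (x' - y)) - ∫ y, f y • invKer (x - y)‖ ≤
      (pot f x' + pot f x) * ‖x' - x‖ := by
  rw [← integral_sub (integrable_invKer hf hf0 hfi x') (integrable_invKer hf hf0 hfi x), pot, pot,
    ← integral_add (integrable_div_sq hf hf0 hfi x') (integrable_div_sq hf hf0 hfi x),
    ← integral_mul_const]
  refine norm_integral_le_of_norm_le (((integrable_div_sq hf hf0 hfi x').add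
    (integrable_div_sq hf hf0 hfi x)).mul_const _) ?_
  filter_upwards [ae_ne x, ae_ne x'] with y hy hy'
  have hz := sub_ne_zero.2 hy.symm
  have hz' := sub_ne_zero.2 hy'.symm
  rw [← smul_sub, norm_smul, Real.norm_of_nonneg (hf0 y), norm_invKer_sub hz' hz,
    sub_sub_sub_cancel_right]
  have ha := norm_pos_iff.2 hz
  have hb := norm_pos_iff.2 hz'
  set a := ‖x - y‖
  set b := ‖x' - y‖
  have h1 : 1 / (b * a) ≤ 1 / b ^ 2 + 1 / a ^ 2 := by
    have e1 : 1 / b ^ 2 + 1 / a ^ 2 - 1 / (b * a) = ((b - a) ^ 2 + a * b) / (b ^ 2 * a ^ 2) := by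
      field_simp; ring
    have : 0 ≤ ((b - a) ^ 2 + a * b) / (b ^ 2 * a ^ 2) := by positivity
    linarith
  have := mul_le_mul_of_nonneg_left h1 (mul_nonneg (hf0 y) (norm_nonneg (x' - x)))
  refine (le_of_eq ?_).trans (this.trans (le_of_eq ?_)) <;> ring

lemma hasGradientAt_logPot {f : E3 → ℝ} (hf : Continuous f) (hf0 : ∀ x, 0 ≤ f x)
    (hfi : Integrable f) {q : ℝ} (hq : ∀ x, pot f x ≤ q) (x : E3) :
    HasGradientAt (logPot f) (-∫ y, f y • invKer (x - y)) x := by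
  rw [hasGradientAt_iff_hasFDerivAt, hasFDerivAt_iff_isLittleO_nhds_zero]
  have key : ∀ h : E3, ‖logPot f (x + h) - logPot f x -
      (InnerProductSpace.toDual ℝ E3 (-∫ y, f y • invKer (x - y))) h‖ ≤ (4 * q) * ‖‖h‖ ^ 2‖ := by
    intro h
    have hK := integrable_invKer hf hf0 hfi x
    have hin : inner ℝ (∫ y, f y • invKer (x - y)) h = ∫ y, inner ℝ h (f y • invKer (x - y)) := by
      rw [real_inner_comm, integral_inner hK]
    have hKi : Integrable fun y => inner ℝ h (f y • invKer (x - y)) := hK.const_inner h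
    rw [map_neg, neg_apply, InnerProductSpace.toDual_apply_apply, hin, sub_neg_eq_add,
      logPot, logPot, ← integral_sub' (integrable_logPot hf hf0 hfi _) (integrable_logPot hf hf0 hfi _),
      ← integral_add' ((integrable_logPot hf hf0 hfi _).sub (integrable_logPot hf hf0 hfi _)) hKi]
    have hbi := (((integrable_div_sq hf hf0 hfi x).add
      (integrable_div_sq hf hf0 hfi (x + h))).const_mul (2 * ‖h‖ ^ 2))
    refine (norm_integral_le_of_norm_le hbi ?_).trans ?_
    · filter_upwards [ae_ne x, ae_ne (x + h), ae_ne 0] with y hy hy' hy0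
      have hz := sub_ne_zero.2 hy.symm
      have hz' : x - y + h ≠ 0 := by
        have := sub_ne_zero.2 hy'.symm
        rwa [sub_add_eq_add_sub]
      have e : x + h - y = x - y + h := by abel
      have h1 := abs_log_norm_add_sub_le hz hz'
      have h2 := mul_le_mul_of_nonneg_right h1 (hf0 y)
      simp only [Pi.add_apply, Pi.sub_apply]
      rw [e, log_div (norm_ne_zero_iff.2 hy0) (norm_ne_zero_iff.2 hz'),
        log_div (norm_ne_zero_iff.2 hy0) (norm_ne_zero_iff.2 hz), inner_smul_right,
        real_inner_comm, norm_eq_abs, ← abs_neg]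
      rw [← abs_of_nonneg (hf0 y), ← abs_mul, abs_of_nonneg (hf0 y)] at h2
      refine (le_of_eq ?_).trans (h2.trans (le_of_eq ?_))
      · congr 1; ring
      · ring
    · rw [integral_const_mul, integral_add' (integrable_div_sq hf hf0 hfi x)
        (integrable_div_sq hf hf0 hfi _), Real.norm_of_nonneg (by positivity)]
      have h1 := hq x
      have h2 := hq (x + h)
      simp only [pot] at h1 h2
      nlinarith [sq_nonneg ‖h‖]
  refine (Asymptotics.IsBigO.of_bound _ (Eventually.of_forall key)).trans_isLittleO ?_
  have := (Asymptotics.isLittleO_norm_pow_id (E' := E3) (n := 2) (by norm_num))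
  exact this

lemma logPot_add_le {f : E3 → ℝ} (hf : Continuous f) (hf0 : ∀ x, 0 ≤ f x)
    (hfi : Integrable f) {S : ℝ} (hS0 : 0 ≤ S) (hS : ∀ x, f x ≤ S) {c : ℝ} (hc : 0 < c) :
    ∀ᶠ x in comap (fun x : E3 => ‖x‖) atTop,
      logPot f x + (∫ y, f y) * log ‖x‖ ≤ c * log ‖x‖ := by
  set g : E3 → E3 → ℝ := fun x y => f y * min 3 (2 * log (1 + ‖y‖) / log ‖x‖)
  have hgm : ∀ x, AEStronglyMeasurable (g x) := fun x =>
    (hf.measurable.mul (by fun_prop)).aestronglyMeasurable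
  have hgb : ∀ x : E3, 2 ≤ ‖x‖ → ∀ y, ‖g x y‖ ≤ f y * 3 := fun x hx y => by
    have h1 : 0 < log ‖x‖ := log_pos (by linarith)
    have h2 : 0 ≤ log (1 + ‖y‖) := log_nonneg (by linarith [norm_nonneg y])
    have := hf0 y
    rw [Real.norm_of_nonneg (by positivity)]
    exact mul_le_mul_of_nonneg_left (min_le_left _ _) this
  have hx2 : ∀ᶠ x in comap (fun x : E3 => ‖x‖) atTop, 2 ≤ ‖x‖ :=
    tendsto_comap.eventually_ge_atTop 2
  have hgt : Tendsto (fun x => ∫ y, g x y) (comap (fun x : E3 => ‖x‖) atTop) (𝓝 0) := by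
    have := tendsto_integral_filter_of_dominated_convergence (μ := volume)
      (l := comap (fun x : E3 => ‖x‖) atTop) (F := g) (f := fun _ => 0) _
      (Eventually.of_forall hgm) (hx2.mono fun x hx => ae_of_all _ (hgb x hx))
      (hfi.mul_const _) (ae_of_all _ fun y => ?_)
    · simpa using this
    · have h1 : Tendsto (fun x : E3 => 2 * log (1 + ‖y‖) / log ‖x‖)
          (comap (fun x : E3 => ‖x‖) atTop) (𝓝 0) :=
        (tendsto_log_atTop.comp tendsto_comap).const_div_atTop _
      have h2 := ((tendsto_const_nhds (x := (3 : ℝ))).min h1).const_mul (f y)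
      rw [min_eq_right (by norm_num), mul_zero] at h2
      exact h2
  have hl2 : 0 < log 2 := log_pos (by norm_num)
  filter_upwards [hx2, hgt.eventually_lt_const (half_pos hc),
    (tendsto_integral_div_norm_zero hf hf0 hfi hS0 hS).eventually_lt_const
      (show 0 < c / 2 * log 2 by positivity)] with x hx h1 h2
  have hlx : log 2 ≤ log ‖x‖ := log_le_log (by norm_num) hx
  have hgi : Integrable (g x) := (hfi.mul_const _).mono' (hgm x) (ae_of_all _ (hgb x hx))
  have hi := integrable_div_norm hf hf0 hfi x
  have h3 : logPot f x + (∫ y, f y) * log ‖x‖ ≤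
      (∫ y, f y / ‖x - y‖) + (∫ y, g x y) * log ‖x‖ := by
    rw [logPot, ← integral_mul_const, ← integral_mul_const,
      ← integral_add (integrable_logPot hf hf0 hfi x) (hfi.mul_const _),
      ← integral_add hi (hgi.mul_const _)]
    refine integral_mono_ae ((integrable_logPot hf hf0 hfi x).add (hfi.mul_const _))
      (hi.add (hgi.mul_const _)) ?_
    filter_upwards [ae_ne 0, ae_ne x] with y hy0 hyx
    have ha := norm_pos_iff.2 (sub_ne_zero.2 hyx.symm)
    have hy := norm_pos_iff.2 hy0
    rw [log_div hy.ne' ha.ne']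
    have t1 : ‖y‖ ≤ ‖x‖ + ‖x - y‖ := by
      have := norm_sub_le x (x - y); simpa using this
    have t2 : ‖x‖ ≤ ‖x - y‖ + ‖y‖ := by
      have := norm_add_le (x - y) y; simpa using this
    set a := ‖x - y‖
    set m := max a 1
    have hm1 : 1 ≤ m := le_max_right _ _
    have hma : a ≤ m := le_max_left _ _
    have hlm : log m - 1 / a ≤ log a := by
      rcases le_total 1 a with h | h
      · rw [show m = a from max_eq_left h]
        have : 0 < 1 / a := by positivity
        linarith
      · rw [show m = 1 from max_eq_right h, log_one]
        have := log_le_sub_one_of_pos (show 0 < 1 / a by positivity)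
        rw [one_div, log_inv] at this
        rw [one_div]; linarith
    have b1 : log ‖y‖ ≤ log 2 + log ‖x‖ + log m := by
      rw [← log_mul (by norm_num) (by linarith), ← log_mul (by positivity) (by linarith)]
      refine log_le_log hy ?_
      nlinarith
    have b2 : log ‖x‖ ≤ log m + log (1 + ‖y‖) := by
      rw [← log_mul (by linarith) (by linarith)]
      refine log_le_log (by linarith) ?_
      nlinarith
    have b3 : log ‖y‖ ≤ log (1 + ‖y‖) := log_le_log hy (by linarith)
    have b4 : log ‖y‖ + log ‖x‖ - log m ≤ min 3 (2 * log (1 + ‖y‖) / log ‖x‖) * log ‖x‖ := by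
      rw [min_mul_of_nonneg _ _ (by linarith), div_mul_cancel₀ _ (by linarith)]
      refine le_min ?_ ?_ <;> linarith
    have b5 : log ‖y‖ - log a + log ‖x‖ ≤
      1 / a + min 3 (2 * log (1 + ‖y‖) / log ‖x‖) * log ‖x‖ := by linarith
    have := mul_le_mul_of_nonneg_left b5 (hf0 y)
    simp only [g]
    refine (le_of_eq ?_).trans (this.trans (le_of_eq ?_)) <;> ring
  have h4 := mul_le_mul_of_nonneg_right h1.le (show 0 ≤ log ‖x‖ by linarith)
  have h5 := mul_le_mul_of_nonneg_left hlx (show 0 ≤ c / 2 by positivity)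
  linarith

lemma logPot_conclusion {f : E3 → ℝ} (hf : Continuous f) (hf0 : ∀ x, 0 ≤ f x)
    (hfi : Integrable f) {S : ℝ} (hS0 : 0 ≤ S) (hS : ∀ x, f x ≤ S) :
    Tendsto (fun x : E3 => ‖gradient (logPot f) x‖) (comap (fun x : E3 => ‖x‖) atTop) (𝓝 0) ∧
    Tendsto (fun x : E3 => ‖iteratedFDeriv ℝ 2 (logPot f) x‖)
      (comap (fun x : E3 => ‖x‖) atTop) (𝓝 0) := by
  obtain ⟨q, hq0, hq⟩ := exists_pot_le hf hf0 hfi hS0 hS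
  have hg := hasGradientAt_logPot hf hf0 hfi hq
  constructor
  · refine squeeze_zero (fun _ => norm_nonneg _) (fun x => ?_)
      (tendsto_integral_div_norm_zero hf hf0 hfi hS0 hS)
    rw [(hg x).gradient, norm_neg]
    exact norm_integral_invKer_le hf0 x
  · refine tendsto_order.2 ⟨fun a ha => Eventually.of_forall fun x =>
      ha.trans_le (norm_nonneg _), fun ε hε => ?_⟩
    have hev := (tendsto_pot_zero hf hf0 hfi hS0 hS).eventually_lt_const
      (show 0 < ε / 3 by positivity)
    obtain ⟨R, hR⟩ := eventually_atTop.1 (eventually_comap.1 hev)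
    filter_upwards [tendsto_comap.eventually_gt_atTop R] with x hx
    rw [← norm_iteratedFDeriv_fderiv, norm_iteratedFDeriv_one]
    refine lt_of_le_of_lt (norm_fderiv_le_of_lip' ℝ (C := 2 * ε / 3) (by positivity) ?_)
      (by linarith)
    filter_upwards [continuous_norm.continuousAt.eventually_const_lt hx] with x' hx'
    rw [(hg x').hasFDerivAt.fderiv, (hg x).hasFDerivAt.fderiv, ← map_sub,
      LinearIsometryEquiv.norm_map, neg_sub_neg, norm_sub_rev]
    refine (norm_integral_invKer_sub_le hf hf0 hfi x x').trans ?_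
    refine mul_le_mul_of_nonneg_right ?_ (norm_nonneg _)
    have h1 := hR _ hx.le x rfl
    have h2 := hR _ hx'.le x' rfl
    linarith

/-- The truncated power `max 0 (1 - ‖z‖²) ^ k`. -/
noncomputable def bumpPow (k : ℕ) (z : E3) : ℝ := max 0 (1 - ‖z‖ ^ 2) ^ k

lemma bumpPow_nonneg (k : ℕ) (z : E3) : 0 ≤ bumpPow k z := by unfold bumpPow; positivity

lemma bumpPow_le_one (k : ℕ) (z : E3) : bumpPow k z ≤ 1 :=
  pow_le_one₀ (le_max_left _ _) (max_le zero_le_one (by linarith [sq_nonneg ‖z‖]))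

lemma continuous_bumpPow (k : ℕ) : Continuous (bumpPow k) := by
  unfold bumpPow; fun_prop

lemma bumpPow_eq_zero {k : ℕ} (hk : k ≠ 0) {z : E3} (hz : z ∉ Metric.closedBall (0 : E3) 1) :
    bumpPow k z = 0 := by
  have h : 1 < ‖z‖ := by simpa using hz
  rw [bumpPow, max_eq_left (by nlinarith), zero_pow hk]

lemma integrable_mul_bumpPow {k : ℕ} (hk : k ≠ 0) {g : E3 → ℝ} (hg : Continuous g) :
    Integrable fun z => g z * bumpPow k z := by
  refine (hg.mul (continuous_bumpPow k)).integrable_of_hasCompactSupport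
    (HasCompactSupport.intro (isCompact_closedBall (0 : E3) 1) fun z hz => ?_)
  rw [Pi.mul_apply, bumpPow_eq_zero hk hz, mul_zero]

lemma integrable_bumpPow {k : ℕ} (hk : k ≠ 0) : Integrable (bumpPow k) := by
  simpa using integrable_mul_bumpPow hk (g := fun _ => 1) continuous_const

lemma hasDerivAt_max_pow (s : ℝ) : HasDerivAt (fun s : ℝ => max 0 s ^ 3) (3 * max 0 s ^ 2) s := by
  refine hasDerivAt_of_hasDerivAt_of_ne' (x := 0) (g := fun s => 3 * max 0 s ^ 2) (fun y hy => ?_)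
    (by fun_prop) (by fun_prop) s
  rcases lt_or_gt_of_ne hy with h | h
  · rw [max_eq_left h.le]
    refine (hasDerivAt_const y (0 : ℝ)).congr_deriv (by norm_num) |>.congr_of_eventuallyEq ?_
    filter_upwards [eventually_lt_nhds h] with t ht
    rw [max_eq_left ht.le]; norm_num
  · rw [max_eq_right h.le]
    refine (hasDerivAt_pow 3 y).congr_deriv (by norm_num) |>.congr_of_eventuallyEq ?_
    filter_upwards [eventually_gt_nhds h] with t ht
    rw [max_eq_right ht.le]

lemma hasFDerivAt_bumpPow (z : E3) :
    HasFDerivAt (bumpPow 3) ((-6 * bumpPow 2 z) • innerSL ℝ z) z := by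
  have h1 : HasFDerivAt (fun z : E3 => 1 - ‖z‖ ^ 2) (-(2 • innerSL ℝ z)) z :=
    (hasStrictFDerivAt_norm_sq z).hasFDerivAt.const_sub 1
  refine ((hasDerivAt_max_pow _).comp_hasFDerivAt z h1).congr_fderiv ?_
  ext y
  simp [bumpPow]
  ring

lemma sum_mul_fderiv (L : E3 →L[ℝ] ℝ) (z : E3) :
    ∑ i, z i * L (EuclideanSpace.single i 1) = L z := by
  have h := (EuclideanSpace.basisFun (Fin 3) ℝ).sum_repr z
  simp only [EuclideanSpace.basisFun_repr, EuclideanSpace.basisFun_apply] at h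
  conv_rhs => rw [← h]
  simp [map_sum]

section average

variable {u : E3 → ℝ} (hu : ContDiff ℝ (⊤ : ℕ∞) u)

include hu

lemma contDiff_partial (i : Fin 3) :
    ContDiff ℝ (⊤ : ℕ∞) (fun y => fderiv ℝ u y (EuclideanSpace.single i 1)) :=
  (hu.fderiv_right (m := (⊤ : ℕ∞)) (by simp)).clm_apply contDiff_const

lemma continuous_lap : Continuous (lap u) := by
  refine continuous_finsetSum _ fun i _ => ?_
  have := (contDiff_partial hu i).fderiv_right (m := (⊤ : ℕ∞)) (by simp)
  exact (this.clm_apply contDiff_const).continuous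

lemma integral_fderiv_mul_bumpPow (x : E3) (r : ℝ) :
    ∫ z, fderiv ℝ u (x + r • z) z * bumpPow 2 z =
      (1 / 6) * (r * ∫ z, lap u (x + r • z) * bumpPow 3 z) := by
  set D : Fin 3 → E3 → ℝ := fun i y => fderiv ℝ u y (EuclideanSpace.single i 1)
  have hD : ∀ i, ContDiff ℝ (⊤ : ℕ∞) (D i) := contDiff_partial hu
  have hDf : ∀ i, Continuous fun y => fderiv ℝ (D i) y (EuclideanSpace.single i 1) := fun i =>
    (((hD i).fderiv_right (m := (⊤ : ℕ∞)) (by simp)).clm_apply contDiff_const).continuous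
  have ha : Continuous fun z : E3 => x + r • z := by fun_prop
  have hcomp : ∀ i z, HasFDerivAt (fun z => D i (x + r • z))
      ((fderiv ℝ (D i) (x + r • z)).comp (r • ContinuousLinearMap.id ℝ E3)) z := fun i z => by
    have h1 : HasFDerivAt (fun z : E3 => x + r • z) (r • ContinuousLinearMap.id ℝ E3) z :=
      ((hasFDerivAt_id z).const_smul r).const_add x
    exact HasFDerivAt.comp z (((hD i).differentiable (by simp)) (x + r • z)).hasFDerivAt h1
  have hparts : ∀ i, ∫ z : E3, z i * D i (x + r • z) * bumpPow 2 z =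
      (1 / 6) * (r * ∫ z, fderiv ℝ (D i) (x + r • z) (EuclideanSpace.single i 1) * bumpPow 3 z) := by
    intro i
    have e1 : ∀ z : E3, D i (x + r • z) * fderiv ℝ (bumpPow 3) z (EuclideanSpace.single i 1) =
        -6 * (z i * D i (x + r • z) * bumpPow 2 z) := fun z => by
      simp only [(hasFDerivAt_bumpPow z).fderiv, FunLike.coe_smul, Pi.smul_apply, smul_eq_mul,
        innerSL_apply_apply, EuclideanSpace.inner_single_right, conj_trivial, one_mul]
      ring
    have e2 : ∀ z : E3, fderiv ℝ (fun z => D i (x + r • z)) z (EuclideanSpace.single i 1) *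
        bumpPow 3 z =
        r * (fderiv ℝ (D i) (x + r • z) (EuclideanSpace.single i 1) * bumpPow 3 z) := fun z => by
      simp only [(hcomp i z).fderiv, ContinuousLinearMap.comp_apply, FunLike.coe_smul,
        Pi.smul_apply, smul_eq_mul, ContinuousLinearMap.id_apply, map_smul]
      ring
    have h := integral_mul_fderiv_eq_neg_fderiv_mul_of_integrable (μ := (volume : Measure E3))
      (f := fun z => D i (x + r • z)) (g := bumpPow 3) (v := EuclideanSpace.single i 1) ?_ ?_ ?_
      (fun z _ => (hcomp i z).differentiableAt)
      (fun z _ => (hasFDerivAt_bumpPow z).differentiableAt)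
    · simp only [e1, e2] at h
      rw [integral_const_mul, integral_const_mul] at h
      linarith
    · simp only [e2]
      exact (integrable_mul_bumpPow (by norm_num) ((hDf i).comp ha)).const_mul r
    · simp only [e1]
      exact (integrable_mul_bumpPow (by norm_num)
        (by have := (hD i).continuous; fun_prop)).const_mul (-6)
    · exact integrable_mul_bumpPow (by norm_num) ((hD i).continuous.comp ha)
  have hi1 : ∀ i, Integrable fun z : E3 => z i * D i (x + r • z) * bumpPow 2 z := fun i =>
    integrable_mul_bumpPow (by norm_num) (by have := (hD i).continuous; fun_prop)
  have hi2 : ∀ i, Integrable fun z : E3 =>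
      fderiv ℝ (D i) (x + r • z) (EuclideanSpace.single i 1) * bumpPow 3 z := fun i =>
    integrable_mul_bumpPow (by norm_num) ((hDf i).comp ha)
  calc ∫ z, fderiv ℝ u (x + r • z) z * bumpPow 2 z
      = ∫ z : E3, ∑ i, z i * D i (x + r • z) * bumpPow 2 z := by
        congr 1; ext z
        rw [← Finset.sum_mul, sum_mul_fderiv]
    _ = _ := by
        rw [integral_finsetSum _ fun i _ => hi1 i]
        simp only [hparts]
        rw [← Finset.mul_sum, ← Finset.mul_sum, ← integral_finsetSum _ fun i _ => hi2 i]
        simp only [lap, Finset.sum_mul, D]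

lemma hasDerivAt_average (x : E3) (r₀ : ℝ) :
    HasDerivAt (fun r : ℝ => ∫ z, u (x + r • z) * bumpPow 2 z)
      (∫ z, fderiv ℝ u (x + r₀ • z) z * bumpPow 2 z) r₀ := by
  have hdu : Continuous (fderiv ℝ u) := hu.continuous_fderiv (by simp)
  have hc : Continuous fun p : ℝ × E3 => fderiv ℝ u (x + p.1 • p.2) p.2 := by fun_prop
  obtain ⟨C, hC⟩ := ((isCompact_closedBall r₀ 1).prod
    (isCompact_closedBall (0 : E3) 1)).exists_bound_of_continuousOn hc.continuousOn
  have hcont := hu.continuous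
  refine (hasDerivAt_integral_of_dominated_loc_of_deriv_le (μ := volume)
    (F := fun (r : ℝ) z => u (x + r • z) * bumpPow 2 z)
    (F' := fun (r : ℝ) z => fderiv ℝ u (x + r • z) z * bumpPow 2 z)
    (bound := fun z => C * bumpPow 2 z) (Metric.closedBall_mem_nhds r₀ one_pos) ?_ ?_ ?_ ?_ ?_ ?_).2
  · exact Eventually.of_forall fun r =>
      (integrable_mul_bumpPow (by norm_num) (by fun_prop)).aestronglyMeasurable
  · exact integrable_mul_bumpPow (by norm_num) (by fun_prop)
  · exact (integrable_mul_bumpPow (by norm_num) (by fun_prop)).aestronglyMeasurable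
  · refine ae_of_all _ fun z r hr => ?_
    by_cases hz : z ∈ Metric.closedBall (0 : E3) 1
    · rw [norm_mul, Real.norm_of_nonneg (bumpPow_nonneg _ _)]
      exact mul_le_mul_of_nonneg_right (hC (r, z) ⟨hr, hz⟩) (bumpPow_nonneg _ _)
    · simp [bumpPow_eq_zero (k := 2) (by norm_num) hz]
  · exact (integrable_bumpPow (by norm_num)).const_mul C
  · refine ae_of_all _ fun z r _ => ?_
    have h1 : HasDerivAt (fun r : ℝ => x + r • z) z r := by
      simpa using ((hasDerivAt_id r).smul_const z).const_add x
    exact ((hu.differentiable (by simp) (x + r • z)).hasFDerivAt.comp_hasDerivAt r h1).mul_const _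

lemma continuous_integral_lap (x : E3) :
    Continuous fun r : ℝ => r * ∫ z, lap u (x + r • z) * bumpPow 3 z := by
  have hl := continuous_lap hu
  have hb := continuous_bumpPow 3
  have h := continuous_parametric_integral_of_continuous (μ := (volume : Measure E3))
    (f := fun (r : ℝ) (z : E3) => lap u (x + r • z) * bumpPow 3 z)
    (by simp only [Function.uncurry_def]; fun_prop) (isCompact_closedBall (0 : E3) 1)
  have e : (fun r : ℝ => ∫ z in Metric.closedBall (0 : E3) 1, lap u (x + r • z) * bumpPow 3 z) =
      fun r : ℝ => ∫ z, lap u (x + r • z) * bumpPow 3 z := by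
    ext r
    refine setIntegral_eq_integral_of_forall_compl_eq_zero fun z hz => ?_
    rw [bumpPow_eq_zero (by norm_num) hz, mul_zero]
  rw [e] at h
  exact continuous_id.mul h

lemma average_representation (x : E3) :
    u x * (∫ z, bumpPow 2 z) = (∫ z, u (x + z) * bumpPow 2 z) +
      (1 / 6) * ∫ r in (0 : ℝ)..1, r * ∫ z, (-lap u (x + r • z)) * bumpPow 3 z := by
  have h := intervalIntegral.integral_eq_sub_of_hasDerivAt (a := 0) (b := 1)
    (fun r _ => hasDerivAt_average hu x r) (by
      simp only [integral_fderiv_mul_bumpPow hu]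
      exact ((continuous_integral_lap hu x).const_mul _).intervalIntegrable _ _)
  simp only [integral_fderiv_mul_bumpPow hu, one_smul, zero_smul, add_zero] at h
  rw [intervalIntegral.integral_const_mul, integral_const_mul] at h
  simp only [neg_mul, integral_neg, mul_neg, intervalIntegral.integral_neg]
  linarith

end average

lemma bumpPow_div_le {r : ℝ} (hr : 0 < r) (ζ z : E3) :
    bumpPow 3 z / ‖ζ + r • z‖ ^ 2 ≤
      5 / (‖ζ‖ ^ 2 + r ^ 2) * (cutKer 2 (r⁻¹ • ζ + z) + bumpPow 3 z) := by
  have hc := cutKer_nonneg 2 (r⁻¹ • ζ + z)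
  have hb := bumpPow_nonneg 3 z
  by_cases hz : z ∈ Metric.closedBall (0 : E3) 1
  swap
  · rw [bumpPow_eq_zero (by norm_num) hz, zero_div]; positivity
  have hz1 : ‖z‖ ≤ 1 := by simpa using hz
  have hrz : ‖r • z‖ ≤ r := by
    rw [norm_smul, Real.norm_of_nonneg hr.le]; nlinarith
  rcases le_total (2 * r) ‖ζ‖ with h | h
  · have h1 : ‖ζ‖ / 2 ≤ ‖ζ + r • z‖ := by
      have := norm_sub_norm_le ζ (-(r • z))
      rw [norm_neg, sub_neg_eq_add] at this
      linarith
    have h2 : (‖ζ‖ / 2) ^ 2 ≤ ‖ζ + r • z‖ ^ 2 := pow_le_pow_left₀ (by positivity) h1 2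
    have h3 : bumpPow 3 z / ‖ζ + r • z‖ ^ 2 ≤ 5 / (‖ζ‖ ^ 2 + r ^ 2) * bumpPow 3 z := by
      rw [div_mul_eq_mul_div, div_le_div_iff₀ (by nlinarith) (by positivity)]
      have h4 : ‖ζ‖ ^ 2 + r ^ 2 ≤ 5 * ‖ζ + r • z‖ ^ 2 := by nlinarith
      nlinarith
    have : 0 ≤ 5 / (‖ζ‖ ^ 2 + r ^ 2) * cutKer 2 (r⁻¹ • ζ + z) := by positivity
    linarith
  · have h1 : ζ + r • z = r • (r⁻¹ • ζ + z) := by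
      rw [smul_add, smul_inv_smul₀ hr.ne']
    rw [h1, norm_smul, Real.norm_of_nonneg hr.le, mul_pow]
    set b := r⁻¹ • ζ + z
    have h2 : bumpPow 3 z / ‖b‖ ^ 2 ≤ cutKer 2 b + bumpPow 3 z := by
      rw [div_sq_eq]
      by_cases hb1 : ‖b‖ < 1
      · rw [cutKer_of_mem hb1]
        have := mul_le_mul_of_nonneg_right (bumpPow_le_one 3 z)
          (show 0 ≤ ‖b‖ ^ (-2 : ℝ) by positivity)
        linarith
      · have := Real.rpow_le_one_of_one_le_of_nonpos (not_lt.1 hb1)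
          (show (-2 : ℝ) ≤ 0 by norm_num)
        nlinarith
    have h3 : 1 / r ^ 2 ≤ 5 / (‖ζ‖ ^ 2 + r ^ 2) := by
      rw [div_le_div_iff₀ (by positivity) (by positivity)]
      nlinarith [norm_nonneg ζ]
    calc bumpPow 3 z / (r ^ 2 * ‖b‖ ^ 2) = 1 / r ^ 2 * (bumpPow 3 z / ‖b‖ ^ 2) := by
          rw [div_mul_div_comm, one_mul]
      _ ≤ _ := by gcongr

/-- The constant in the bound for spherical averages of the potential. -/
noncomputable def avgConst : ℝ := 5 * ((∫ z, cutKer 2 z) + ∫ z, bumpPow 3 z)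

lemma avgConst_nonneg : 0 ≤ avgConst := by
  have h1 : 0 ≤ ∫ z, cutKer 2 z := integral_nonneg fun z => cutKer_nonneg 2 z
  have h2 : 0 ≤ ∫ z, bumpPow 3 z := integral_nonneg fun z => bumpPow_nonneg 3 z
  unfold avgConst
  positivity

lemma integral_bumpPow_div_le {r : ℝ} (hr : 0 < r) (ζ : E3) :
    Integrable (fun z => bumpPow 3 z / ‖ζ + r • z‖ ^ 2) ∧
      ∫ z, bumpPow 3 z / ‖ζ + r • z‖ ^ 2 ≤ avgConst / (‖ζ‖ ^ 2 + r ^ 2) := by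
  have hc := (integrable_cutKer (p := 2) (by norm_num)).comp_add_left (r⁻¹ • ζ)
  have hb := integrable_bumpPow (k := 3) (by norm_num)
  have hi := (hc.add hb).const_mul (5 / (‖ζ‖ ^ 2 + r ^ 2))
  have hI : Integrable (fun z => bumpPow 3 z / ‖ζ + r • z‖ ^ 2) := by
    refine hi.mono' ?_ (ae_of_all _ fun z => ?_)
    · have := (continuous_bumpPow 3).measurable
      exact Measurable.aestronglyMeasurable (by fun_prop)
    · have := bumpPow_nonneg 3 z
      rw [Real.norm_of_nonneg (by positivity)]
      exact bumpPow_div_le hr ζ z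
  refine ⟨hI, (integral_mono hI hi fun z => bumpPow_div_le hr ζ z).trans (le_of_eq ?_)⟩
  rw [integral_const_mul, integral_add' hc hb, integral_add_left_eq_self, avgConst]
  ring

lemma integral_pot_mul_bumpPow_le {f : E3 → ℝ} (hf : Continuous f) (hf0 : ∀ x, 0 ≤ f x)
    (hfi : Integrable f) {r : ℝ} (hr : 0 < r) (x : E3) :
    Integrable (fun z => pot f (x + r • z) * bumpPow 3 z) ∧
      ∫ z, pot f (x + r • z) * bumpPow 3 z ≤
        avgConst * ∫ y, f y / (‖x - y‖ ^ 2 + r ^ 2) := by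
  have hbm := (continuous_bumpPow 3).measurable
  have hfm := hf.measurable
  have hK := avgConst_nonneg
  set F : E3 → E3 → ℝ := fun z y => f y * (bumpPow 3 z / ‖x - y + r • z‖ ^ 2)
  have hF0 : ∀ z y, 0 ≤ F z y := fun z y =>
    mul_nonneg (hf0 y) (div_nonneg (bumpPow_nonneg 3 z) (by positivity))
  have hFm : AEStronglyMeasurable (Function.uncurry F) (volume.prod volume) :=
    Measurable.aestronglyMeasurable (by simp only [Function.uncurry_def, F]; fun_prop)
  have hFy : ∀ y, ∫ z, F z y = f y * ∫ z, bumpPow 3 z / ‖x - y + r • z‖ ^ 2 := fun y =>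
    integral_const_mul _ _
  have hFle : ∀ y, ∫ z, F z y ≤ avgConst * (f y / (‖x - y‖ ^ 2 + r ^ 2)) := fun y => by
    rw [hFy]
    refine (mul_le_mul_of_nonneg_left (integral_bumpPow_div_le hr (x - y)).2 (hf0 y)).trans
      (le_of_eq ?_)
    ring
  have hHi : Integrable fun y => f y / (‖x - y‖ ^ 2 + r ^ 2) := by
    refine (hfi.const_mul (1 / r ^ 2)).mono' (Measurable.aestronglyMeasurable (by fun_prop))
      (ae_of_all _ fun y => ?_)
    have := hf0 y
    rw [Real.norm_of_nonneg (by positivity), one_div_mul_eq_div]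
    gcongr
    nlinarith [sq_nonneg ‖x - y‖]
  have hFp : Integrable (Function.uncurry F) (volume.prod volume) := by
    rw [integrable_prod_iff' hFm]
    refine ⟨ae_of_all _ fun y => (integral_bumpPow_div_le hr (x - y)).1.const_mul (f y), ?_⟩
    refine (hHi.const_mul avgConst).mono' hFm.norm.prod_swap.integral_prod_right' (ae_of_all _ fun y => ?_)
    simp only [Function.uncurry, Real.norm_of_nonneg (hF0 _ _)]
    rw [Real.norm_of_nonneg (integral_nonneg fun z => hF0 z y)]
    exact hFle y
  have hz : ∀ z, ∫ y, F z y = pot f (x + r • z) * bumpPow 3 z := fun z => by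
    rw [pot, ← integral_mul_const]
    congr 1; ext y
    simp only [F]
    rw [sub_add_eq_add_sub]
    ring
  constructor
  · have := hFp.integral_prod_left
    simpa only [Function.uncurry, hz] using this
  · calc ∫ z, pot f (x + r • z) * bumpPow 3 z = ∫ z, ∫ y, F z y := by simp only [hz]
      _ = ∫ y, ∫ z, F z y := integral_integral_swap hFp
      _ ≤ ∫ y, avgConst * (f y / (‖x - y‖ ^ 2 + r ^ 2)) :=
          integral_mono hFp.integral_prod_right (hHi.const_mul _) hFle
      _ = _ := integral_const_mul _ _

lemma integral_div_add_sq {ρ : ℝ} (hρ : 0 < ρ) :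
    ∫ r in (0 : ℝ)..1, r / (ρ + r ^ 2) = 1 / 2 * log (1 + 1 / ρ) := by
  have hd : ∀ r : ℝ, HasDerivAt (fun r => 1 / 2 * log (ρ + r ^ 2)) (r / (ρ + r ^ 2)) r := by
    intro r
    have h0 : ρ + r ^ 2 ≠ 0 := by positivity
    refine (((hasDerivAt_pow 2 r).const_add ρ).log h0 |>.const_mul (1 / 2)).congr_deriv ?_
    field_simp
    norm_num
  rw [intervalIntegral.integral_eq_sub_of_hasDerivAt (fun r _ => hd r)
    (Continuous.intervalIntegrable (by
      refine continuous_id.div (by fun_prop) fun r => by positivity) _ _)]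
  rw [← mul_sub, ← log_div (by positivity) (by positivity)]
  congr 2
  field_simp
  norm_num

lemma integral_mul_integral_div {f : E3 → ℝ} (hf : Continuous f) (hf0 : ∀ x, 0 ≤ f x)
    (hfi : Integrable f) (x : E3) :
    IntervalIntegrable (fun r => r * ∫ y, f y / (‖x - y‖ ^ 2 + r ^ 2)) volume 0 1 ∧
      ∫ r in (0 : ℝ)..1, r * ∫ y, f y / (‖x - y‖ ^ 2 + r ^ 2) =
        1 / 2 * ∫ y, f y * log (1 + 1 / ‖x - y‖ ^ 2) := by
  have hfm := hf.measurable
  set J : ℝ → E3 → ℝ := fun r y => f y * (r / (‖x - y‖ ^ 2 + r ^ 2))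
  set ν := (volume : Measure ℝ).restrict (Set.Ioc 0 1)
  have hJm : AEStronglyMeasurable (Function.uncurry J) (ν.prod volume) :=
    Measurable.aestronglyMeasurable (by simp only [Function.uncurry_def, J]; fun_prop)
  have hr0 : ∀ᵐ r ∂ν, 0 < r := (ae_restrict_mem measurableSet_Ioc).mono fun r hr => hr.1
  have hJy : ∀ y, y ≠ x → ∫ r, J r y ∂ν = 1 / 2 * (f y * log (1 + 1 / ‖x - y‖ ^ 2)) := by
    intro y hy
    have := norm_pos_iff.2 (sub_ne_zero.2 hy.symm)
    rw [integral_const_mul, ← intervalIntegral.integral_of_le zero_le_one,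
      integral_div_add_sq (by positivity)]
    ring
  have hJp : Integrable (Function.uncurry J) (ν.prod volume) := by
    rw [integrable_prod_iff' hJm]
    constructor
    · filter_upwards [ae_ne x] with y hy
      have := norm_pos_iff.2 (sub_ne_zero.2 hy.symm)
      have hc : Continuous fun r => r / (‖x - y‖ ^ 2 + r ^ 2) :=
        continuous_id.div (by fun_prop) fun r => by positivity
      have hI : IntegrableOn (fun r => r / (‖x - y‖ ^ 2 + r ^ 2)) (Set.Ioc 0 1) :=
        hc.integrableOn_Icc.mono_set Set.Ioc_subset_Icc_self
      exact hI.const_mul (f y)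
    · refine ((integrable_mul_log hf hf0 hfi x).const_mul (1 / 2)).congr ?_
      filter_upwards [ae_ne x] with y hy
      rw [← hJy y hy]
      refine integral_congr_ae ?_
      filter_upwards [hr0] with r hr
      have := hf0 y
      exact (Real.norm_of_nonneg (show 0 ≤ J r y by simp only [J]; positivity)).symm
  have hr : ∀ r, ∫ y, J r y = r * ∫ y, f y / (‖x - y‖ ^ 2 + r ^ 2) := fun r => by
    rw [← integral_const_mul]
    congr 1; ext y
    simp only [J]; ring
  constructor
  · rw [intervalIntegrable_iff_integrableOn_Ioc_of_le zero_le_one]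
    have := hJp.integral_prod_left
    simp only [Function.uncurry, hr] at this
    exact this
  · rw [intervalIntegral.integral_of_le zero_le_one]
    simp only [← hr]
    rw [integral_integral_swap hJp, ← integral_const_mul]
    exact integral_congr_ae ((ae_ne x).mono fun y hy => hJy y hy)

lemma integral_bumpPow_pos (k : ℕ) (hk : k ≠ 0) : 0 < ∫ z, bumpPow k z := by
  refine (continuous_bumpPow k).integral_pos_of_hasCompactSupport_nonneg_nonzero
    (x := 0) (HasCompactSupport.intro (isCompact_closedBall (0 : E3) 1)
      fun z hz => bumpPow_eq_zero hk hz) (bumpPow_nonneg k) (by simp [bumpPow])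

lemma le_integral_log_of_neg_lap_le {u : E3 → ℝ} (hu : ContDiff ℝ (⊤ : ℕ∞) u)
    (hfi : Integrable fun x => exp (3 * u x)) {C₀ C₁ : ℝ} (hC₀ : 0 ≤ C₀) (hC₁ : 0 ≤ C₁)
    (h : ∀ x, -lap u x ≤ C₀ + C₁ * pot (fun y => exp (3 * u y)) x) :
    ∃ C K : ℝ, 0 ≤ K ∧
      ∀ x, u x ≤ C + K * ∫ y, exp (3 * u y) * log (1 + 1 / ‖x - y‖ ^ 2) := by
  have huc := hu.continuous
  set f : E3 → ℝ := fun x => exp (3 * u x)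
  have hf : Continuous f := by fun_prop
  have hf0 : ∀ x, 0 ≤ f x := fun x => (exp_pos _).le
  have hK := avgConst_nonneg
  have hb := integrable_bumpPow (k := 3) (by norm_num)
  set c := ∫ z, bumpPow 2 z
  have hc : 0 < c := integral_bumpPow_pos 2 (by norm_num)
  set θ := ∫ z, bumpPow 3 z
  have hθ : 0 ≤ θ := (integral_bumpPow_pos 3 (by norm_num)).le
  set M := ∫ y, f y
  refine ⟨c⁻¹ * (1 / 3 * M + 1 / 6 * (C₀ * θ)), c⁻¹ * (1 / 6 * (C₁ * avgConst * (1 / 2))),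
    by positivity, fun x => ?_⟩
  obtain ⟨hHi, hH⟩ := integral_mul_integral_div hf hf0 hfi x
  have h1 : ∫ z, u (x + z) * bumpPow 2 z ≤ 1 / 3 * M := by
    have hM : ∫ z, f (x + z) = M := integral_add_left_eq_self _ x
    rw [← hM, ← integral_const_mul]
    refine integral_mono (integrable_mul_bumpPow (by norm_num) (by fun_prop))
      ((hfi.comp_add_left x).const_mul _) fun z => ?_
    have e1 : u (x + z) ≤ 1 / 3 * f (x + z) := by
      have := add_one_le_exp (3 * u (x + z))
      simp only [f]; linarith
    have e2 := mul_le_mul_of_nonneg_right e1 (bumpPow_nonneg 2 z)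
    have e3 := mul_le_mul_of_nonneg_left (bumpPow_le_one 2 z) (show 0 ≤ 1 / 3 * f (x + z) by
      have := hf0 (x + z); positivity)
    linarith
  have h2 : ∫ r in (0 : ℝ)..1, r * ∫ z, (-lap u (x + r • z)) * bumpPow 3 z ≤
      ∫ r in (0 : ℝ)..1, (C₀ * θ + C₁ * avgConst * (r * ∫ y, f y / (‖x - y‖ ^ 2 + r ^ 2))) := by
    refine intervalIntegral.integral_mono_on zero_le_one ?_
      (intervalIntegrable_const.add (hHi.const_mul _)) fun r hr => ?_
    · simp only [neg_mul, integral_neg, mul_neg]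
      exact (continuous_integral_lap hu x).neg.intervalIntegrable _ _
    · rcases eq_or_lt_of_le hr.1 with h0 | h0
      · rw [← h0]; simp; positivity
      obtain ⟨hpi, hp⟩ := integral_pot_mul_bumpPow_le hf hf0 hfi h0 x
      have e1 : ∫ z, (-lap u (x + r • z)) * bumpPow 3 z ≤
          C₀ * θ + C₁ * (avgConst * ∫ y, f y / (‖x - y‖ ^ 2 + r ^ 2)) := by
        calc ∫ z, (-lap u (x + r • z)) * bumpPow 3 z
            ≤ ∫ z, (C₀ * bumpPow 3 z + C₁ * (pot f (x + r • z) * bumpPow 3 z)) := by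
              refine integral_mono (integrable_mul_bumpPow (by norm_num)
                (by have := continuous_lap hu; fun_prop))
                ((hb.const_mul _).add (hpi.const_mul _)) fun z => ?_
              have := mul_le_mul_of_nonneg_right (h (x + r • z)) (bumpPow_nonneg 3 z)
              simp only [f]
              linarith
          _ = C₀ * θ + C₁ * ∫ z, pot f (x + r • z) * bumpPow 3 z := by
              rw [integral_add (hb.const_mul _) (hpi.const_mul _), integral_const_mul,
                integral_const_mul]
          _ ≤ _ := by gcongr
      have e2 := mul_le_mul_of_nonneg_left e1 h0.le
      have e3 := mul_le_mul_of_nonneg_right hr.2 (mul_nonneg hC₀ hθ)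
      linarith
  rw [intervalIntegral.integral_add intervalIntegrable_const (hHi.const_mul _),
    intervalIntegral.integral_const_mul (C₁ * avgConst), hH,
    intervalIntegral.integral_const] at h2
  have h3 := average_representation hu x
  have h4 : u x = c⁻¹ * (u x * c) := by field_simp
  have h5 : u x * c ≤ 1 / 3 * M + 1 / 6 * (C₀ * θ + C₁ * avgConst *
      (1 / 2 * ∫ y, f y * log (1 + 1 / ‖x - y‖ ^ 2))) := by
    simp only [sub_zero, one_smul] at h2
    linarith
  rw [h4]
  refine (mul_le_mul_of_nonneg_left h5 (by positivity)).trans (le_of_eq ?_)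
  ring

lemma one_add_pow_mul_exp_neg_le {a : ℝ} (ha : 0 ≤ a) (k : ℕ) :
    (1 + a) ^ k * exp (-a) ≤ k.factorial * exp 1 := by
  have h := pow_div_factorial_le_exp (x := 1 + a) (by linarith) k
  rw [div_le_iff₀ (by positivity), exp_add] at h
  have h2 := mul_le_mul_of_nonneg_right h (exp_pos (-a)).le
  have h3 : exp a * exp (-a) = 1 := by rw [← exp_add]; simp
  calc _ ≤ exp 1 * exp a * k.factorial * exp (-a) := h2
    _ = k.factorial * exp 1 * (exp a * exp (-a)) := by ring
    _ = _ := by rw [h3, mul_one]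

lemma one_add_norm_pow_mul_gaussian_le {s : ℝ} (hs : 0 < s) (k : ℕ) (r : ℝ) (hr : 0 ≤ r) :
    (1 + r) ^ k * exp (-(s * r ^ 2)) ≤ (2 * (1 + 1 / s)) ^ k * (k.factorial * exp 1) := by
  have h1 : 1 + r ≤ 2 * (1 + 1 / s) * (1 + s * r ^ 2) := by
    have e : 2 * (1 + 1 / s) * (1 + s * r ^ 2) = 2 * (1 + r ^ 2) + 2 / s + 2 * s * r ^ 2 := by
      field_simp; ring
    rw [e]
    have : 0 ≤ 2 / s := by positivity
    have : 0 ≤ 2 * s * r ^ 2 := by positivity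
    nlinarith [sq_nonneg (r - 1)]
  calc _ ≤ (2 * (1 + 1 / s) * (1 + s * r ^ 2)) ^ k * exp (-(s * r ^ 2)) := by gcongr
    _ = (2 * (1 + 1 / s)) ^ k * ((1 + s * r ^ 2) ^ k * exp (-(s * r ^ 2))) := by
      rw [mul_pow]; ring
    _ ≤ _ := mul_le_mul_of_nonneg_left (one_add_pow_mul_exp_neg_le (by positivity) k) (by positivity)

/-- The Gaussian `exp (-s‖x‖²)` as a Schwartz function. -/
noncomputable def gaussianSchwartz {s : ℝ} (hs : 0 < s) : SchwartzMap E3 ℝ where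
  toFun x := exp (-(s * ‖x‖ ^ 2))
  smooth' := by
    have : ContDiff ℝ (⊤ : ℕ∞) fun x : E3 => ‖x‖ ^ 2 := contDiff_norm_sq ℝ
    fun_prop
  decay' := by
    intro k n
    have hT : Function.HasTemperateGrowth fun x : E3 => -(s * ‖x‖ ^ 2) :=
      ((Function.HasTemperateGrowth.const s).mul (Function.hasTemperateGrowth_norm_sq E3)).neg
    obtain ⟨l, C, hC, h⟩ := hT.norm_iteratedFDeriv_le_uniform n
    refine ⟨n.factorial * (1 + C) ^ n *
      ((2 * (1 + 1 / s)) ^ (k + l * n) * ((k + l * n).factorial * exp 1)), fun x => ?_⟩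
    have hb := norm_iteratedFDeriv_comp_le (𝕜 := ℝ) (g := exp) (f := fun x : E3 => -(s * ‖x‖ ^ 2))
      (n := n) (N := (⊤ : ℕ∞)) contDiff_exp hT.1 (by exact_mod_cast le_top) x
      (C := exp (-(s * ‖x‖ ^ 2))) (D := (1 + C) * (1 + ‖x‖) ^ l)
      (fun i _ => by
        rw [norm_iteratedFDeriv_eq_norm_iteratedDeriv, iteratedDeriv_eq_iterate, iter_deriv_exp]
        simp) (fun i hi hin => by
        have h1 : (1 : ℝ) ≤ (1 + C) * (1 + ‖x‖) ^ l :=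
          one_le_mul_of_one_le_of_one_le (by linarith)
            (one_le_pow₀ (by linarith [norm_nonneg x]))
        calc _ ≤ C * (1 + ‖x‖) ^ l := h i hin x
          _ ≤ (1 + C) * (1 + ‖x‖) ^ l := by gcongr; linarith
          _ ≤ _ := le_self_pow₀ h1 (by omega))
    calc _ ≤ (1 + ‖x‖) ^ k * (n.factorial * exp (-(s * ‖x‖ ^ 2)) *
          ((1 + C) * (1 + ‖x‖) ^ l) ^ n) := by
          gcongr
          · linarith
          · exact hb
      _ = n.factorial * (1 + C) ^ n * ((1 + ‖x‖) ^ (k + l * n) * exp (-(s * ‖x‖ ^ 2))) := by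
          rw [mul_pow, ← pow_mul, pow_add]; ring
      _ ≤ _ := mul_le_mul_of_nonneg_left
          (one_add_norm_pow_mul_gaussian_le hs _ _ (norm_nonneg x)) (by positivity)

/-- The Gaussian kernel `t^{-3/2} exp (-‖z‖²/t)`. -/
noncomputable def heat (t : ℝ) (z : E3) : ℝ := t ^ (-(3 / 2) : ℝ) * exp (-(‖z‖ ^ 2 / t))

lemma exists_schwartz_heat {t : ℝ} (ht : 0 < t) (x₀ : E3) :
    ∃ φ : SchwartzMap E3 ℝ, ∀ x, φ x = heat t (x - x₀) := by
  refine ⟨t ^ (-(3 / 2) : ℝ) • (gaussianSchwartz (one_div_pos.2 ht)).compSubConstCLM ℝ x₀,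
    fun x => ?_⟩
  simp only [smul_apply, SchwartzMap.compSubConstCLM_apply, smul_eq_mul, heat]
  congr 1
  change exp _ = _
  congr 2; ring

lemma heat_nonneg {t : ℝ} (ht : 0 < t) (z : E3) : 0 ≤ heat t z := by unfold heat; positivity

lemma continuous_heat (t : ℝ) : Continuous (heat t) := by unfold heat; fun_prop

lemma continuousAt_heat_time {t : ℝ} (ht : 0 < t) (z : E3) :
    ContinuousAt (fun s => heat s z) t := by
  unfold heat
  exact (continuousAt_rpow_const _ _ (Or.inl ht.ne')).mul
    (continuous_exp.continuousAt.comp (ContinuousAt.neg (by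
      exact continuousAt_const.div continuousAt_id ht.ne')))

lemma integrable_gaussian {b : ℝ} (hb : 0 < b) : Integrable fun z : E3 => exp (-(b * ‖z‖ ^ 2)) :=
  (gaussianSchwartz hb).integrable

lemma integral_gaussian_eq {b : ℝ} (hb : 0 < b) :
    ∫ z : E3, exp (-(b * ‖z‖ ^ 2)) = (π / b) ^ (3 / 2 : ℝ) := by
  have := GaussianFourier.integral_rexp_neg_mul_sq_norm (V := E3) hb
  simpa [neg_mul] using this

/-- Convolving a Gaussian kernel with a Gaussian yields a wider Gaussian kernel. -/
lemma integral_gaussian_mul_heat {t b : ℝ} (ht : 0 < t) (hb : 0 < b) (x : E3) :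
    ∫ z, exp (-(b * ‖z‖ ^ 2)) * heat t (x + z) = (π / b) ^ (3 / 2 : ℝ) * heat (t + 1 / b) x := by
  have hc : 0 < b + 1 / t := by positivity
  have key : ∀ z : E3, exp (-(b * ‖z‖ ^ 2)) * heat t (x + z) =
      t ^ (-(3 / 2) : ℝ) * exp (-(‖x‖ ^ 2 / (t + 1 / b))) *
        exp (-((b + 1 / t) * ‖z + (1 / (b * t + 1)) • x‖ ^ 2)) := by
    intro z
    have hbt : 0 < b * t + 1 := by positivity
    rw [heat, mul_left_comm, ← exp_add, mul_assoc, ← exp_add]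
    congr 2
    rw [norm_add_sq_real, norm_add_sq_real, inner_smul_right, norm_smul, real_inner_comm x z,
      norm_of_nonneg (by positivity)]
    field_simp
    ring
  simp_rw [key]
  rw [integral_const_mul, integral_add_right_eq_self (fun z : E3 => exp (-((b + 1 / t) * ‖z‖ ^ 2))),
    integral_gaussian_eq hc, heat]
  have e1 : (t + 1 / b) = b⁻¹ * t * (b + 1 / t) := by field_simp
  have : (π / (b + 1 / t)) ^ (3 / 2 : ℝ) * t ^ (-(3 / 2) : ℝ) =
      (π / b) ^ (3 / 2 : ℝ) * (t + 1 / b) ^ (-(3 / 2) : ℝ) := by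
    rw [rpow_neg ht.le, rpow_neg (by positivity), ← inv_rpow ht.le, ← inv_rpow (by positivity),
      ← mul_rpow (by positivity) (by positivity), ← mul_rpow (by positivity) (by positivity)]
    congr 1
    field_simp
  linear_combination exp (-(‖x‖ ^ 2 / (t + 1 / b))) * this

/-- The symmetric second difference of `φ` at `x`. -/
def secondDiff (φ : E3 → ℝ) (x z : E3) : ℝ := 2 * φ x - φ (x + z) - φ (x - z)

lemma SchwartzMap.exists_bound {F : Type*} [NormedAddCommGroup F] [NormedSpace ℝ F]
    (φ : SchwartzMap E3 F) : ∃ M, 0 ≤ M ∧ ∀ x, ‖φ x‖ ≤ M :=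
  ⟨_, norm_nonneg _, φ.toBoundedContinuousFunction.norm_coe_le_norm⟩

lemma abs_secondDiff_le_sq (φ : SchwartzMap E3 ℝ) :
    ∃ C, 0 ≤ C ∧ ∀ x z, |secondDiff φ x z| ≤ C * ‖z‖ ^ 2 := by
  set ψ := SchwartzMap.fderivCLM ℝ E3 ℝ φ with hψ
  obtain ⟨C, hC0, hC⟩ := (SchwartzMap.fderivCLM ℝ E3 (E3 →L[ℝ] ℝ) ψ).exists_bound
  have hlip : ∀ a b, ‖ψ a - ψ b‖ ≤ C * ‖a - b‖ := fun a b =>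
    Convex.norm_image_sub_le_of_norm_fderiv_le (𝕜 := ℝ) (s := Set.univ) (f := ψ)
      (fun y _ => ψ.differentiableAt) (fun y _ => hC y) convex_univ trivial trivial
  refine ⟨2 * C, by positivity, fun x z => ?_⟩
  have hd : ∀ y, HasFDerivAt φ (ψ y) y := fun y => φ.hasFDerivAt y
  have hG : ∀ w, HasFDerivAt (fun w => φ (x + w) + φ (x - w)) (ψ (x + w) - ψ (x - w)) w := by
    intro w
    have h1 : HasFDerivAt (fun w => φ (x + w)) (ψ (x + w)) w := by
      simpa [Function.comp_def] using (hd (x + w)).comp w ((hasFDerivAt_id w).const_add x)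
    have h2 : HasFDerivAt (fun w => φ (x - w)) (-ψ (x - w)) w := by
      simpa [Function.comp_def] using (hd (x - w)).comp w ((hasFDerivAt_id w).const_sub x)
    rw [sub_eq_add_neg (ψ _)]
    exact h1.fun_add h2
  have := Convex.norm_image_sub_le_of_norm_hasFDerivWithin_le (𝕜 := ℝ)
    (s := Metric.closedBall (0 : E3) ‖z‖) (f := fun w => φ (x + w) + φ (x - w))
    (C := 2 * C * ‖z‖) (x := 0) (y := z) (fun w _ => (hG w).hasFDerivWithinAt)
    (fun w hw => by
      have hw' : ‖w‖ ≤ ‖z‖ := by simpa using hw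
      calc _ ≤ C * ‖(x + w) - (x - w)‖ := hlip _ _
        _ = C * (2 * ‖w‖) := by
          rw [show (x + w) - (x - w) = (2 : ℝ) • w by rw [two_smul]; abel, norm_smul]; simp
        _ ≤ _ := by nlinarith) (convex_closedBall _ _) (by simp) (by simp)
  rw [← abs_neg, ← Real.norm_eq_abs]
  convert this using 1
  · congr 1; simp only [secondDiff, add_zero, sub_zero]; ring
  · simp; ring

lemma integrable_one_add_norm_inv_pow_four :
    Integrable fun z : E3 => ((1 + ‖z‖) ^ 4)⁻¹ := by
  have := integrable_one_add_norm (E := E3) (μ := volume) (r := 4) (by simp; norm_num)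
  refine this.congr (ae_of_all _ fun z => ?_)
  simp only
  rw [rpow_neg (by positivity)]
  norm_cast

lemma div_pow_four_le {ε a M : ℝ} (hε : 0 < ε) {z : E3} (hz : ε ≤ ‖z‖) (hM : |a| ≤ M) :
    |a / ‖z‖ ^ 4| ≤ M * (1 + 1 / ε) ^ 4 * ((1 + ‖z‖) ^ 4)⁻¹ := by
  have hz0 : 0 < ‖z‖ := hε.trans_le hz
  have h1 : 1 + ‖z‖ ≤ (1 + 1 / ε) * ‖z‖ := by
    have : 1 ≤ 1 / ε * ‖z‖ := by rw [one_div_mul_eq_div, one_le_div hε]; exact hz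
    linarith
  rw [abs_div, abs_of_nonneg (by positivity : (0:ℝ) ≤ ‖z‖ ^ 4), ← div_eq_mul_inv,
    div_le_div_iff₀ (by positivity) (by positivity)]
  have hM0 : 0 ≤ M := (abs_nonneg a).trans hM
  calc _ ≤ M * ((1 + 1 / ε) * ‖z‖) ^ 4 := by gcongr
    _ = _ := by ring

lemma continuous_secondDiff (φ : SchwartzMap E3 ℝ) (x : E3) : Continuous (secondDiff φ x) := by
  unfold secondDiff
  have := φ.continuous
  fun_prop

lemma abs_secondDiff_le (φ : SchwartzMap E3 ℝ) :
    ∃ M, 0 ≤ M ∧ ∀ x z, |secondDiff φ x z| ≤ M := by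
  obtain ⟨M, hM0, hM⟩ := φ.exists_bound
  refine ⟨4 * M, by positivity, fun x z => ?_⟩
  have h1 := abs_le.1 (hM x); have h2 := abs_le.1 (hM (x + z)); have h3 := abs_le.1 (hM (x - z))
  exact abs_le.2 ⟨by unfold secondDiff; linarith, by unfold secondDiff; linarith⟩

lemma integrable_secondDiff_div (φ : SchwartzMap E3 ℝ) (x : E3) :
    Integrable fun z => secondDiff φ x z / ‖z‖ ^ 4 := by
  obtain ⟨C, hC0, hC⟩ := abs_secondDiff_le_sq φ
  obtain ⟨M, hM0, hM⟩ := abs_secondDiff_le φ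
  refine Integrable.mono' (((integrable_cutKer (p := 2) (by norm_num)).const_mul C).add
    (integrable_one_add_norm_inv_pow_four.const_mul (M * (1 + 1 / 1) ^ 4)))
    ((continuous_secondDiff φ x).measurable.div (by fun_prop)).aestronglyMeasurable
    (ae_of_all _ fun z => ?_)
  rw [Real.norm_eq_abs, Pi.add_apply]
  rcases lt_or_ge ‖z‖ 1 with hz | hz
  · refine le_add_of_le_of_nonneg ?_ (by positivity)
    rw [cutKer_of_mem hz, abs_div, abs_of_nonneg (by positivity : (0:ℝ) ≤ ‖z‖ ^ 4)]
    rcases eq_or_ne z 0 with rfl | hz0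
    · simp
    have : 0 < ‖z‖ := norm_pos_iff.2 hz0
    rw [div_le_iff₀ (by positivity)]
    have e : ‖z‖ ^ (-(2:ℝ)) * ‖z‖ ^ 4 = ‖z‖ ^ 2 := by
      rw [rpow_neg this.le]; norm_cast; field_simp
    rw [mul_assoc, e]
    exact hC x z
  · exact le_add_of_nonneg_of_le (mul_nonneg hC0 (cutKer_nonneg _ _))
      (div_pow_four_le one_pos hz (hM x z))

lemma halfLap_eq_integral_secondDiff (φ : SchwartzMap E3 ℝ) (x : E3) :
    halfLap φ x = (1 / π ^ 2) * ((1 / 2) * ∫ z, secondDiff φ x z / ‖z‖ ^ 4) := by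
  obtain ⟨M, hM0, hM⟩ := φ.exists_bound
  have key : ∀ ε : ℝ, 0 < ε → ∫ y in {y : E3 | ε < ‖x - y‖}, (φ x - φ y) / ‖x - y‖ ^ 4 =
      (1 / 2) * ∫ z, {z : E3 | ε < ‖z‖}.indicator (fun z => secondDiff φ x z / ‖z‖ ^ 4) z := by
    intro ε hε
    have hms : MeasurableSet {z : E3 | ε < ‖z‖} := measurableSet_lt measurable_const measurable_norm
    set F : E3 → ℝ := {z : E3 | ε < ‖z‖}.indicator fun z => (φ x - φ (x - z)) / ‖z‖ ^ 4 with hF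
    have hFi : Integrable F := by
      refine Integrable.mono' (integrable_one_add_norm_inv_pow_four.const_mul
        (2 * M * (1 + 1 / ε) ^ 4)) (Measurable.indicator (Measurable.div ?_ (by fun_prop))
          hms).aestronglyMeasurable (ae_of_all _ fun z => ?_)
      · have := φ.continuous
        exact Continuous.measurable (by fun_prop)
      · by_cases hz : ε < ‖z‖
        · rw [hF, Set.indicator_of_mem (by exact hz), Real.norm_eq_abs]
          refine div_pow_four_le hε hz.le ?_
          have h1 := abs_le.1 (hM x); have h2 := abs_le.1 (hM (x - z))
          exact abs_le.2 ⟨by linarith, by linarith⟩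
        · rw [hF, Set.indicator_of_notMem (by exact hz), norm_zero]
          positivity
    have h1 : ∫ y in {y : E3 | ε < ‖x - y‖}, (φ x - φ y) / ‖x - y‖ ^ 4 = ∫ z, F z := by
      rw [← integral_indicator (measurableSet_lt measurable_const (by fun_prop)),
        ← integral_sub_left_eq_self F volume x]
      congr 1; ext y
      simp [hF, Set.indicator]
    have h2 : ∫ z, F z = ∫ z, F (-z) := (integral_neg_eq_self F volume).symm
    have h3 : ∫ z, {z : E3 | ε < ‖z‖}.indicator (fun z => secondDiff φ x z / ‖z‖ ^ 4) z =
        (∫ z, F z) + ∫ z, F (-z) := by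
      rw [← integral_add hFi hFi.comp_neg]
      congr 1; ext z
      by_cases hz : ε < ‖z‖
      · simp only [hF, Set.indicator, Set.mem_ofPred_eq, hz, norm_neg, if_true, secondDiff,
          sub_neg_eq_add]
        ring
      · simp [hF, hz]
    rw [h1, h3, ← h2]; ring
  have hlim : Tendsto (fun ε : ℝ =>
      ∫ z, {z : E3 | ε < ‖z‖}.indicator (fun z => secondDiff φ x z / ‖z‖ ^ 4) z) (𝓝[>] 0)
      (𝓝 (∫ z, secondDiff φ x z / ‖z‖ ^ 4)) := by
    refine tendsto_integral_filter_of_dominated_convergence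
      (fun z => ‖secondDiff φ x z / ‖z‖ ^ 4‖)
      (Eventually.of_forall fun ε => (integrable_secondDiff_div φ x).aestronglyMeasurable.indicator
        (measurableSet_lt measurable_const measurable_norm))
      (Eventually.of_forall fun ε => ae_of_all _ fun z => norm_indicator_le_norm_self _ _)
      (integrable_secondDiff_div φ x).norm ((ae_ne 0).mono fun z hz => ?_)
    refine tendsto_const_nhds.congr' ?_
    filter_upwards [nhdsWithin_le_nhds (Iio_mem_nhds (norm_pos_iff.2 hz))] with ε hε
    rw [Set.indicator_of_mem (by exact hε)]
  unfold halfLap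
  refine Tendsto.limUnder_eq ?_
  refine Tendsto.const_mul _ ((hlim.const_mul (1 / 2)).congr' ?_)
  filter_upwards [self_mem_nhdsWithin] with ε hε
  exact (key ε hε).symm

lemma integral_mul_exp_neg_mul {r : ℝ} (hr : 0 < r) :
    ∫ σ in Set.Ioi (0 : ℝ), σ * exp (-(σ * r)) = 1 / r ^ 2 := by
  have := Real.integral_rpow_mul_exp_neg_mul_Ioi (a := 2) (by norm_num) hr
  rw [Gamma_two, mul_one] at this
  norm_num at this
  simpa [mul_comm] using this

lemma integrableOn_mul_exp_neg_mul {r : ℝ} (hr : 0 < r) :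
    IntegrableOn (fun σ : ℝ => σ * exp (-(σ * r))) (Set.Ioi 0) := by
  by_contra h
  have h1 := integral_mul_exp_neg_mul hr
  rw [integral_undef h] at h1
  have : 0 < 1 / r ^ 2 := by positivity
  linarith

lemma halfLap_eq_integral_gaussian (φ : SchwartzMap E3 ℝ) (x : E3) :
    halfLap φ x = (1 / π ^ 2) * ∫ σ in Set.Ioi (0 : ℝ),
      σ * ((π / σ) ^ (3 / 2 : ℝ) * φ x - ∫ z, exp (-(σ * ‖z‖ ^ 2)) * φ (x + z)) := by
  have hz4 : ∀ z : E3, z ≠ 0 → ∀ a : ℝ, ∫ σ in Set.Ioi (0 : ℝ), a * (σ * exp (-(σ * ‖z‖ ^ 2))) =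
      a / ‖z‖ ^ 4 := fun z hz a => by
    rw [integral_const_mul, integral_mul_exp_neg_mul (by positivity)]; ring
  have hint : Integrable (Function.uncurry fun (z : E3) (σ : ℝ) =>
      secondDiff φ x z * (σ * exp (-(σ * ‖z‖ ^ 2))))
      (volume.prod (volume.restrict (Set.Ioi 0))) := by
    have hc : Continuous (Function.uncurry fun (z : E3) (σ : ℝ) =>
        secondDiff φ x z * (σ * exp (-(σ * ‖z‖ ^ 2)))) := by
      have := continuous_secondDiff φ x
      simp only [Function.uncurry_def]
      fun_prop
    rw [integrable_prod_iff hc.aestronglyMeasurable]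
    refine ⟨(ae_ne 0).mono fun z hz => ?_, (integrable_secondDiff_div φ x).norm.congr
      ((ae_ne 0).mono fun z hz => ?_)⟩
    · simp only [Function.uncurry_apply_pair]
      exact (integrableOn_mul_exp_neg_mul (r := ‖z‖ ^ 2) (by positivity)).const_mul _
    · have h1 := hz4 z hz |secondDiff φ x z|
      simp only [Function.uncurry_apply_pair, Real.norm_eq_abs, abs_div,
        abs_of_nonneg (by positivity : (0 : ℝ) ≤ ‖z‖ ^ 4)]
      rw [← h1]
      refine setIntegral_congr_fun measurableSet_Ioi fun σ hσ => ?_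
      simp only [abs_mul, abs_exp, abs_of_pos (Set.mem_Ioi.1 hσ)]
  have hsw := integral_integral_swap hint
  have hL : ∫ z, secondDiff φ x z / ‖z‖ ^ 4 = ∫ z, ∫ σ in Set.Ioi (0 : ℝ),
      secondDiff φ x z * (σ * exp (-(σ * ‖z‖ ^ 2))) :=
    integral_congr_ae ((ae_ne 0).mono fun z hz => (hz4 z hz _).symm)
  rw [halfLap_eq_integral_secondDiff, hL, hsw, ← integral_const_mul]
  congr 1
  refine setIntegral_congr_fun measurableSet_Ioi fun σ hσ => ?_
  have hσ' : 0 < σ := hσ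
  obtain ⟨M, hM0, hM⟩ := φ.exists_bound
  have hg := integrable_gaussian hσ'
  have hi : Integrable fun z : E3 => exp (-(σ * ‖z‖ ^ 2)) * φ (x + z) :=
    hg.mul_bdd (c := M) (φ.continuous.comp (by fun_prop)).aestronglyMeasurable
      (ae_of_all _ fun z => hM _)
  have hneg : ∫ z : E3, exp (-(σ * ‖z‖ ^ 2)) * φ (x - z) =
      ∫ z : E3, exp (-(σ * ‖z‖ ^ 2)) * φ (x + z) := by
    rw [← integral_neg_eq_self (fun z : E3 => exp (-(σ * ‖z‖ ^ 2)) * φ (x + z))]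
    simp [sub_eq_add_neg]
  have hi' : Integrable fun z : E3 => exp (-(σ * ‖z‖ ^ 2)) * φ (x - z) := by
    have := hi.comp_neg
    simpa [sub_eq_add_neg] using this
  have h1 : ∀ z : E3, secondDiff φ x z * (σ * exp (-(σ * ‖z‖ ^ 2))) =
      2 * σ * φ x * exp (-(σ * ‖z‖ ^ 2)) - σ * (exp (-(σ * ‖z‖ ^ 2)) * φ (x + z)) -
        σ * (exp (-(σ * ‖z‖ ^ 2)) * φ (x - z)) := fun z => by
    unfold secondDiff; ring
  simp only [h1]
  have hs := integral_sub ((hg.const_mul (2 * σ * φ x)).sub (hi.const_mul σ)) (hi'.const_mul σ)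
  simp only [Pi.sub_apply] at hs
  rw [hs, integral_sub (hg.const_mul _) (hi.const_mul _), integral_const_mul, integral_const_mul,
    integral_const_mul, hneg, integral_gaussian_eq hσ']
  ring

/-- The difference of the Gaussian kernels centred at `x₀` and at the origin. -/
noncomputable def heatDiff (x₀ : E3) (t : ℝ) (x : E3) : ℝ := heat t (x - x₀) - heat t x

lemma mul_pi_div_rpow {σ : ℝ} (hσ : 0 < σ) :
    σ * (π / σ) ^ (3 / 2 : ℝ) = π ^ (3 / 2 : ℝ) * σ ^ (-(1 / 2) : ℝ) := by
  rw [div_rpow pi_pos.le hσ.le, mul_div_assoc', mul_comm, mul_div_assoc]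
  congr 1
  nth_rw 1 [← rpow_one σ]
  rw [← rpow_sub hσ]
  norm_num

lemma exists_schwartz_heatDiff {t : ℝ} (ht : 0 < t) (x₀ : E3) :
    ∃ φ : SchwartzMap E3 ℝ, (∀ x, φ x = heatDiff x₀ t x) ∧
      ∀ x, halfLap φ x = (1 / √π) * ∫ σ in Set.Ioi (0 : ℝ),
        σ ^ (-(1 / 2) : ℝ) * (heatDiff x₀ t x - heatDiff x₀ (t + 1 / σ) x) := by
  obtain ⟨φ₁, h₁⟩ := exists_schwartz_heat ht x₀
  obtain ⟨φ₂, h₂⟩ := exists_schwartz_heat ht 0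
  have hφ : ∀ x, (φ₁ - φ₂) x = heatDiff x₀ t x := fun x => by
    simp [h₁, h₂, heatDiff]
  refine ⟨φ₁ - φ₂, hφ, fun x => ?_⟩
  have hpi : (1 / π ^ 2) * π ^ (3 / 2 : ℝ) = 1 / √π := by
    rw [sqrt_eq_rpow, one_div_mul_eq_div, div_eq_div_iff (by positivity)
      (rpow_pos_of_pos pi_pos _).ne', ← rpow_add pi_pos]
    norm_num
  rw [halfLap_eq_integral_gaussian, ← hpi, mul_assoc]
  congr 1
  rw [← integral_const_mul]
  refine setIntegral_congr_fun measurableSet_Ioi fun (σ : ℝ) hσ => ?_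
  have hσ' : 0 < σ := hσ
  have hb : ∀ a : E3, Integrable fun z : E3 => exp (-(σ * ‖z‖ ^ 2)) * heat t (a + z) := fun a => by
    refine (integrable_gaussian hσ').mul_bdd (c := t ^ (-(3 / 2) : ℝ))
      ((continuous_heat t).comp (by fun_prop)).aestronglyMeasurable (ae_of_all _ fun z => ?_)
    rw [Real.norm_eq_abs, abs_of_nonneg (heat_nonneg ht _), heat]
    exact mul_le_of_le_one_right (by positivity) (exp_le_one_iff.2 (by
      have : 0 ≤ ‖a + z‖ ^ 2 / t := by positivity
      linarith))
  have hI : ∫ z, exp (-(σ * ‖z‖ ^ 2)) * heatDiff x₀ t (x + z) =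
      (π / σ) ^ (3 / 2 : ℝ) * heatDiff x₀ (t + 1 / σ) x := by
    have h : ∀ z, exp (-(σ * ‖z‖ ^ 2)) * heatDiff x₀ t (x + z) =
        exp (-(σ * ‖z‖ ^ 2)) * heat t ((x - x₀) + z) - exp (-(σ * ‖z‖ ^ 2)) * heat t (x + z) :=
      fun z => by rw [heatDiff, sub_add_eq_add_sub]; ring
    simp_rw [h]
    rw [integral_sub (hb _) (hb _), integral_gaussian_mul_heat ht hσ',
      integral_gaussian_mul_heat ht hσ', heatDiff]
    ring
  simp only [hφ, hI]
  linear_combination (heatDiff x₀ t x - heatDiff x₀ (t + 1 / σ) x) * mul_pi_div_rpow hσ'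

lemma heat_eq_sqrt {t : ℝ} (ht : 0 < t) (z : E3) :
    heat t z = (√t ^ 3)⁻¹ * exp (-(‖z‖ / √t) ^ 2) := by
  rw [heat, div_pow, sq_sqrt ht.le, rpow_neg ht.le]
  congr 2
  rw [sqrt_eq_rpow, ← rpow_natCast, ← rpow_mul ht.le]
  norm_num

lemma one_add_sq_le {r₀ r b : ℝ} (hr₀ : 0 < r₀) (hr : r₀ ≤ r) :
    1 + (r * b) ^ 2 ≤ (1 + 1 / r₀ ^ 2) * r ^ 2 * (1 + b ^ 2) := by
  have h1 : 1 ≤ 1 / r₀ ^ 2 * r ^ 2 := by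
    rw [one_div_mul_eq_div, one_le_div (by positivity)]; gcongr
  nlinarith [mul_nonneg (zero_le_one.trans h1) (sq_nonneg b), sq_nonneg r]

lemma weight_mul_gaussian_le {t₀ t c n : ℝ} (ht₀ : 0 < t₀) (ht : t₀ ≤ t) (hc : 0 ≤ c) (hn : 0 ≤ n) :
    (1 + n ^ 2) ^ 2 * ((√t ^ 3)⁻¹ * ((2 * n * c + c ^ 2) / t) * exp (-(n / √t) ^ 2)) ≤
      (1 + 1 / √t₀ ^ 2) ^ 2 * (2 * c + c ^ 2 / √t₀) * (6 * exp 1) := by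
  have hr₀ : 0 < √t₀ := sqrt_pos.2 ht₀
  have hr : √t₀ ≤ √t := sqrt_le_sqrt ht
  have htt : √t ^ 2 = t := sq_sqrt (ht₀.le.trans ht)
  set r := √t
  set r₀ := √t₀
  have hr0 : 0 < r := hr₀.trans_le hr
  rw [← htt]
  obtain ⟨b, hb⟩ : ∃ b, b = n / r := ⟨_, rfl⟩
  have hn' : n = r * b := by rw [hb]; field_simp
  have hb0 : 0 ≤ b := hb ▸ by positivity
  rw [← hb, hn']
  have h2 : 2 * (r * b) * c + c ^ 2 ≤ r * (2 * c + c ^ 2 / r₀) * (1 + b ^ 2) := by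
    have e1 : c ^ 2 ≤ r * (c ^ 2 / r₀) := by
      rw [mul_div_assoc', le_div_iff₀ hr₀]; nlinarith [sq_nonneg c]
    have e2 : 0 ≤ r * c * (1 + b ^ 2 - b) := by
      have : 0 ≤ 1 + b ^ 2 - b := by nlinarith [sq_nonneg (b - 1)]
      positivity
    have e3 : 0 ≤ r * (c ^ 2 / r₀) * b ^ 2 := by positivity
    nlinarith
  have h3 := one_add_pow_mul_exp_neg_le (sq_nonneg b) 3
  norm_num [Nat.factorial] at h3
  calc _ ≤ ((1 + 1 / r₀ ^ 2) * r ^ 2 * (1 + b ^ 2)) ^ 2 *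
        ((r ^ 3)⁻¹ * (r * (2 * c + c ^ 2 / r₀) * (1 + b ^ 2) / r ^ 2) * exp (-b ^ 2)) := by
        gcongr
        exact one_add_sq_le hr₀ hr
    _ = (1 + 1 / r₀ ^ 2) ^ 2 * (2 * c + c ^ 2 / r₀) * ((1 + b ^ 2) ^ 3 * exp (-b ^ 2)) := by
        field_simp
    _ ≤ _ := mul_le_mul_of_nonneg_left h3 (by positivity)

lemma abs_exp_neg_sub_le {a b : ℝ} :
    |exp (-a) - exp (-b)| ≤ |a - b| * exp (-a) + |a - b| * exp (-b) := by
  wlog h : a ≤ b generalizing a b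
  · have := this (le_of_not_ge h)
    rw [abs_sub_comm, abs_sub_comm a b]; linarith
  have h1 : exp (-a) * (1 - (b - a)) ≤ exp (-b) := by
    have := add_one_le_exp (a - b)
    calc exp (-a) * (1 - (b - a)) ≤ exp (-a) * exp (a - b) := by gcongr; linarith
      _ = exp (-b) := by rw [← exp_add]; ring_nf
  have h2 : exp (-b) ≤ exp (-a) := exp_le_exp.2 (by linarith)
  rw [abs_of_nonneg (by linarith), abs_of_nonpos (by linarith)]
  have : 0 ≤ (b - a) * exp (-b) := mul_nonneg (by linarith) (exp_pos _).le
  nlinarith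

lemma one_add_norm_pow_four_le (x : E3) : 1 + ‖x‖ ^ 4 ≤ (1 + ‖x‖ ^ 2) ^ 2 := by
  nlinarith [sq_nonneg ‖x‖]

lemma one_add_norm_pow_four_le_translate (x x₀ : E3) :
    1 + ‖x‖ ^ 4 ≤ 4 * (1 + ‖x₀‖ ^ 2) ^ 2 * (1 + ‖x - x₀‖ ^ 2) ^ 2 := by
  have h : ‖x‖ ≤ ‖x - x₀‖ + ‖x₀‖ := by simpa using norm_add_le (x - x₀) x₀
  have h1 : 1 + ‖x‖ ^ 2 ≤ 2 * (1 + ‖x₀‖ ^ 2) * (1 + ‖x - x₀‖ ^ 2) := by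
    have : ‖x‖ ^ 2 ≤ (‖x - x₀‖ + ‖x₀‖) ^ 2 := by gcongr
    nlinarith [sq_nonneg (‖x - x₀‖ - ‖x₀‖), mul_nonneg (sq_nonneg ‖x₀‖) (sq_nonneg ‖x - x₀‖)]
  calc _ ≤ (1 + ‖x‖ ^ 2) ^ 2 := one_add_norm_pow_four_le x
    _ ≤ (2 * (1 + ‖x₀‖ ^ 2) * (1 + ‖x - x₀‖ ^ 2)) ^ 2 := by gcongr
    _ = _ := by ring

lemma abs_norm_sub_sq_sub_le (x x₀ : E3) :
    |‖x - x₀‖ ^ 2 - ‖x‖ ^ 2| ≤ 2 * ‖x‖ * ‖x₀‖ + ‖x₀‖ ^ 2 := by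
  have h := abs_le.1 (abs_real_inner_le_norm x x₀)
  rw [norm_sub_sq_real]
  exact abs_le.2 ⟨by nlinarith [sq_nonneg ‖x₀‖], by nlinarith [sq_nonneg ‖x₀‖]⟩

lemma heatDiff_bound (x₀ : E3) {t₀ : ℝ} (ht₀ : 0 < t₀) :
    ∃ C, 0 ≤ C ∧ ∀ t, t₀ ≤ t → ∀ x, (1 + ‖x‖ ^ 4) * |heatDiff x₀ t x| ≤ C := by
  set K := (1 + 1 / √t₀ ^ 2) ^ 2 * (2 * ‖x₀‖ + ‖x₀‖ ^ 2 / √t₀) * (6 * exp 1)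
  have hK : 0 ≤ K := by positivity
  refine ⟨4 * (1 + ‖x₀‖ ^ 2) ^ 2 * K + K, by positivity, fun t ht x => ?_⟩
  have ht0 : 0 < t := ht₀.trans_le ht
  have h1 := weight_mul_gaussian_le ht₀ ht (norm_nonneg x₀) (norm_nonneg (x - x₀))
  have h2 := weight_mul_gaussian_le ht₀ ht (norm_nonneg x₀) (norm_nonneg x)
  have e : ∀ z : E3, (‖z‖ / √t) ^ 2 = ‖z‖ ^ 2 / t := fun z => by rw [div_pow, sq_sqrt ht0.le]
  rw [heatDiff, heat_eq_sqrt ht0, heat_eq_sqrt ht0, ← mul_sub, abs_mul,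
    abs_of_nonneg (by positivity : 0 ≤ (√t ^ 3)⁻¹)]
  have d1 : |(‖x - x₀‖ / √t) ^ 2 - (‖x‖ / √t) ^ 2| ≤ (2 * ‖x‖ * ‖x₀‖ + ‖x₀‖ ^ 2) / t := by
    rw [e, e, ← sub_div, abs_div, abs_of_pos ht0]
    gcongr; exact abs_norm_sub_sq_sub_le x x₀
  have d2 : |(‖x - x₀‖ / √t) ^ 2 - (‖x‖ / √t) ^ 2| ≤
      (2 * ‖x - x₀‖ * ‖x₀‖ + ‖x₀‖ ^ 2) / t := by
    rw [e, e, ← sub_div, abs_div, abs_of_pos ht0, abs_sub_comm]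
    have := abs_norm_sub_sq_sub_le (x - x₀) (-x₀)
    rw [sub_neg_eq_add, sub_add_cancel, norm_neg] at this
    gcongr
  calc _ ≤ (1 + ‖x‖ ^ 4) * ((√t ^ 3)⁻¹ *
        ((2 * ‖x - x₀‖ * ‖x₀‖ + ‖x₀‖ ^ 2) / t * exp (-(‖x - x₀‖ / √t) ^ 2) +
          (2 * ‖x‖ * ‖x₀‖ + ‖x₀‖ ^ 2) / t * exp (-(‖x‖ / √t) ^ 2))) := by
        gcongr
        refine abs_exp_neg_sub_le.trans ?_
        gcongr
    _ = (1 + ‖x‖ ^ 4) * ((√t ^ 3)⁻¹ *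
        ((2 * ‖x - x₀‖ * ‖x₀‖ + ‖x₀‖ ^ 2) / t) * exp (-(‖x - x₀‖ / √t) ^ 2)) +
        (1 + ‖x‖ ^ 4) * ((√t ^ 3)⁻¹ *
          ((2 * ‖x‖ * ‖x₀‖ + ‖x₀‖ ^ 2) / t) * exp (-(‖x‖ / √t) ^ 2)) := by ring
    _ ≤ 4 * (1 + ‖x₀‖ ^ 2) ^ 2 * (1 + ‖x - x₀‖ ^ 2) ^ 2 * ((√t ^ 3)⁻¹ *
        ((2 * ‖x - x₀‖ * ‖x₀‖ + ‖x₀‖ ^ 2) / t) * exp (-(‖x - x₀‖ / √t) ^ 2)) +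
        (1 + ‖x‖ ^ 2) ^ 2 * ((√t ^ 3)⁻¹ *
          ((2 * ‖x‖ * ‖x₀‖ + ‖x₀‖ ^ 2) / t) * exp (-(‖x‖ / √t) ^ 2)) := by
        gcongr ?_ * _ + ?_ * _
        · exact one_add_norm_pow_four_le_translate x x₀
        · exact one_add_norm_pow_four_le x
    _ ≤ _ := by
        rw [mul_assoc (4 * (1 + ‖x₀‖ ^ 2) ^ 2)]
        gcongr

lemma hasDerivAt_heat {s : ℝ} (hs : 0 < s) (z : E3) :
    HasDerivAt (fun s => heat s z) (heat s z * ((‖z‖ ^ 2 / s - 3 / 2) / s)) s := by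
  have h1 := (hasDerivAt_id s).rpow_const (p := (-(3 / 2) : ℝ)) (Or.inl hs.ne')
  have h2 := (((hasDerivAt_inv hs.ne').const_mul (‖z‖ ^ 2)).neg).exp
  have h := h1.mul h2
  have e : (fun s => heat s z) = (fun s : ℝ => id s ^ (-(3 / 2) : ℝ)) *
      fun s => exp (-(‖z‖ ^ 2 * s⁻¹)) := by
    ext s; simp [heat, div_eq_mul_inv]
  rw [e]
  refine h.congr_deriv ?_
  simp only [id, Pi.neg_apply, heat]
  rw [rpow_sub_one hs.ne', ← div_eq_mul_inv]
  field_simp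
  ring

lemma heat_sub_bound {t₀ : ℝ} (ht₀ : 0 < t₀) :
    ∃ C, 0 ≤ C ∧ ∀ t, t₀ ≤ t → ∀ τ, 0 ≤ τ → ∀ z,
      (1 + ‖z‖ ^ 2) ^ 2 * |heat t z - heat (t + τ) z| ≤ C * τ := by
  have hr₀ : 0 < √t₀ := sqrt_pos.2 ht₀
  refine ⟨(1 + 1 / √t₀ ^ 2) ^ 2 * (2 / √t₀) * (6 * exp 1), by positivity, fun t ht τ hτ z => ?_⟩
  have hb : ∀ s ∈ Set.Ici t₀, ‖heat s z * ((‖z‖ ^ 2 / s - 3 / 2) / s)‖ ≤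
      (1 + 1 / √t₀ ^ 2) ^ 2 * (2 / √t₀) * (6 * exp 1) / (1 + ‖z‖ ^ 2) ^ 2 := by
    intro s hs
    have hs0 : 0 < s := ht₀.trans_le hs
    have hr : √t₀ ≤ √s := sqrt_le_sqrt hs
    have hss : √s ^ 2 = s := sq_sqrt hs0.le
    have e : ‖z‖ ^ 2 / s = (‖z‖ / √s) ^ 2 := by rw [div_pow, hss]
    rw [le_div_iff₀ (by positivity), heat_eq_sqrt hs0, e, Real.norm_eq_abs, abs_mul, abs_mul, abs_exp,
      abs_of_nonneg (by positivity : 0 ≤ (√s ^ 3)⁻¹), abs_div, abs_of_pos hs0,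
      show |(‖z‖ / √s) ^ 2 - 3 / 2| / s = |(‖z‖ / √s) ^ 2 - 3 / 2| / √s ^ 2 by rw [hss]]
    set r := √s
    set r₀ := √t₀
    have hr0 : 0 < r := hr₀.trans_le hr
    obtain ⟨b, hb⟩ : ∃ b, b = ‖z‖ / r := ⟨_, rfl⟩
    have hn' : ‖z‖ = r * b := by rw [hb]; field_simp
    rw [← hb, hn']
    have h2 : |b ^ 2 - 3 / 2| ≤ 2 * (1 + b ^ 2) :=
      abs_le.2 ⟨by nlinarith [sq_nonneg b], by nlinarith [sq_nonneg b]⟩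
    have h3 := one_add_pow_mul_exp_neg_le (sq_nonneg b) 3
    norm_num [Nat.factorial] at h3
    calc _ ≤ (r ^ 3)⁻¹ * exp (-b ^ 2) * (2 * (1 + b ^ 2) / r ^ 2) *
          ((1 + 1 / r₀ ^ 2) * r ^ 2 * (1 + b ^ 2)) ^ 2 := by
          gcongr
          exact one_add_sq_le hr₀ hr
      _ = (1 + 1 / r₀ ^ 2) ^ 2 * (2 / r) * ((1 + b ^ 2) ^ 3 * exp (-b ^ 2)) := by
          field_simp
      _ ≤ (1 + 1 / r₀ ^ 2) ^ 2 * (2 / r₀) * ((1 + b ^ 2) ^ 3 * exp (-b ^ 2)) := by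
          gcongr
      _ ≤ _ := mul_le_mul_of_nonneg_left h3 (by positivity)
  have := Convex.norm_image_sub_le_of_norm_hasDerivWithin_le (s := Set.Ici t₀)
    (f := fun s => heat s z) (fun s hs =>
      (hasDerivAt_heat (ht₀.trans_le hs) z).hasDerivWithinAt) hb (convex_Ici t₀)
      (x := t + τ) (y := t) (by simp; linarith) ht
  rw [Real.norm_eq_abs, Real.norm_eq_abs, sub_add_cancel_left, abs_neg, abs_of_nonneg hτ] at this
  calc _ ≤ (1 + ‖z‖ ^ 2) ^ 2 * ((1 + 1 / √t₀ ^ 2) ^ 2 * (2 / √t₀) * (6 * exp 1) /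
        (1 + ‖z‖ ^ 2) ^ 2 * τ) := by gcongr
    _ = _ := by field_simp

lemma heatDiff_sub_bound (x₀ : E3) {t₀ : ℝ} (ht₀ : 0 < t₀) :
    ∃ C, 0 ≤ C ∧ ∀ t, t₀ ≤ t → ∀ τ, 0 ≤ τ → ∀ x,
      (1 + ‖x‖ ^ 4) * |heatDiff x₀ t x - heatDiff x₀ (t + τ) x| ≤ C * τ := by
  obtain ⟨C, hC0, hC⟩ := heat_sub_bound ht₀
  refine ⟨4 * (1 + ‖x₀‖ ^ 2) ^ 2 * C + C, by positivity, fun t ht τ hτ x => ?_⟩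
  calc _ ≤ (1 + ‖x‖ ^ 4) * (|heat t (x - x₀) - heat (t + τ) (x - x₀)| +
        |heat t x - heat (t + τ) x|) := by
        gcongr
        unfold heatDiff
        refine le_trans (le_of_eq ?_) (abs_sub _ _)
        congr 1; ring
    _ ≤ 4 * (1 + ‖x₀‖ ^ 2) ^ 2 * (1 + ‖x - x₀‖ ^ 2) ^ 2 *
          |heat t (x - x₀) - heat (t + τ) (x - x₀)| +
        (1 + ‖x‖ ^ 2) ^ 2 * |heat t x - heat (t + τ) x| := by
        rw [mul_add]
        gcongr ?_ * _ + ?_ * _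
        · exact one_add_norm_pow_four_le_translate x x₀
        · exact one_add_norm_pow_four_le x
    _ ≤ 4 * (1 + ‖x₀‖ ^ 2) ^ 2 * (C * τ) + C * τ := by
        rw [mul_assoc (4 * (1 + ‖x₀‖ ^ 2) ^ 2)]
        exact add_le_add (mul_le_mul_of_nonneg_left (hC t ht τ hτ _) (by positivity))
          (hC t ht τ hτ _)
    _ = _ := by ring

lemma continuousAt_heatDiff {t : ℝ} (ht : 0 < t) (x₀ x : E3) :
    ContinuousAt (fun s => heatDiff x₀ s x) t :=
  (continuousAt_heat_time ht _).sub (continuousAt_heat_time ht _)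

lemma continuous_heatDiff (x₀ : E3) (t : ℝ) : Continuous (heatDiff x₀ t) :=
  ((continuous_heat t).comp (by fun_prop)).sub (continuous_heat t)

lemma tendsto_heat_atTop (z : E3) : Tendsto (fun t => heat t z) atTop (𝓝 0) := by
  refine squeeze_zero' ?_ ?_ (tendsto_rpow_neg_atTop (y := 3 / 2) (by norm_num))
  · filter_upwards [eventually_gt_atTop 0] with t ht using heat_nonneg ht z
  · filter_upwards [eventually_gt_atTop 0] with t ht
    refine mul_le_of_le_one_right (by positivity) (exp_le_one_iff.2 ?_)
    have : 0 ≤ ‖z‖ ^ 2 / t := by positivity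
    linarith

/-- The pairing of a weight `w` with the difference of two Gaussian kernels. -/
noncomputable def heatPair (w : E3 → ℝ) (x₀ : E3) (t : ℝ) : ℝ := ∫ x, w x * heatDiff x₀ t x

lemma abs_mul_le_of_weight {a b r C : ℝ} (h : (1 + r ^ 4) * |b| ≤ C) :
    |a * b| ≤ |a| / (1 + r ^ 4) * C := by
  have h0 : 0 < 1 + r ^ 4 := by positivity
  calc |a * b| = |a| / (1 + r ^ 4) * ((1 + r ^ 4) * |b|) := by rw [abs_mul]; field_simp
    _ ≤ _ := by gcongr

lemma integrable_mul_heatDiff {w : E3 → ℝ} (hw : Continuous w)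
    (hwi : Integrable fun x => |w x| / (1 + ‖x‖ ^ 4)) (x₀ : E3) {t : ℝ} (ht : 0 < t) :
    Integrable fun x => w x * heatDiff x₀ t x := by
  obtain ⟨C, hC0, hC⟩ := heatDiff_bound x₀ ht
  exact (hwi.mul_const C).mono' (hw.mul (continuous_heatDiff x₀ t)).aestronglyMeasurable
    (ae_of_all _ fun x => abs_mul_le_of_weight (hC t le_rfl x))

lemma continuousOn_heatPair {w : E3 → ℝ} (hw : Continuous w)
    (hwi : Integrable fun x => |w x| / (1 + ‖x‖ ^ 4)) (x₀ : E3) :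
    ContinuousOn (heatPair w x₀) (Set.Ioi 0) := by
  intro t ht
  have ht0 : 0 < t := ht
  refine ContinuousAt.continuousWithinAt ?_
  obtain ⟨C, hC0, hC⟩ := heatDiff_bound x₀ (half_pos ht0)
  refine continuousAt_of_dominated (bound := fun x => |w x| / (1 + ‖x‖ ^ 4) * C)
    (Eventually.of_forall fun s => (hw.mul (continuous_heatDiff x₀ s)).aestronglyMeasurable) ?_
    (hwi.mul_const C) (ae_of_all _ fun x => continuousAt_const.mul (continuousAt_heatDiff ht0 x₀ x))
  filter_upwards [Ioi_mem_nhds (half_lt_self ht0)] with s hs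
  exact ae_of_all _ fun x => abs_mul_le_of_weight (hC s (le_of_lt hs) x)

lemma tendsto_heatPair_atTop {w : E3 → ℝ} (hw : Continuous w)
    (hwi : Integrable fun x => |w x| / (1 + ‖x‖ ^ 4)) (x₀ : E3) :
    Tendsto (heatPair w x₀) atTop (𝓝 0) := by
  obtain ⟨C, hC0, hC⟩ := heatDiff_bound x₀ one_pos
  have h0 : (0 : ℝ) = ∫ x : E3, w x * 0 := by simp
  rw [h0]
  refine tendsto_integral_filter_of_dominated_convergence
    (fun x => |w x| / (1 + ‖x‖ ^ 4) * C)
    (Eventually.of_forall fun s => (hw.mul (continuous_heatDiff x₀ s)).aestronglyMeasurable) ?_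
    (hwi.mul_const C) (ae_of_all _ fun x => ?_)
  · filter_upwards [eventually_ge_atTop 1] with s hs
    exact ae_of_all _ fun x => abs_mul_le_of_weight (hC s hs x)
  · have := (tendsto_heat_atTop (x - x₀)).sub (tendsto_heat_atTop x)
    rw [sub_zero] at this
    exact this.const_mul _

lemma exists_integrable_bound_min (C₁ C₂ : ℝ) :
    ∃ k : ℝ → ℝ, IntegrableOn k (Set.Ioi 0) ∧ ∀ σ : ℝ, 0 < σ → ∀ a : ℝ, a ≤ C₁ → a ≤ C₂ * (1 / σ) →
      σ ^ (-(1 / 2) : ℝ) * a ≤ k σ := by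
  refine ⟨fun σ => (Set.Ioc 0 1).indicator (fun σ => σ ^ (-(1 / 2) : ℝ) * C₁) σ +
    (Set.Ioi 1).indicator (fun σ => σ ^ (-(3 / 2) : ℝ) * C₂) σ, ?_, fun σ hσ a ha₁ ha₂ => ?_⟩
  · have i1 : IntegrableOn (fun σ : ℝ => σ ^ (-(1 / 2) : ℝ)) (Set.Ioc 0 1) :=
      (intervalIntegrable_iff_integrableOn_Ioc_of_le zero_le_one).1
        (intervalIntegral.intervalIntegrable_rpow' (by norm_num))
    have i2 : IntegrableOn (fun σ : ℝ => σ ^ (-(3 / 2) : ℝ)) (Set.Ioi 1) :=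
      integrableOn_Ioi_rpow_of_lt (by norm_num) one_pos
    exact Integrable.add
      (((integrable_indicator_iff measurableSet_Ioc).2 (i1.mul_const C₁)).integrableOn)
      (((integrable_indicator_iff measurableSet_Ioi).2 (i2.mul_const C₂)).integrableOn)
  · rcases le_or_gt σ 1 with h | h
    · have m1 : σ ∈ Set.Ioc (0 : ℝ) 1 := ⟨hσ, h⟩
      have m2 : σ ∉ Set.Ioi (1 : ℝ) := fun h' => (not_lt.2 h) h'
      simp only [Set.indicator_of_mem m1, Set.indicator_of_notMem m2, add_zero]
      gcongr
    · have m1 : σ ∉ Set.Ioc (0 : ℝ) 1 := fun h' => (not_le.2 h) h'.2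
      have m2 : σ ∈ Set.Ioi (1 : ℝ) := h
      simp only [Set.indicator_of_mem m2, Set.indicator_of_notMem m1, zero_add]
      have e : σ ^ (-(3 / 2) : ℝ) = σ ^ (-(1 / 2) : ℝ) * (1 / σ) := by
        rw [show (-(3 / 2) : ℝ) = -(1 / 2) - 1 by norm_num, rpow_sub_one hσ.ne']; ring
      rw [e, mul_assoc, mul_comm (1 / σ)]
      gcongr

lemma integrable_prod_heatDiff {w : E3 → ℝ} (hw : Continuous w)
    (hwi : Integrable fun x => |w x| / (1 + ‖x‖ ^ 4)) (x₀ : E3) {t : ℝ} (ht : 0 < t) :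
    Integrable (Function.uncurry fun (x : E3) (σ : ℝ) =>
      w x * (σ ^ (-(1 / 2) : ℝ) * (heatDiff x₀ t x - heatDiff x₀ (t + 1 / σ) x)))
      (volume.prod (volume.restrict (Set.Ioi 0))) := by
  obtain ⟨C₁, hC₁0, hC₁⟩ := heatDiff_bound x₀ ht
  obtain ⟨C₂, hC₂0, hC₂⟩ := heatDiff_sub_bound x₀ ht
  obtain ⟨k, hk, hkb⟩ := exists_integrable_bound_min (C₁ + C₁) C₂
  refine (hwi.mul_prod hk).mono' ?_ ?_
  · refine Measurable.aestronglyMeasurable ?_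
    have := hw.measurable
    unfold heatDiff heat
    simp only [Function.uncurry_def]
    fun_prop
  · have : ∀ᵐ p : E3 × ℝ ∂(volume.prod (volume.restrict (Set.Ioi 0))), p.2 ∈ Set.Ioi (0 : ℝ) :=
      Measure.quasiMeasurePreserving_snd.ae (ae_restrict_mem measurableSet_Ioi)
    filter_upwards [this] with p hp
    have hσ : 0 < p.2 := hp
    have hts : t ≤ t + 1 / p.2 := by
      have : 0 ≤ 1 / p.2 := by positivity
      linarith
    rw [Function.uncurry, Real.norm_eq_abs]
    refine abs_mul_le_of_weight ?_
    rw [abs_mul, abs_of_nonneg (by positivity : 0 ≤ p.2 ^ (-(1 / 2) : ℝ)), mul_left_comm]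
    refine hkb _ hσ _ ?_ (hC₂ t le_rfl _ (by positivity) _)
    calc _ ≤ (1 + ‖p.1‖ ^ 4) * (|heatDiff x₀ t p.1| + |heatDiff x₀ (t + 1 / p.2) p.1|) := by
          gcongr; exact abs_sub _ _
      _ ≤ _ := by
          rw [mul_add]
          exact add_le_add (hC₁ t le_rfl _) (hC₁ _ hts _)

lemma integral_heatPair_sub {w : E3 → ℝ} (hw : Continuous w)
    (hwi : Integrable fun x => |w x| / (1 + ‖x‖ ^ 4)) (x₀ : E3) {t : ℝ} (ht : 0 < t) :
    IntegrableOn (fun σ : ℝ => σ ^ (-(1 / 2) : ℝ) * (heatPair w x₀ t - heatPair w x₀ (t + 1 / σ)))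
      (Set.Ioi 0) ∧
    ∫ σ in Set.Ioi (0 : ℝ),
      σ ^ (-(1 / 2) : ℝ) * (heatPair w x₀ t - heatPair w x₀ (t + 1 / σ)) =
    ∫ x, w x * ∫ σ in Set.Ioi (0 : ℝ),
      σ ^ (-(1 / 2) : ℝ) * (heatDiff x₀ t x - heatDiff x₀ (t + 1 / σ) x) := by
  have hint := integrable_prod_heatDiff hw hwi x₀ ht
  have hin : ∀ σ ∈ Set.Ioi (0 : ℝ), ∫ x, w x * (σ ^ (-(1 / 2) : ℝ) *
      (heatDiff x₀ t x - heatDiff x₀ (t + 1 / σ) x)) =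
      σ ^ (-(1 / 2) : ℝ) * (heatPair w x₀ t - heatPair w x₀ (t + 1 / σ)) := by
    intro σ hσ
    have hσ' : 0 < σ := hσ
    unfold heatPair
    rw [← integral_sub (integrable_mul_heatDiff hw hwi x₀ ht)
      (integrable_mul_heatDiff hw hwi x₀ (by positivity)), ← integral_const_mul]
    congr 1; ext x; ring
  constructor
  · refine Integrable.congr hint.integral_prod_right ?_
    filter_upwards [ae_restrict_mem measurableSet_Ioi] with σ hσ using hin σ hσ
  · rw [← setIntegral_congr_fun measurableSet_Ioi hin, ← integral_integral_swap hint]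
    simp_rw [integral_const_mul]

/-- A smoothed Riesz potential of `f` at `x₀`, at time scale `t`. -/
noncomputable def barrier (f : E3 → ℝ) (x₀ : E3) (t : ℝ) : ℝ := ∫ y, f y / (t + ‖y - x₀‖ ^ 2)

section Barrier

variable {f : E3 → ℝ} (hf : Continuous f) (hf0 : ∀ x, 0 < f x) (hfi : Integrable f) (x₀ : E3)

include hf hf0 hfi

lemma integrable_barrier {t : ℝ} (ht : 0 < t) : Integrable fun y => f y / (t + ‖y - x₀‖ ^ 2) := by
  refine (hfi.div_const t).mono' (Continuous.aestronglyMeasurable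
    (hf.div (by fun_prop) fun y => by positivity)) (ae_of_all _ fun y => ?_)
  have := (hf0 y).le
  rw [norm_of_nonneg (by positivity)]
  gcongr
  simp

lemma barrier_le_pot {t : ℝ} (ht : 0 < t) : barrier f x₀ t ≤ pot f x₀ := by
  refine integral_mono_ae (integrable_barrier hf hf0 hfi x₀ ht)
    (integrable_div_sq hf (fun x => (hf0 x).le) hfi x₀) ((ae_ne x₀).mono fun y hy => ?_)
  have := (hf0 y).le
  have : 0 < ‖x₀ - y‖ := norm_pos_iff.2 (sub_ne_zero.2 hy.symm)
  simp only
  rw [norm_sub_rev y]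
  gcongr
  simp [ht.le]

lemma continuousOn_barrier : ContinuousOn (barrier f x₀) (Set.Ioi 0) := by
  intro t ht
  have ht0 : 0 < t := ht
  refine ContinuousAt.continuousWithinAt ?_
  have hpos : ∀ᶠ s in 𝓝 t, t / 2 < s := Ioi_mem_nhds (half_lt_self ht0)
  refine continuousAt_of_dominated (bound := fun y => f y / (t / 2 + ‖y - x₀‖ ^ 2)) ?_ ?_
    (integrable_barrier hf hf0 hfi x₀ (half_pos ht0)) (ae_of_all _ fun y => ?_)
  · filter_upwards [hpos] with s hs
    exact (integrable_barrier hf hf0 hfi x₀ ((half_pos ht0).trans hs)).aestronglyMeasurable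
  · filter_upwards [hpos] with s hs
    refine ae_of_all _ fun y => ?_
    have := (hf0 y).le
    have : 0 < s := (half_pos ht0).trans hs
    rw [norm_of_nonneg (by positivity)]
    gcongr
  · exact continuousAt_const.div (by fun_prop) (by positivity)

end Barrier

/-- A truncated lower bound for the decrement of `1 / (m + 1 / σ)`. -/
noncomputable def truncKer (m σ : ℝ) : ℝ := if σ * m ≤ 1 then σ ^ (-(1 / 2) : ℝ) / (2 * m) else 0

lemma truncKer_nonneg {m σ : ℝ} (hm : 0 < m) (hσ : 0 < σ) : 0 ≤ truncKer m σ := by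
  unfold truncKer; split_ifs <;> positivity

lemma truncKer_le_sub {m σ : ℝ} (hm : 0 < m) (hσ : 0 < σ) :
    truncKer m σ ≤ σ ^ (-(1 / 2) : ℝ) * (1 / m - 1 / (m + 1 / σ)) := by
  have e : 1 / m - 1 / (m + 1 / σ) = 1 / (m * (σ * m + 1)) := by field_simp; ring
  rw [e]
  unfold truncKer
  split_ifs with h
  · rw [div_eq_mul_one_div, mul_comm 2 m]
    gcongr
    linarith
  · positivity

lemma integral_truncKer {m : ℝ} (hm : 0 < m) :
    IntegrableOn (truncKer m) (Set.Ioi 0) ∧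
      ∫ σ in Set.Ioi (0 : ℝ), truncKer m σ = m ^ (-(3 / 2) : ℝ) := by
  have e : ∀ σ ∈ Set.Ioi (0 : ℝ), (Set.Ioc 0 (1 / m)).indicator
      (fun σ => σ ^ (-(1 / 2) : ℝ) / (2 * m)) σ = truncKer m σ := by
    intro σ hσ
    have hσ' : 0 < σ := hσ
    simp only [Set.indicator, Set.mem_Ioc, hσ', true_and, truncKer, le_div_iff₀ hm]
  have i1 : IntegrableOn (fun σ : ℝ => σ ^ (-(1 / 2) : ℝ)) (Set.Ioc 0 (1 / m)) :=
    (intervalIntegrable_iff_integrableOn_Ioc_of_le (by positivity)).1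
      (intervalIntegral.intervalIntegrable_rpow' (by norm_num))
  refine ⟨IntegrableOn.congr_fun (f := (Set.Ioc 0 (1 / m)).indicator
      (fun σ => σ ^ (-(1 / 2) : ℝ) / (2 * m))) ?_ e measurableSet_Ioi, ?_⟩
  · exact ((integrable_indicator_iff measurableSet_Ioc).2 (i1.div_const _)).integrableOn
  · rw [← setIntegral_congr_fun measurableSet_Ioi e, setIntegral_indicator measurableSet_Ioc,
      Set.inter_eq_right.2 Set.Ioc_subset_Ioi_self,
      ← intervalIntegral.integral_of_le (by positivity), intervalIntegral.integral_div,
      integral_rpow (Or.inl (by norm_num)), zero_rpow (by norm_num), sub_zero,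
      one_div, inv_rpow hm.le, ← rpow_neg hm.le,
      show (-(3 / 2) : ℝ) = -(-(1 / 2) + 1) - 1 by norm_num, rpow_sub_one hm.ne']
    norm_num
    field_simp

lemma truncKer_le {t m σ : ℝ} (ht : 0 < t) (htm : t ≤ m) (hσ : 0 < σ) :
    truncKer m σ ≤ truncKer t σ := by
  unfold truncKer
  split_ifs with h1 h2
  · gcongr
  · exact absurd ((mul_le_mul_of_nonneg_left htm hσ.le).trans h1) h2
  · positivity
  · rfl

section Barrier

variable {f : E3 → ℝ} (hf : Continuous f) (hf0 : ∀ x, 0 < f x) (hfi : Integrable f) (x₀ : E3)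

include hf hf0 hfi

lemma integrable_prod_truncKer {t : ℝ} (ht : 0 < t) :
    Integrable (Function.uncurry fun (y : E3) (σ : ℝ) => f y * truncKer (t + ‖y - x₀‖ ^ 2) σ)
      (volume.prod (volume.restrict (Set.Ioi 0))) := by
  refine (hfi.mul_prod (integral_truncKer ht).1).mono' ?_ ?_
  · refine Measurable.aestronglyMeasurable ?_
    have := hf.measurable
    unfold truncKer
    simp only [Function.uncurry_def]
    refine Measurable.mul (by fun_prop) (Measurable.ite (measurableSet_le (by fun_prop)
      (by fun_prop)) (by fun_prop) (by fun_prop))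
  · have : ∀ᵐ p : E3 × ℝ ∂(volume.prod (volume.restrict (Set.Ioi 0))), p.2 ∈ Set.Ioi (0 : ℝ) :=
      Measure.quasiMeasurePreserving_snd.ae (ae_restrict_mem measurableSet_Ioi)
    filter_upwards [this] with p hp
    have := (hf0 p.1).le
    have h2 := truncKer_nonneg (m := t + ‖p.1 - x₀‖ ^ 2) (by positivity) hp
    rw [Function.uncurry, norm_of_nonneg (by positivity)]
    gcongr
    exact truncKer_le ht (by simp) hp

lemma integral_barrier_sub_ge {t A : ℝ} (hA : 0 ≤ A) (ht : 0 < t) {g : ℝ → ℝ}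
    (hg : IntegrableOn (fun σ : ℝ => σ ^ (-(1 / 2) : ℝ) * g σ) (Set.Ioi 0))
    (h : ∀ σ, 0 < σ → A * (barrier f x₀ t - barrier f x₀ (t + 1 / σ)) ≤ g σ) :
    A * ∫ y, f y * (t + ‖y - x₀‖ ^ 2) ^ (-(3 / 2) : ℝ) ≤
      ∫ σ in Set.Ioi (0 : ℝ), σ ^ (-(1 / 2) : ℝ) * g σ := by
  have hint := integrable_prod_truncKer hf hf0 hfi x₀ ht
  have e : ∫ y, f y * (t + ‖y - x₀‖ ^ 2) ^ (-(3 / 2) : ℝ) =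
      ∫ σ in Set.Ioi (0 : ℝ), ∫ y, f y * truncKer (t + ‖y - x₀‖ ^ 2) σ := by
    rw [← integral_integral_swap hint]
    congr 1; ext y
    rw [integral_const_mul, (integral_truncKer (by positivity)).2]
  rw [e, ← integral_const_mul]
  refine integral_mono_ae (hint.integral_prod_right.const_mul A) hg ?_
  filter_upwards [ae_restrict_mem measurableSet_Ioi, hint.prod_left_ae] with σ hσ hi
  have hσ' : 0 < σ := hσ
  have hle : ∫ y, f y * truncKer (t + ‖y - x₀‖ ^ 2) σ ≤
      σ ^ (-(1 / 2) : ℝ) * (barrier f x₀ t - barrier f x₀ (t + 1 / σ)) := by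
    have i1 := integrable_barrier hf hf0 hfi x₀ ht
    have i2 := integrable_barrier hf hf0 hfi x₀ (t := t + 1 / σ) (by positivity)
    unfold barrier
    rw [← integral_sub i1 i2, ← integral_const_mul]
    refine integral_mono hi ((i1.sub i2).const_mul _) fun y => ?_
    have h1 := truncKer_le_sub (m := t + ‖y - x₀‖ ^ 2) (by positivity) hσ'
    calc _ ≤ f y * (σ ^ (-(1 / 2) : ℝ) *
          (1 / (t + ‖y - x₀‖ ^ 2) - 1 / (t + ‖y - x₀‖ ^ 2 + 1 / σ))) :=
          mul_le_mul_of_nonneg_left h1 (hf0 y).le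
      _ = _ := by rw [add_right_comm t]; ring
  calc _ ≤ A * (σ ^ (-(1 / 2) : ℝ) * (barrier f x₀ t - barrier f x₀ (t + 1 / σ))) :=
        mul_le_mul_of_nonneg_left hle hA
    _ = σ ^ (-(1 / 2) : ℝ) * (A * (barrier f x₀ t - barrier f x₀ (t + 1 / σ))) := by ring
    _ ≤ _ := mul_le_mul_of_nonneg_left (h σ hσ') (by positivity)

end Barrier

lemma heat_le_rpow {t : ℝ} (ht : 0 < t) (z : E3) :
    heat t z ≤ 6 * (t + ‖z‖ ^ 2) ^ (-(3 / 2) : ℝ) := by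
  obtain ⟨a, ha⟩ : ∃ a, a = ‖z‖ ^ 2 / t := ⟨_, rfl⟩
  have ha0 : 0 ≤ a := ha ▸ by positivity
  have hm : t + ‖z‖ ^ 2 = t * (1 + a) := by rw [ha]; field_simp
  have h1 := one_add_pow_mul_exp_neg_le ha0 2
  have h2 := exp_one_lt_d9
  norm_num at h1
  rw [heat, hm, ← ha, mul_rpow ht.le (by positivity), mul_left_comm]
  gcongr
  have h3 : (1 + a) ^ (-2 : ℝ) ≤ (1 + a) ^ (-(3 / 2) : ℝ) :=
    rpow_le_rpow_of_exponent_le (by linarith) (by norm_num)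
  have h4 : (1 + a) ^ (-2 : ℝ) = ((1 + a) ^ 2)⁻¹ := by
    rw [rpow_neg (by positivity)]; norm_cast
  calc exp (-a) = (1 + a) ^ 2 * exp (-a) * ((1 + a) ^ 2)⁻¹ := by field_simp
    _ ≤ 6 * ((1 + a) ^ 2)⁻¹ := by gcongr; linarith
    _ ≤ _ := by rw [← h4]; gcongr

section Comparison

variable {w f : E3 → ℝ}

lemma integrable_mul_rpow (hf : Continuous f) (hf0 : ∀ x, 0 < f x) (hfi : Integrable f) (x₀ : E3)
    {t : ℝ} (ht : 0 < t) : Integrable fun y => f y * (t + ‖y - x₀‖ ^ 2) ^ (-(3 / 2) : ℝ) := by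
  refine (hfi.mul_const (t ^ (-(3 / 2) : ℝ))).mono' ?_ (ae_of_all _ fun y => ?_)
  · have := hf.measurable
    exact Measurable.aestronglyMeasurable (by fun_prop)
  · have := (hf0 y).le
    rw [norm_of_nonneg (by positivity)]
    exact mul_le_mul_of_nonneg_left (rpow_le_rpow_of_nonpos ht
      (le_add_of_nonneg_right (sq_nonneg _)) (by norm_num)) (hf0 y).le

lemma integral_heatPair_sub_le (hw : Continuous w)
    (hwi : Integrable fun x => |w x| / (1 + ‖x‖ ^ 4)) (hf : Continuous f) (hf0 : ∀ x, 0 < f x)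
    (hfi : Integrable f)
    (hsol : ∀ φ : SchwartzMap E3 ℝ, ∫ x, w x * halfLap φ x = 2 * ∫ x, f x * φ x)
    (x₀ : E3) {t : ℝ} (ht : 0 < t) :
    ∫ σ in Set.Ioi (0 : ℝ), σ ^ (-(1 / 2) : ℝ) * (heatPair w x₀ t - heatPair w x₀ (t + 1 / σ)) ≤
      24 * ∫ y, f y * (t + ‖y - x₀‖ ^ 2) ^ (-(3 / 2) : ℝ) := by
  obtain ⟨φ, hφ, hφL⟩ := exists_schwartz_heatDiff ht x₀
  have hpi : 0 < √π := sqrt_pos.2 pi_pos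
  have hpi2 : √π ≤ 2 := by
    rw [sqrt_le_left (by norm_num)]; linarith [pi_le_four]
  have hs := hsol φ
  have i1 := integrable_mul_rpow hf hf0 hfi x₀ ht
  have h0 : 0 ≤ ∫ y, f y * (t + ‖y - x₀‖ ^ 2) ^ (-(3 / 2) : ℝ) :=
    integral_nonneg fun y => by have := (hf0 y).le; positivity
  have h1 : ∫ x, f x * φ x ≤ 6 * ∫ y, f y * (t + ‖y - x₀‖ ^ 2) ^ (-(3 / 2) : ℝ) := by
    obtain ⟨M, hM0, hM⟩ := φ.exists_bound
    rw [← integral_const_mul]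
    refine integral_mono (hfi.mul_bdd φ.continuous.aestronglyMeasurable (ae_of_all _ hM))
      (i1.const_mul 6) fun y => ?_
    simp only
    rw [mul_left_comm]
    refine mul_le_mul_of_nonneg_left ?_ (hf0 y).le
    rw [hφ, heatDiff]
    linarith [heat_le_rpow ht (y - x₀), heat_nonneg ht y]
  have h2 : ∫ x, w x * halfLap φ x = (1 / √π) * ∫ x, w x * ∫ σ in Set.Ioi (0 : ℝ),
      σ ^ (-(1 / 2) : ℝ) * (heatDiff x₀ t x - heatDiff x₀ (t + 1 / σ) x) := by
    rw [← integral_const_mul]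
    congr 1; ext x
    rw [hφL, mul_left_comm]
  rw [(integral_heatPair_sub hw hwi x₀ ht).2]
  have h3 : ∫ x, w x * ∫ σ in Set.Ioi (0 : ℝ),
      σ ^ (-(1 / 2) : ℝ) * (heatDiff x₀ t x - heatDiff x₀ (t + 1 / σ) x) =
      √π * (2 * ∫ x, f x * φ x) := by
    rw [← hs, h2]; field_simp
  rw [h3]
  calc _ ≤ √π * (2 * (6 * ∫ y, f y * (t + ‖y - x₀‖ ^ 2) ^ (-(3 / 2) : ℝ))) := by gcongr
    _ ≤ 2 * (2 * (6 * ∫ y, f y * (t + ‖y - x₀‖ ^ 2) ^ (-(3 / 2) : ℝ))) := by gcongr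
    _ = _ := by ring

theorem heatPair_le_barrier (hw : Continuous w)
    (hwi : Integrable fun x => |w x| / (1 + ‖x‖ ^ 4)) (hf : Continuous f) (hf0 : ∀ x, 0 < f x)
    (hfi : Integrable f)
    (hsol : ∀ φ : SchwartzMap E3 ℝ, ∫ x, w x * halfLap φ x = 2 * ∫ x, f x * φ x)
    (x₀ : E3) {t : ℝ} (ht : 0 < t) : heatPair w x₀ t ≤ 25 * barrier f x₀ t := by
  by_contra! hlt
  set G : ℝ → ℝ := fun s => heatPair w x₀ s - 25 * barrier f x₀ s with hG
  have hGt : 0 < G t := sub_pos.2 hlt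
  have hbn : ∀ s, 0 < s → 0 ≤ barrier f x₀ s := fun s hs =>
    integral_nonneg fun y => by have := (hf0 y).le; positivity
  have hE : ∀ᶠ s in atTop, G s ≤ G t := by
    filter_upwards [(tendsto_heatPair_atTop hw hwi x₀).eventually_lt_const hGt,
      eventually_gt_atTop 0] with s hs hs0
    have := hbn s hs0
    simp only [hG] at hs ⊢
    linarith
  have hsub : Set.Ici t ⊆ Set.Ioi (0 : ℝ) := fun s hs => ht.trans_le hs
  obtain ⟨s, hs, hmax⟩ := ContinuousOn.exists_isMaxOn' (s := Set.Ici t) (f := G) (x₀ := t)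
    (((continuousOn_heatPair hw hwi x₀).mono hsub).sub
      (((continuousOn_barrier hf hf0 hfi x₀).mono hsub).const_smul (25 : ℝ))) isClosed_Ici
    Set.self_mem_Ici (by
      rw [eventually_inf_principal, cocompact_eq_atBot_atTop, eventually_sup]
      exact ⟨(eventually_lt_atBot t).mono fun x hx h => absurd hx (not_lt.2 h),
        hE.mono fun x hx _ => hx⟩)
  have hs0 : 0 < s := hsub hs
  have h1 := integral_barrier_sub_ge hf hf0 hfi x₀ (A := 25) (by norm_num) hs0
    (integral_heatPair_sub hw hwi x₀ hs0).1 (fun σ hσ => by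
      have h2 : G (s + 1 / σ) ≤ G s := hmax (show s + 1 / σ ∈ Set.Ici t from
        (show t ≤ s from hs).trans (by have : 0 ≤ 1 / σ := by positivity
                                       linarith))
      simp only [hG] at h2
      linarith)
  have h2 := integral_heatPair_sub_le hw hwi hf hf0 hfi hsol x₀ hs0
  have h3 : 0 < ∫ y, f y * (s + ‖y - x₀‖ ^ 2) ^ (-(3 / 2) : ℝ) := by
    have hpos : ∀ y, 0 < f y * (s + ‖y - x₀‖ ^ 2) ^ (-(3 / 2) : ℝ) := fun y =>
      mul_pos (hf0 y) (rpow_pos_of_pos (by positivity) _)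
    rw [integral_pos_iff_support_of_nonneg (fun y => (hpos y).le)
      (integrable_mul_rpow hf hf0 hfi x₀ hs0), Function.support_eq_univ fun y => (hpos y).ne']
    simp
  linarith

end Comparison

lemma integrable_mul_heat {w : E3 → ℝ} (hw : Continuous w)
    (hwi : Integrable fun x => |w x| / (1 + ‖x‖ ^ 4)) (a : E3) {t : ℝ} (ht : 0 < t) :
    Integrable fun x => w x * heat t (x - a) := by
  refine (hwi.mul_const (4 * (1 + ‖a‖ ^ 2) ^ 2 * (t ^ (-(3 / 2) : ℝ) *
    ((2 * (1 + 1 / (1 / t))) ^ 4 * ((4).factorial * exp 1))))).mono'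
    (hw.mul ((continuous_heat t).comp (by fun_prop))).aestronglyMeasurable
    (ae_of_all _ fun x => abs_mul_le_of_weight ?_)
  have h := one_add_norm_pow_mul_gaussian_le (one_div_pos.2 ht) 4 _ (norm_nonneg (x - a))
  rw [abs_of_nonneg (heat_nonneg ht _)]
  calc _ ≤ 4 * (1 + ‖a‖ ^ 2) ^ 2 * (1 + ‖x - a‖ ^ 2) ^ 2 * heat t (x - a) :=
        mul_le_mul_of_nonneg_right (one_add_norm_pow_four_le_translate x a) (heat_nonneg ht _)
    _ = 4 * (1 + ‖a‖ ^ 2) ^ 2 * (t ^ (-(3 / 2) : ℝ) * ((1 + ‖x - a‖ ^ 2) ^ 2 *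
        exp (-(1 / t * ‖x - a‖ ^ 2)))) := by
        rw [heat, one_div_mul_eq_div]; ring
    _ ≤ 4 * (1 + ‖a‖ ^ 2) ^ 2 * (t ^ (-(3 / 2) : ℝ) * ((1 + ‖x - a‖) ^ 4 *
        exp (-(1 / t * ‖x - a‖ ^ 2)))) := by
        gcongr
        nlinarith [norm_nonneg (x - a), sq_nonneg (‖x - a‖),
          pow_nonneg (norm_nonneg (x - a)) 3]
    _ ≤ _ := by
        refine mul_le_mul_of_nonneg_left (mul_le_mul_of_nonneg_left h ?_) ?_ <;> positivity

lemma tendsto_integral_mul_heat_near {g : E3 → ℝ} (hg : Integrable g) (a : E3)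
    (hga : ContinuousAt g a) :
    Tendsto (fun c : ℝ => ∫ x, g x * heat (1 / c ^ 2) (x - a)) atTop
      (𝓝 (π ^ (3 / 2 : ℝ) * g a)) := by
  set φ : E3 → ℝ := fun x => (π ^ (3 / 2 : ℝ))⁻¹ * exp (-(1 * ‖x‖ ^ 2)) with hφ
  have hP : 0 < π ^ (3 / 2 : ℝ) := rpow_pos_of_pos pi_pos _
  have h := tendsto_integral_comp_smul_smul_of_integrable' (μ := volume) (φ := φ) (g := g)
    (x₀ := a) (fun x => by positivity)
    (by rw [integral_const_mul, integral_gaussian_eq one_pos, div_one, inv_mul_cancel₀ hP.ne'])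
    (by
      have hK := one_add_norm_pow_mul_gaussian_le one_pos 4
      set K : ℝ := (2 * (1 + 1 / 1)) ^ 4 * ((4).factorial * exp 1)
      have hT : Tendsto (fun x : E3 => (π ^ (3 / 2 : ℝ))⁻¹ * K * (1 + ‖x‖)⁻¹)
          (Bornology.cobounded E3) (𝓝 ((π ^ (3 / 2 : ℝ))⁻¹ * K * 0)) :=
        (tendsto_inv_atTop_zero.comp (tendsto_atTop_add_const_left _ 1
          tendsto_norm_cobounded_atTop)).const_mul _
      rw [mul_zero] at hT
      refine squeeze_zero (fun x => by positivity) (fun x => ?_) hT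
      have h1 := hK ‖x‖ (norm_nonneg x)
      rw [finrank_euclideanSpace, Fintype.card_fin, ← div_eq_mul_inv,
        le_div_iff₀ (by positivity)]
      have h2 : ‖x‖ ^ 3 * (1 + ‖x‖) ≤ (1 + ‖x‖) ^ 4 := by
        rw [pow_succ (1 + ‖x‖) 3]
        gcongr
        linarith
      calc _ = (π ^ (3 / 2 : ℝ))⁻¹ * ((‖x‖ ^ 3 * (1 + ‖x‖)) * exp (-(1 * ‖x‖ ^ 2))) := by
            simp only [hφ]; ring
        _ ≤ (π ^ (3 / 2 : ℝ))⁻¹ * ((1 + ‖x‖) ^ 4 * exp (-(1 * ‖x‖ ^ 2))) := by gcongr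
        _ ≤ _ := mul_le_mul_of_nonneg_left h1 (by positivity)) hg hga
  refine (h.const_mul (π ^ (3 / 2 : ℝ))).congr' ?_
  filter_upwards [eventually_gt_atTop 0] with c hc
  rw [← integral_const_mul]
  congr 1; ext x
  rw [heat_eq_sqrt (by positivity), sqrt_div zero_le_one, sqrt_sq hc.le, sqrt_one, hφ]
  simp only [finrank_euclideanSpace, Fintype.card_fin, smul_eq_mul]
  have e : (‖x - a‖ / (1 / c)) ^ 2 = 1 * ‖c • (a - x)‖ ^ 2 := by
    rw [norm_smul, norm_sub_rev a x, Real.norm_eq_abs, mul_pow, sq_abs]; field_simp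
  rw [e]
  field_simp

lemma heat_mul_pow_four_le {t : ℝ} (ht : 0 < t) (z : E3) :
    ‖z‖ ^ 4 * heat t z ≤ 6 * √t := by
  have hr : 0 < √t := sqrt_pos.2 ht
  rw [heat_eq_sqrt ht]
  obtain ⟨b, hb⟩ : ∃ b, b = ‖z‖ / √t := ⟨_, rfl⟩
  have hn : ‖z‖ = √t * b := by rw [hb]; field_simp
  have h1 := one_add_pow_mul_exp_neg_le (sq_nonneg b) 2
  have h2 := exp_one_lt_d9
  norm_num at h1
  rw [← hb, hn]
  calc (√t * b) ^ 4 * ((√t ^ 3)⁻¹ * exp (-b ^ 2)) = √t * ((b ^ 2) ^ 2 * exp (-b ^ 2)) := by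
        field_simp
    _ ≤ √t * ((1 + b ^ 2) ^ 2 * exp (-b ^ 2)) := by gcongr; linarith
    _ ≤ √t * 6 := by gcongr; linarith
    _ = _ := mul_comm _ _

lemma tendsto_integral_mul_heat {w : E3 → ℝ} (hw : Continuous w)
    (hwi : Integrable fun x => |w x| / (1 + ‖x‖ ^ 4)) (a : E3) :
    Tendsto (fun c : ℝ => ∫ x, w x * heat (1 / c ^ 2) (x - a)) atTop
      (𝓝 (π ^ (3 / 2 : ℝ) * w a)) := by
  set B := Metric.ball a 1 with hB
  have hBm : MeasurableSet B := Metric.isOpen_ball.measurableSet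
  set g := B.indicator w with hg
  have hgi : Integrable g := (integrable_indicator_iff hBm).2
    ((hw.continuousOn.integrableOn_compact (isCompact_closedBall a 1)).mono_set
      Metric.ball_subset_closedBall)
  have haB : B ∈ 𝓝 a := Metric.ball_mem_nhds a one_pos
  have hga : g =ᶠ[𝓝 a] w := by
    filter_upwards [haB] with x hx using Set.indicator_of_mem hx w
  have hnear := tendsto_integral_mul_heat_near hgi a (hw.continuousAt.congr hga.symm)
  rw [hga.self_of_nhds] at hnear
  set C := 16 * (1 + ‖a‖ ^ 2) ^ 2 * 6 with hC
  have hfar : Tendsto (fun c : ℝ => ∫ x in Bᶜ, w x * heat (1 / c ^ 2) (x - a)) atTop (𝓝 0) := by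
    have hT : Tendsto (fun c : ℝ => (∫ x, |w x| / (1 + ‖x‖ ^ 4)) * (C * c⁻¹)) atTop
        (𝓝 ((∫ x, |w x| / (1 + ‖x‖ ^ 4)) * (C * 0))) :=
      (tendsto_inv_atTop_zero.const_mul _).const_mul _
    rw [mul_zero, mul_zero] at hT
    refine squeeze_zero_norm' ?_ hT
    filter_upwards [eventually_gt_atTop 0] with c hc
    have ht : 0 < 1 / c ^ 2 := by positivity
    have hb : ∀ x ∈ Bᶜ, ‖w x * heat (1 / c ^ 2) (x - a)‖ ≤ |w x| / (1 + ‖x‖ ^ 4) * (C * c⁻¹) := by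
      intro x hx
      have hx1 : 1 ≤ ‖x - a‖ := by simpa [hB, dist_eq_norm] using hx
      refine abs_mul_le_of_weight ?_
      have h1 := heat_mul_pow_four_le ht (x - a)
      rw [sqrt_div zero_le_one, sqrt_sq hc.le, sqrt_one, one_div c] at h1
      have h2 : (1 + ‖x - a‖ ^ 2) ^ 2 ≤ 4 * ‖x - a‖ ^ 4 := by
        have : 1 ≤ ‖x - a‖ ^ 2 := one_le_pow₀ hx1
        nlinarith
      rw [abs_of_nonneg (heat_nonneg ht _)]
      have h0 := heat_nonneg ht (x - a)
      calc _ ≤ 4 * (1 + ‖a‖ ^ 2) ^ 2 * (4 * ‖x - a‖ ^ 4) * heat (1 / c ^ 2) (x - a) := by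
            gcongr
            exact (one_add_norm_pow_four_le_translate x a).trans (by gcongr)
        _ = 16 * (1 + ‖a‖ ^ 2) ^ 2 * (‖x - a‖ ^ 4 * heat (1 / c ^ 2) (x - a)) := by ring
        _ ≤ 16 * (1 + ‖a‖ ^ 2) ^ 2 * (6 * c⁻¹) := by
            exact mul_le_mul_of_nonneg_left h1 (by positivity)
        _ = _ := by rw [hC]; ring
    calc _ ≤ ∫ x in Bᶜ, |w x| / (1 + ‖x‖ ^ 4) * (C * c⁻¹) := by
          refine norm_integral_le_of_norm_le (hwi.mul_const _).integrableOn ?_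
          filter_upwards [ae_restrict_mem hBm.compl] with x hx using hb x hx
      _ ≤ ∫ x, |w x| / (1 + ‖x‖ ^ 4) * (C * c⁻¹) :=
          setIntegral_le_integral (hwi.mul_const _) (ae_of_all _ fun x => by
            simp only [Pi.zero_apply]; positivity)
      _ = _ := integral_mul_const _ _
  have := hnear.add hfar
  rw [add_zero] at this
  refine this.congr' ?_
  filter_upwards [eventually_gt_atTop 0] with c hc
  have hi := integrable_mul_heat hw hwi a (t := 1 / c ^ 2) (by positivity)
  rw [← integral_add_compl hBm hi, ← integral_indicator hBm]
  congr 2; ext x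
  by_cases hx : x ∈ B <;> simp [hg, hx]

/-- Pointwise control of `w` by the Riesz potential of `f`. -/
theorem le_add_pot {w f : E3 → ℝ} (hw : Continuous w)
    (hwi : Integrable fun x => |w x| / (1 + ‖x‖ ^ 4)) (hf : Continuous f) (hf0 : ∀ x, 0 < f x)
    (hfi : Integrable f)
    (hsol : ∀ φ : SchwartzMap E3 ℝ, ∫ x, w x * halfLap φ x = 2 * ∫ x, f x * φ x) (x : E3) :
    w x ≤ w 0 + 25 / π ^ (3 / 2 : ℝ) * pot f x := by
  have hP : 0 < π ^ (3 / 2 : ℝ) := rpow_pos_of_pos pi_pos _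
  have hlim := (tendsto_integral_mul_heat hw hwi x).sub (tendsto_integral_mul_heat hw hwi 0)
  have hle : π ^ (3 / 2 : ℝ) * w x - π ^ (3 / 2 : ℝ) * w 0 ≤ 25 * pot f x := by
    refine le_of_tendsto hlim ?_
    filter_upwards [eventually_gt_atTop 0] with c hc
    have ht : 0 < 1 / c ^ 2 := by positivity
    rw [← integral_sub (integrable_mul_heat hw hwi x ht) (integrable_mul_heat hw hwi 0 ht)]
    calc _ = heatPair w x (1 / c ^ 2) := by
          unfold heatPair heatDiff; congr 1; ext y; rw [sub_zero]; ring
      _ ≤ 25 * barrier f x (1 / c ^ 2) := heatPair_le_barrier hw hwi hf hf0 hfi hsol x ht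
      _ ≤ _ := by
          gcongr
          exact barrier_le_pot hf hf0 hfi x ht
  rw [div_mul_eq_mul_div, ← sub_le_iff_le_add', le_div_iff₀ hP]
  linarith

theorem solV_eq_logPot (u : E3 → ℝ) :
    solV u = logPot fun y => 1 / π ^ 2 * exp (3 * u y) := by
  funext x
  rw [solV, logPot, ← integral_const_mul]
  congr 1; ext y; ring

/-- A smooth solution of finite volume has bounded conformal factor. -/
theorem IsSolution.exists_exp_le {u : E3 → ℝ} (hu : IsSolution u) :
    ∃ S, 0 ≤ S ∧ ∀ x, exp (3 * u x) ≤ S := by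
  obtain ⟨hsm, ⟨-, hwi⟩, hfi, hsol⟩ := hu
  have hfc : Continuous fun x => exp (3 * u x) := by
    have := hsm.continuous
    fun_prop
  have hle : ∀ x, -lap u x ≤
      |lap u 0| + 25 / π ^ (3 / 2 : ℝ) * pot (fun y => exp (3 * u y)) x := fun x =>
    (le_add_pot (w := fun x => -lap u x) (continuous_lap hsm).neg (by simpa only [abs_neg] using hwi) hfc
      (fun _ => exp_pos _) hfi hsol x).trans
      (by simpa using neg_le_abs (lap u 0))
  obtain ⟨C, K, hK, h⟩ :=
    le_integral_log_of_neg_lap_le hsm hfi (abs_nonneg _) (by positivity) hle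
  obtain ⟨R, C', -, hC', h⟩ := exists_pow_le_pot hsm.continuous hfi hK h
  exact exists_bound_of_pow_le_pot hfc (fun _ => (exp_pos _).le) hfi hC' h

/-- Theorem 13: for a smooth finite-volume solution `u` of `(−Δ)^{3/2}u = 2e^{3u}`:
(a) for every `ε > 0` there is `R > 0` with `−v(x) ≥ (α − ε) log|x|` for `|x| ≥ R`;
(b) `|∇v(x)| → 0` and `D²v(x) → 0` as `|x| → ∞`. -/
theorem neg_v_lower_bound_and_derivatives_vanish (u : E3 → ℝ) (hu : IsSolution u) :
    (∀ ε : ℝ, 0 < ε → ∃ R : ℝ, 0 < R ∧ ∀ x : E3, R ≤ ‖x‖ →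
      (solAlpha u - ε) * Real.log ‖x‖ ≤ -(solV u x)) ∧
    Filter.Tendsto (fun x : E3 => ‖gradient (solV u) x‖)
      (Filter.comap (fun x : E3 => ‖x‖) Filter.atTop) (𝓝 0) ∧
    Filter.Tendsto (fun x : E3 => ‖iteratedFDeriv ℝ 2 (solV u) x‖)
      (Filter.comap (fun x : E3 => ‖x‖) Filter.atTop) (𝓝 0) := by
  obtain ⟨S, hS0, hS⟩ := hu.exists_exp_le
  obtain ⟨hsm, -, hfi, -⟩ := hu
  set f : E3 → ℝ := fun y => 1 / π ^ 2 * exp (3 * u y) with hf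
  have hc : Continuous f := by
    have := hsm.continuous
    fun_prop
  have hf0 : ∀ x, 0 ≤ f x := fun x => by positivity
  have hf1 : Integrable f := hfi.const_mul _
  have hfS : ∀ x, f x ≤ 1 / π ^ 2 * S := fun x =>
    mul_le_mul_of_nonneg_left (hS x) (by positivity)
  have hS1 : 0 ≤ 1 / π ^ 2 * S := by positivity
  have hα : solAlpha u = ∫ y, f y := (integral_const_mul _ _).symm
  rw [solV_eq_logPot, hα]
  refine ⟨fun ε hε => ?_, logPot_conclusion hc hf0 hf1 hS1 hfS⟩
  have := logPot_add_le hc hf0 hf1 hS1 hfS hε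
  obtain ⟨R, hR⟩ := eventually_atTop.1 (eventually_comap.1 this)
  refine ⟨max R 1, by positivity, fun x hx => ?_⟩
  linarith [hR ‖x‖ ((le_max_left _ _).trans hx) x rfl]
end

section
/- (Pohozaev-type identity.) Let w ∈ C¹(ℝ³) and K ∈ C¹(ℝ³) be such that K e^{3w} ∈ L¹(ℝ³), x ↦ x·∇K(x) e^{3w(x)} ∈ L¹(ℝ³), and w satisfies the integral equation w(x) = (1/2π²)∫_{ℝ³} log(|y|/|x−y|) K(y) e^{3w(y)} dy for every x ∈ ℝ³. Set α := (1/2π²)∫_{ℝ³} K e^{3w} dx. Then α(α − 2) = (1/3π²)∫_{ℝ³} x·∇K(x) e^{3w(x)} dx. -/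
open MeasureTheory Real Filter

open scoped RealInnerProductSpace

open scoped Topology

theorem integral_fderiv_self (g : E3 → ℝ) (hg : ContDiff ℝ 1 g) (hc : HasCompactSupport g) :
    ∫ x, fderiv ℝ g x x = -3 * ∫ x, g x := by
  have hg' : Continuous (fderiv ℝ g) := hg.continuous_fderiv one_ne_zero
  have hgd : Differentiable ℝ g := hg.differentiable one_ne_zero
  have hcd : HasCompactSupport (fderiv ℝ g) := hc.fderiv ℝ
  have hint (i : Fin 3) :
      Integrable (fun x : E3 => x i * fderiv ℝ g x (EuclideanSpace.single i 1)) := by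
    apply Continuous.integrable_of_hasCompactSupport
    · fun_prop
    · apply HasCompactSupport.mul_left
      exact hcd.comp_left (g := fun L : E3 →L[ℝ] ℝ => L (EuclideanSpace.single i 1)) rfl
  have hproj (i : Fin 3) (x : E3) : fderiv ℝ (fun y : E3 => y i) x = EuclideanSpace.proj i :=
    (EuclideanSpace.proj (𝕜 := ℝ) i : E3 →L[ℝ] ℝ).hasFDerivAt.fderiv
  have hterm (i : Fin 3) :
      ∫ x : E3, x i * fderiv ℝ g x (EuclideanSpace.single i 1) = - ∫ x, g x := by
    rw [integral_mul_fderiv_eq_neg_fderiv_mul_of_integrable (f := fun x : E3 => x i)]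
    · simp [hproj]
    · simpa [hproj] using hg.continuous.integrable_of_hasCompactSupport hc
    · exact hint i
    · exact Continuous.integrable_of_hasCompactSupport (by fun_prop) hc.mul_left
    · intro x _; fun_prop
    · intro x _; exact hgd x
  have hsum (x : E3) :
      fderiv ℝ g x x = ∑ i, x i * fderiv ℝ g x (EuclideanSpace.single i 1) := by
    have := (EuclideanSpace.basisFun (Fin 3) ℝ).sum_repr x
    conv_lhs => enter [2]; rw [← this]
    simp
  simp_rw [hsum]
  rw [integral_finsetSum _ (fun i _ => hint i)]
  simp [hterm]

theorem integrable_indicator_ball_inv_norm :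
    Integrable ((Metric.ball (0 : E3) 1).indicator fun z => ‖z‖⁻¹) := by
  rw [integrable_indicator_iff measurableSet_ball]
  have := integrableOn_fun_norm_addHaar (volume : Measure E3) (f := fun y : ℝ => y⁻¹) (r := 1)
  rw [this]
  have h : IntegrableOn (fun y : ℝ => y) (Set.Ioo 0 1) :=
    (continuous_id.integrableOn_Icc (a := (0 : ℝ)) (b := 1)).mono_set Set.Ioo_subset_Icc_self
  refine h.congr_fun (fun y hy => ?_) measurableSet_Ioo
  have := hy.1.ne'
  simp only [finrank_euclideanSpace, Fintype.card_fin, smul_eq_mul]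
  field_simp

theorem exists_forall_integral_inv_norm_sub_le (f : E3 → ℝ) (hf : Continuous f)
    (hi : Integrable f) (r : ℝ) :
    ∃ B, ∀ x : E3, ‖x‖ ≤ r → Integrable (fun y => ‖x - y‖⁻¹ * |f y|) ∧
      ∫ y, ‖x - y‖⁻¹ * |f y| ≤ B := by
  obtain ⟨M, hM⟩ := (isCompact_closedBall (0 : E3) (r + 1)).exists_bound_of_continuousOn
    hf.continuousOn
  set h : E3 → ℝ := (Metric.ball (0 : E3) 1).indicator fun z => ‖z‖⁻¹ with hh
  have hint : Integrable h := integrable_indicator_ball_inv_norm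
  refine ⟨M * (∫ z, h z) + ∫ y, |f y|, fun x hx => ?_⟩
  have hint' : Integrable (fun y => M * h (x - y) + |f y|) :=
    ((hint.comp_sub_left x).const_mul M).add hi.abs
  have hle (y : E3) : ‖x - y‖⁻¹ * |f y| ≤ M * h (x - y) + |f y| := by
    by_cases hy : ‖x - y‖ < 1
    · have h1 : h (x - y) = ‖x - y‖⁻¹ := Set.indicator_of_mem (by simpa using hy) _
      have h2 : |f y| ≤ M := by
        refine hM y ?_
        have := norm_sub_norm_le y x
        rw [norm_sub_rev] at this
        simp only [Metric.mem_closedBall, dist_zero_right]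
        linarith
      rw [h1, mul_comm M]
      have := mul_le_mul_of_nonneg_left h2 (inv_nonneg.2 (norm_nonneg (x - y)))
      linarith [abs_nonneg (f y)]
    · have h1 : h (x - y) = 0 := Set.indicator_of_notMem (by simpa using hy) _
      rw [h1, mul_zero, zero_add]
      exact mul_le_of_le_one_left (abs_nonneg _) (inv_le_one_of_one_le₀ (not_lt.1 hy))
  have hI : Integrable (fun y => ‖x - y‖⁻¹ * |f y|) := by
    refine hint'.mono' ?_ (.of_forall fun y => ?_)
    · exact Measurable.aestronglyMeasurable (by fun_prop)
    · rw [Real.norm_of_nonneg (by positivity)]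
      exact hle y
  refine ⟨hI, (integral_mono hI hint' hle).trans_eq ?_⟩
  rw [integral_add ((hint.comp_sub_left x).const_mul M) hi.abs, integral_const_mul,
    integral_sub_left_eq_self h]

/-- The logarithmic potential of the density `f`, with the kernel smoothed at scale `ε`. -/
noncomputable def regLogPotential (f : E3 → ℝ) (ε : ℝ) (x : E3) : ℝ :=
  ∫ y, (Real.log ‖y‖ - Real.log (‖x - y‖ ^ 2 + ε ^ 2) / 2) * f y

theorem abs_half_log_sq_add_sq_sub_log_le {r ε : ℝ} (hr : 0 < r) (hε : 0 < ε) :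
    |Real.log (r ^ 2 + ε ^ 2) / 2 - Real.log r| ≤ ε * r⁻¹ := by
  have h1 : Real.log (r ^ 2) = 2 * Real.log r := by simp
  have h2 : Real.log ((r + ε) ^ 2) = 2 * Real.log (r + ε) := by simp
  have h3 : Real.log (r ^ 2) ≤ Real.log (r ^ 2 + ε ^ 2) :=
    Real.log_le_log (by positivity) (by nlinarith)
  have h4 : Real.log (r ^ 2 + ε ^ 2) ≤ Real.log ((r + ε) ^ 2) :=
    Real.log_le_log (by positivity) (by nlinarith)
  have h5 : Real.log (r + ε) - Real.log r ≤ ε * r⁻¹ := by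
    rw [← Real.log_div (by positivity) hr.ne']
    refine (Real.log_le_sub_one_of_pos (by positivity)).trans_eq ?_
    field_simp
    ring
  rw [abs_of_nonneg] <;> linarith

theorem abs_log_sub_log_le (f : E3 → ℝ) {ε : ℝ} (hε : 0 < ε) (x : E3) :
    ∀ᵐ y : E3, |(Real.log ‖y‖ - Real.log (‖x - y‖ ^ 2 + ε ^ 2) / 2) * f y -
      Real.log (‖y‖ / ‖x - y‖) * f y| ≤ ε * (‖x - y‖⁻¹ * |f y|) := by
  filter_upwards [Measure.ae_ne volume 0, Measure.ae_ne volume x] with y h0 hx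
  have hr : 0 < ‖x - y‖ := norm_pos_iff.2 (sub_ne_zero.2 hx.symm)
  rw [Real.log_div (norm_ne_zero_iff.2 h0) hr.ne', ← sub_mul, abs_mul, ← mul_assoc]
  refine mul_le_mul_of_nonneg_right ?_ (abs_nonneg _)
  refine Eq.trans_le ?_ (abs_half_log_sq_add_sq_sub_log_le hr hε)
  rw [abs_sub_comm]
  congr 1
  ring

theorem integrable_regLogPotential (f : E3 → ℝ) (hf : Continuous f) {ε : ℝ} (hε : 0 < ε) (x : E3)
    (hx : Integrable fun y => Real.log (‖y‖ / ‖x - y‖) * f y)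
    (hx' : Integrable fun y => ‖x - y‖⁻¹ * |f y|) :
    Integrable fun y => (Real.log ‖y‖ - Real.log (‖x - y‖ ^ 2 + ε ^ 2) / 2) * f y := by
  have hfm := hf.measurable
  have h : Integrable (fun y => (Real.log ‖y‖ - Real.log (‖x - y‖ ^ 2 + ε ^ 2) / 2) * f y -
      Real.log (‖y‖ / ‖x - y‖) * f y) :=
    (hx'.const_mul ε).mono' (Measurable.aestronglyMeasurable (by fun_prop))
      (abs_log_sub_log_le f hε x)
  exact (h.add hx).congr (.of_forall fun y => by simp)

theorem abs_regLogPotential_sub_le (f : E3 → ℝ) (hf : Continuous f) {ε : ℝ} (hε : 0 < ε) (x : E3)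
    (hx : Integrable fun y => Real.log (‖y‖ / ‖x - y‖) * f y)
    (hx' : Integrable fun y => ‖x - y‖⁻¹ * |f y|) :
    |regLogPotential f ε x - ∫ y, Real.log (‖y‖ / ‖x - y‖) * f y| ≤
      ε * ∫ y, ‖x - y‖⁻¹ * |f y| := by
  rw [regLogPotential, ← integral_sub (integrable_regLogPotential f hf hε x hx hx') hx,
    ← integral_const_mul, ← Real.norm_eq_abs]
  exact norm_integral_le_of_norm_le (hx'.const_mul ε) (abs_log_sub_log_le f hε x)

/-- The gradient (as a linear form) of `-log (‖x‖² + ε²) / 2`. -/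
noncomputable def regKernel (ε : ℝ) (x : E3) : E3 →L[ℝ] ℝ :=
  -((‖x‖ ^ 2 + ε ^ 2)⁻¹ • innerSL ℝ x)

theorem continuous_regKernel {ε : ℝ} (hε : 0 < ε) : Continuous (regKernel ε) := by
  unfold regKernel
  have h : Continuous fun x : E3 => (‖x‖ ^ 2 + ε ^ 2)⁻¹ :=
    Continuous.inv₀ (by fun_prop) fun x => by positivity
  exact (h.smul (innerSL ℝ).continuous).neg

theorem norm_regKernel_le {ε : ℝ} (hε : 0 < ε) (x : E3) : ‖regKernel ε x‖ ≤ ε⁻¹ := by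
  rw [regKernel, norm_neg, norm_smul, innerSL_apply_norm, Real.norm_of_nonneg (by positivity),
    inv_mul_eq_div, div_le_iff₀ (by positivity), inv_mul_eq_div, le_div_iff₀ hε]
  nlinarith [sq_nonneg (‖x‖ - ε), norm_nonneg x]

theorem hasFDerivAt_log_norm_sub {ε : ℝ} (hε : 0 < ε) (a : ℝ) (x y : E3) :
    HasFDerivAt (fun x => a - Real.log (‖x - y‖ ^ 2 + ε ^ 2) / 2) (regKernel ε (x - y)) x := by
  have h1 : HasFDerivAt (fun x : E3 => ‖x - y‖ ^ 2) (2 • innerSL ℝ (x - y)) x := by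
    exact (hasStrictFDerivAt_norm_sq (x - y)).hasFDerivAt.comp x
      ((hasFDerivAt_id x).sub_const y)
  have h2 := (((h1.add_const (ε ^ 2)).log (by positivity)).const_mul (1 / 2)).const_sub a
  have hfun : (fun x : E3 => a - Real.log (‖x - y‖ ^ 2 + ε ^ 2) / 2) =
      fun x => a - 1 / 2 * Real.log (‖x - y‖ ^ 2 + ε ^ 2) := by
    ext z; ring
  have hder : regKernel ε (x - y) =
      -((1 / 2 : ℝ) • (‖x - y‖ ^ 2 + ε ^ 2)⁻¹ • 2 • innerSL ℝ (x - y)) := by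
    ext z
    simp [regKernel]
    ring
  rw [hfun, hder]
  exact h2

theorem hasFDerivAt_regLogPotential (f : E3 → ℝ) (hf : Continuous f) (hi : Integrable f)
    {ε : ℝ} (hε : 0 < ε) (x : E3)
    (hx : Integrable fun y => (Real.log ‖y‖ - Real.log (‖x - y‖ ^ 2 + ε ^ 2) / 2) * f y) :
    HasFDerivAt (regLogPotential f ε) (∫ y, f y • regKernel ε (x - y)) x := by
  have hfm := hf.measurable
  have hk := continuous_regKernel hε
  refine hasFDerivAt_integral_of_dominated_of_fderiv_le (𝕜 := ℝ) (s := Set.univ)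
    (bound := fun y => |f y| * ε⁻¹)
    (F' := fun x y => f y • regKernel ε (x - y)) Filter.univ_mem ?_ hx ?_ ?_ ?_ ?_
  · exact .of_forall fun x => Measurable.aestronglyMeasurable (by fun_prop)
  · exact Continuous.aestronglyMeasurable (by fun_prop)
  · refine .of_forall fun y x _ => ?_
    rw [norm_smul, Real.norm_eq_abs]
    exact mul_le_mul_of_nonneg_left (norm_regKernel_le hε _) (abs_nonneg _)
  · exact hi.abs.mul_const _
  · exact .of_forall fun y x _ => (hasFDerivAt_log_norm_sub hε _ x y).mul_const (f y)

theorem continuous_integral_regKernel (f : E3 → ℝ) (hf : Continuous f) (hi : Integrable f)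
    {ε : ℝ} (hε : 0 < ε) : Continuous fun x : E3 => ∫ y, f y • regKernel ε (x - y) := by
  have hk := continuous_regKernel hε
  refine continuous_of_dominated (bound := fun y => |f y| * ε⁻¹) (fun x => ?_) (fun x => ?_)
    (hi.abs.mul_const _) (.of_forall fun y => by fun_prop)
  · exact Continuous.aestronglyMeasurable (by fun_prop)
  · refine .of_forall fun y => ?_
    rw [norm_smul, Real.norm_eq_abs]
    exact mul_le_mul_of_nonneg_left (norm_regKernel_le hε _) (abs_nonneg _)

theorem integral_mul_integral_regKernel (f : E3 → ℝ) (hf : Continuous f) (hi : Integrable f)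
    {ε : ℝ} (hε : 0 < ε) (X : E3 → E3) (hX : Continuous X) (hXc : HasCompactSupport X) :
    ∫ x, f x * (∫ y, f y • regKernel ε (x - y)) (X x) =
      -(1 / 2) * ∫ z : E3 × E3, (‖z.1 - z.2‖ ^ 2 + ε ^ 2)⁻¹ *
        ⟪z.1 - z.2, X z.1 - X z.2⟫ * (f z.1 * f z.2) := by
  have hk := continuous_regKernel hε
  obtain ⟨C, hC⟩ := hXc.exists_bound_of_continuous hX
  set G : E3 × E3 → ℝ := fun z => regKernel ε (z.1 - z.2) (X z.1) * (f z.1 * f z.2) with hG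
  have hGint : Integrable G (volume.prod volume) := by
    refine (hi.mul_prod hi).bdd_mul (c := ε⁻¹ * C) ?_ (.of_forall fun z => ?_)
    · exact Continuous.aestronglyMeasurable (by fun_prop)
    · exact ((regKernel ε (z.1 - z.2)).le_opNorm (X z.1)).trans <|
        mul_le_mul (norm_regKernel_le hε _) (hC _) (norm_nonneg _) (by positivity)
  have hinner (x : E3) : f x * (∫ y, f y • regKernel ε (x - y)) (X x) = ∫ y, G (x, y) := by
    rw [ContinuousLinearMap.integral_apply, ← integral_const_mul]
    · refine integral_congr_ae (.of_forall fun y => ?_)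
      simp only [hG, smul_apply, smul_eq_mul]
      ring
    · refine (hi.abs.mul_const ε⁻¹).mono' (Continuous.aestronglyMeasurable (by fun_prop))
        (.of_forall fun y => ?_)
      rw [norm_smul, Real.norm_eq_abs]
      exact mul_le_mul_of_nonneg_left (norm_regKernel_le hε _) (abs_nonneg _)
  simp_rw [hinner]
  rw [← integral_prod G hGint, ← Measure.volume_eq_prod]
  have hswap : ∫ z : E3 × E3, G z.swap = ∫ z, G z := integral_prod_swap G
  have hadd : ∫ z : E3 × E3, (G z + G z.swap) = 2 * ∫ z, G z := by
    refine (integral_add hGint hGint.swap).trans ?_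
    rw [two_mul]
    exact congrArg _ hswap
  have : ∫ z, G z = (1 / 2) * ∫ z : E3 × E3, (G z + G z.swap) := by rw [hadd]; ring
  rw [this, neg_mul, ← mul_neg, ← integral_neg]
  congr 1
  refine integral_congr_ae (.of_forall fun z => ?_)
  simp only [hG, regKernel, Prod.fst_swap, Prod.snd_swap, neg_apply,
    smul_apply, innerSL_apply_apply, smul_eq_mul]
  rw [norm_sub_rev z.2 z.1, ← neg_sub z.1 z.2, inner_neg_left, inner_sub_right]
  ring

theorem integral_mul_fderiv_self (h u : E3 → ℝ) (hh : ContDiff ℝ 1 h) (hu : ContDiff ℝ 1 u)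
    (hc : HasCompactSupport h) :
    ∫ x, h x * fderiv ℝ u x x = -∫ x, u x * (3 * h x + fderiv ℝ h x x) := by
  have hh' := hh.continuous_fderiv one_ne_zero
  have hu' := hu.continuous_fderiv one_ne_zero
  have hhc := hh.continuous
  have huc := hu.continuous
  have key := integral_fderiv_self (fun x => h x * u x) (hh.mul hu) hc.mul_right
  have hd (x : E3) :
      fderiv ℝ (fun x => h x * u x) x x = h x * fderiv ℝ u x x + u x * fderiv ℝ h x x := by
    rw [fderiv_fun_mul (hh.differentiable one_ne_zero x) (hu.differentiable one_ne_zero x)]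
    simp
  simp_rw [hd] at key
  have i1 : Integrable fun x => h x * fderiv ℝ u x x :=
    Continuous.integrable_of_hasCompactSupport (by fun_prop) hc.mul_right
  have i2 : Integrable fun x => u x * fderiv ℝ h x x := by
    refine Continuous.integrable_of_hasCompactSupport (by fun_prop) (HasCompactSupport.mul_left ?_)
    exact (hc.fderiv ℝ).mono fun x hx h0 => hx (by simp [h0])
  have i3 : Integrable fun x => h x * u x :=
    Continuous.integrable_of_hasCompactSupport (by fun_prop) hc.mul_right
  rw [integral_add i1 i2] at key
  have : ∫ x, u x * (3 * h x + fderiv ℝ h x x) =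
      3 * (∫ x, h x * u x) + ∫ x, u x * fderiv ℝ h x x := by
    rw [← integral_const_mul, ← integral_add (i3.const_mul 3) i2]
    congr 1
    ext x
    ring
  rw [this]
  linarith

theorem abs_inv_mul_inner_sub_le {X : E3 → E3} {L : NNReal} (hL : LipschitzWith L X) {δ : ℝ}
    (hδ : 0 ≤ δ) (z : E3 × E3) :
    |(‖z.1 - z.2‖ ^ 2 + δ)⁻¹ * ⟪z.1 - z.2, X z.1 - X z.2⟫| ≤ L := by
  have h1 : |⟪z.1 - z.2, X z.1 - X z.2⟫| ≤ L * ‖z.1 - z.2‖ ^ 2 := by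
    refine (abs_real_inner_le_norm _ _).trans ?_
    have := mul_le_mul_of_nonneg_left (hL.norm_sub_le z.1 z.2) (norm_nonneg (z.1 - z.2))
    linarith
  rw [abs_mul, abs_of_nonneg (by positivity)]
  refine inv_mul_le_of_le_mul₀ (by positivity) L.2 (h1.trans ?_)
  nlinarith [mul_nonneg L.2 hδ]

theorem integral_mul_fderiv_self_logPotential (w f φ : E3 → ℝ) (c : ℝ) (hw : ContDiff ℝ 1 w)
    (hf : ContDiff ℝ 1 f) (hi : Integrable f)
    (habs : ∀ x : E3, Integrable fun y => Real.log (‖y‖ / ‖x - y‖) * f y)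
    (heq : ∀ x : E3, w x = c * ∫ y, Real.log (‖y‖ / ‖x - y‖) * f y)
    (hφ : ContDiff ℝ 1 φ) (hφc : HasCompactSupport φ) {L : NNReal}
    (hL : LipschitzWith L fun x => φ x • x) :
    ∫ x, φ x * f x * fderiv ℝ w x x =
      -(c / 2) * ∫ z : E3 × E3, (‖z.1 - z.2‖ ^ 2)⁻¹ *
        ⟪z.1 - z.2, φ z.1 • z.1 - φ z.2 • z.2⟫ * (f z.1 * f z.2) := by
  set ε : ℕ → ℝ := fun n => 1 / ((n : ℝ) + 1) with hε
  have hεpos (n : ℕ) : 0 < ε n := Nat.one_div_pos_of_nat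
  have hεle (n : ℕ) : ε n ≤ 1 := by
    rw [hε]
    exact div_le_one_of_le₀ (by linarith [n.cast_nonneg (α := ℝ)]) (by positivity)
  have hε0 : Tendsto ε atTop (𝓝 0) := tendsto_one_div_add_atTop_nhds_zero_nat
  have hJ (x : E3) : Integrable fun y => ‖x - y‖⁻¹ * |f y| := by
    obtain ⟨B, hB⟩ := exists_forall_integral_inv_norm_sub_le f hf.continuous hi ‖x‖
    exact (hB x le_rfl).1
  have hder (n : ℕ) (x : E3) := hasFDerivAt_regLogPotential f hf.continuous hi (hεpos n) x
    (integrable_regLogPotential f hf.continuous (hεpos n) x (habs x) (hJ x))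
  have hC1 (n : ℕ) : ContDiff ℝ 1 (regLogPotential f (ε n)) := by
    refine contDiff_one_iff_fderiv.2 ⟨fun x => (hder n x).differentiableAt, ?_⟩
    rw [funext fun x => (hder n x).fderiv]
    exact continuous_integral_regKernel f hf.continuous hi (hεpos n)
  set h : E3 → ℝ := fun x => φ x * f x with hh
  have hhC : ContDiff ℝ 1 h := hφ.mul hf
  have hhc : HasCompactSupport h := hφc.mul_right
  set q : E3 → ℝ := fun x => 3 * h x + fderiv ℝ h x x with hq
  have hqcont : Continuous q := by
    have h1 := hhC.continuous
    have h2 := hhC.continuous_fderiv one_ne_zero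
    fun_prop
  have hqc : HasCompactSupport q := by
    refine HasCompactSupport.add hhc.mul_left ?_
    exact (hhc.fderiv ℝ).mono fun x hx h0 => hx (by simp [h0])
  have lim1 : Tendsto (fun n => ∫ x, h x * fderiv ℝ (fun x => c * regLogPotential f (ε n) x) x x)
      atTop (𝓝 (∫ x, h x * fderiv ℝ w x x)) := by
    rw [integral_mul_fderiv_self h w hhC hw hhc]
    simp_rw [fun n => integral_mul_fderiv_self h (fun x => c * regLogPotential f (ε n) x) hhC
      (contDiff_const.mul (hC1 n)) hhc]
    refine Tendsto.neg ?_
    obtain ⟨r, hr⟩ := hqc.isCompact.isBounded.subset_closedBall 0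
    obtain ⟨B, hB⟩ := exists_forall_integral_inv_norm_sub_le f hf.continuous hi r
    have happ (n : ℕ) (x : E3) (hx : ‖x‖ ≤ r) :
        |c * regLogPotential f (ε n) x - w x| ≤ |c| * (ε n * B) := by
      rw [heq x, ← mul_sub, abs_mul]
      refine mul_le_mul_of_nonneg_left ?_ (abs_nonneg c)
      exact (abs_regLogPotential_sub_le f hf.continuous (hεpos n) x (habs x) (hJ x)).trans
        (mul_le_mul_of_nonneg_left (hB x hx).2 (hεpos n).le)
    have hq0 (x : E3) (hx : ¬ ‖x‖ ≤ r) : q x = 0 :=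
      image_eq_zero_of_notMem_tsupport fun h => hx (by simpa using hr h)
    refine tendsto_integral_of_dominated_convergence
      (fun x => (|w x| + |c| * |B|) * |q x|) (fun n => ?_) ?_ (fun n => .of_forall fun x => ?_)
      (.of_forall fun x => ?_)
    · have := (hC1 n).continuous
      exact Continuous.aestronglyMeasurable (by fun_prop)
    · have := hw.continuous
      refine Continuous.integrable_of_hasCompactSupport (by fun_prop) ?_
      exact HasCompactSupport.mul_left (hqc.comp_left (g := fun t : ℝ => |t|) abs_zero)
    · change ‖_ * q x‖ ≤ _
      rw [norm_mul, Real.norm_eq_abs, Real.norm_eq_abs]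
      by_cases hx : ‖x‖ ≤ r
      · refine mul_le_mul_of_nonneg_right ?_ (abs_nonneg _)
        have h1 := happ n x hx
        have h2 : ε n * B ≤ |B| :=
          (mul_le_mul_of_nonneg_left (le_abs_self B) (hεpos n).le).trans
            (mul_le_of_le_one_left (abs_nonneg B) (hεle n))
        have h3 := mul_le_mul_of_nonneg_left h2 (abs_nonneg c)
        have h4 := abs_sub_abs_le_abs_sub (c * regLogPotential f (ε n) x) (w x)
        linarith
      · simp [hq0 x hx]
    · change Tendsto _ _ (𝓝 (_ * q x))
      by_cases hx : ‖x‖ ≤ r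
      · refine Tendsto.mul_const _ (tendsto_iff_norm_sub_tendsto_zero.2 ?_)
        refine squeeze_zero (fun n => norm_nonneg _) (fun n => happ n x hx) ?_
        simpa using (hε0.mul_const B).const_mul |c|
      · have := hq0 x hx
        simp only [hq] at this
        simp [hq0 x hx, this]
  have hX : Continuous fun x : E3 => φ x • x := hL.continuous
  have hXc : HasCompactSupport fun x : E3 => φ x • x := hφc.smul_right
  have hval (n : ℕ) : ∫ x, h x * fderiv ℝ (fun x => c * regLogPotential f (ε n) x) x x =
      -(c / 2) * ∫ z : E3 × E3, (‖z.1 - z.2‖ ^ 2 + ε n ^ 2)⁻¹ *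
        ⟪z.1 - z.2, φ z.1 • z.1 - φ z.2 • z.2⟫ * (f z.1 * f z.2) := by
    have := integral_mul_integral_regKernel f hf.continuous hi (hεpos n) _ hX hXc
    rw [show -(c / 2) = c * -(1 / 2) by ring, mul_assoc, ← this, ← integral_const_mul]
    refine integral_congr_ae (.of_forall fun x => ?_)
    simp only [((hder n x).const_mul c).fderiv, smul_apply, map_smul, smul_eq_mul, hh]
    ring
  simp_rw [hval] at lim1
  refine tendsto_nhds_unique lim1 (Tendsto.const_mul _ ?_)
  have hff : Integrable (fun z : E3 × E3 => f z.1 * f z.2) := hi.mul_prod hi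
  have hfc := hf.continuous
  have hφcont := hφ.continuous
  refine tendsto_integral_of_dominated_convergence (fun z => L * |f z.1 * f z.2|) (fun n => ?_)
    (hff.abs.const_mul _) (fun n => .of_forall fun z => ?_) (.of_forall fun z => ?_)
  · refine Measurable.aestronglyMeasurable ?_
    have hm : Measurable fun z : E3 × E3 => ⟪z.1 - z.2, φ z.1 • z.1 - φ z.2 • z.2⟫ :=
      Continuous.measurable (by fun_prop)
    have hm' : Measurable fun z : E3 × E3 => f z.1 * f z.2 := Continuous.measurable (by fun_prop)
    fun_prop
  · rw [norm_mul, Real.norm_eq_abs, Real.norm_eq_abs]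
    exact mul_le_mul_of_nonneg_right (abs_inv_mul_inner_sub_le hL (sq_nonneg _) z) (abs_nonneg _)
  · by_cases hz : z.1 = z.2
    · simp [hz]
    · have : ‖z.1 - z.2‖ ^ 2 ≠ 0 := by simpa [sub_eq_zero] using hz
      refine Tendsto.mul_const _ (Tendsto.mul_const _ (Tendsto.inv₀ ?_ this))
      simpa using (hε0.pow 2).const_add (‖z.1 - z.2‖ ^ 2)

theorem ae_fst_ne_snd : ∀ᵐ z : E3 × E3, z.1 ≠ z.2 := by
  rw [ae_iff, Measure.volume_eq_prod]
  simp only [ne_eq, not_not]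
  rw [Measure.measure_prod_null (measurableSet_eq_fun measurable_fst measurable_snd)]
  refine .of_forall fun x => ?_
  have hx : Prod.mk x ⁻¹' {z : E3 × E3 | z.1 = z.2} = {x} := by
    ext y
    simp [eq_comm]
  change volume (Prod.mk x ⁻¹' {z : E3 × E3 | z.1 = z.2}) = 0
  rw [hx, measure_singleton]

theorem three_mul_integral_mul_fderiv_self (w K φ : E3 → ℝ) (hw : ContDiff ℝ 1 w)
    (hK : ContDiff ℝ 1 K) (hφ : ContDiff ℝ 1 φ) (hφc : HasCompactSupport φ) :
    3 * ∫ x, φ x * (K x * Real.exp (3 * w x)) * fderiv ℝ w x x =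
      -∫ x, (φ x * (3 * (K x * Real.exp (3 * w x)) + fderiv ℝ K x x * Real.exp (3 * w x)) +
        fderiv ℝ φ x x * (K x * Real.exp (3 * w x))) := by
  have key := integral_mul_fderiv_self (fun x => φ x * K x) (fun x => Real.exp (3 * w x))
    (hφ.mul hK) (contDiff_const.mul hw).exp hφc.mul_right
  rw [← integral_const_mul]
  refine Eq.trans (integral_congr_ae (.of_forall fun x => ?_))
    (key.trans (congrArg _ (integral_congr_ae (.of_forall fun x => ?_))))
  · have hd := (((hw.differentiable one_ne_zero x).hasFDerivAt.const_mul 3).exp).fderiv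
    simp only [hd, smul_apply, smul_eq_mul]
    ring
  · simp only [fderiv_fun_mul (hφ.differentiable one_ne_zero x) (hK.differentiable one_ne_zero x),
      add_apply, smul_apply, smul_eq_mul]
    ring

theorem exists_contDiff_hasCompactSupport_apply_zero_eq_one :
    ∃ φ : E3 → ℝ, ContDiff ℝ 1 φ ∧ HasCompactSupport φ ∧ φ 0 = 1 := by
  let b : ContDiffBump (0 : E3) := ⟨1, 2, one_pos, one_lt_two⟩
  exact ⟨b, b.contDiff, b.hasCompactSupport,
    b.one_of_mem_closedBall (Metric.mem_closedBall_self zero_le_one)⟩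

theorem fderiv_comp_smul_apply_self (φ : E3 → ℝ) (s : ℝ) (x : E3) :
    fderiv ℝ (fun x => φ (s • x)) x x = fderiv ℝ φ (s • x) (s • x) := by
  have := congrArg (fun L : E3 →L[ℝ] ℝ => L x) (fderiv_comp_smul (𝕜 := ℝ) s (f := φ) (x := x))
  simpa using this

theorem lipschitzWith_comp_smul_smul {φ : E3 → ℝ} {L : NNReal}
    (hL : LipschitzWith L fun x => φ x • x) {s : ℝ} (hs : 0 < s) :
    LipschitzWith L fun x => φ (s • x) • x := by
  refine LipschitzWith.of_dist_le_mul fun x y => ?_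
  have h := hL.dist_le_mul (s • x) (s • y)
  rw [smul_comm _ s x, smul_comm _ s y, dist_smul₀, dist_smul₀, Real.norm_of_nonneg hs.le] at h
  refine le_of_mul_le_mul_left ?_ hs
  linarith

theorem tendsto_integral_cutoff (f g φ : E3 → ℝ) (hf : Integrable f) (hg : Integrable g)
    (hφ : ContDiff ℝ 1 φ) (hφc : HasCompactSupport φ) (hφ0 : φ 0 = 1) {s : ℕ → ℝ}
    (hs : Tendsto s atTop (𝓝 0)) :
    Tendsto (fun n => ∫ x, (φ (s n • x) * g x + fderiv ℝ φ (s n • x) (s n • x) * f x)) atTop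
      (𝓝 (∫ x, g x)) := by
  have hφ1 := hφ.continuous
  have hφ2 : Continuous fun x => fderiv ℝ φ x x := by
    have := hφ.continuous_fderiv one_ne_zero
    fun_prop
  obtain ⟨C, hC⟩ := hφc.exists_bound_of_continuous hφ1
  obtain ⟨C', hC'⟩ := HasCompactSupport.exists_bound_of_continuous (f := fun x => fderiv ℝ φ x x)
    ((hφc.fderiv ℝ).mono fun x hx h0 => hx (by simp [h0])) hφ2
  have hsx (x : E3) : Tendsto (fun n => s n • x) atTop (𝓝 0) := by
    simpa using hs.smul_const x
  refine tendsto_integral_of_dominated_convergence (fun x => C * ‖g x‖ + C' * ‖f x‖)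
    (fun n => ?_) ((hg.norm.const_mul _).add (hf.norm.const_mul _))
    (fun n => .of_forall fun x => ?_) (.of_forall fun x => ?_)
  · have h2 : Continuous fun x => fderiv ℝ φ (s n • x) (s n • x) :=
      hφ2.comp (continuous_const_smul (s n))
    exact AEStronglyMeasurable.add
      ((Continuous.aestronglyMeasurable (by fun_prop)).mul hg.aestronglyMeasurable)
      (h2.aestronglyMeasurable.mul hf.aestronglyMeasurable)
  · refine (norm_add_le _ _).trans (add_le_add ?_ ?_) <;> rw [norm_mul]
    · exact mul_le_mul_of_nonneg_right (hC _) (norm_nonneg _)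
    · exact mul_le_mul_of_nonneg_right (hC' (s n • x)) (norm_nonneg _)
  · have h1 := ((hφ1.tendsto 0).comp (hsx x)).mul_const (g x)
    have h2 := ((hφ2.tendsto 0).comp (hsx x)).mul_const (f x)
    simpa [hφ0, Function.comp_def] using h1.add h2

theorem tendsto_integral_prod_cutoff (f φ : E3 → ℝ) (hf : Integrable f)
    (hφ : Continuous φ) (hφ0 : φ 0 = 1) {L : NNReal}
    (hL : LipschitzWith L fun x => φ x • x) {s : ℕ → ℝ} (hpos : ∀ n, 0 < s n)
    (hs : Tendsto s atTop (𝓝 0)) :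
    Tendsto (fun n => ∫ z : E3 × E3, (‖z.1 - z.2‖ ^ 2)⁻¹ *
        ⟪z.1 - z.2, φ (s n • z.1) • z.1 - φ (s n • z.2) • z.2⟫ * (f z.1 * f z.2)) atTop
      (𝓝 ((∫ x, f x) ^ 2)) := by
  have hff : Integrable (fun z : E3 × E3 => f z.1 * f z.2) := hf.mul_prod hf
  have hlim : ∫ z : E3 × E3, f z.1 * f z.2 = (∫ x, f x) ^ 2 := by
    rw [sq]
    exact integral_prod_mul f f
  rw [← hlim]
  have hφs (x : E3) : Tendsto (fun n => φ (s n • x)) atTop (𝓝 1) := by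
    rw [← hφ0]
    exact (hφ.tendsto 0).comp (by simpa using hs.smul_const x)
  refine tendsto_integral_of_dominated_convergence (fun z => L * |f z.1 * f z.2|) (fun n => ?_)
    (hff.abs.const_mul _) (fun n => .of_forall fun z => ?_) ?_
  · refine AEStronglyMeasurable.mul (Measurable.aestronglyMeasurable ?_) hff.aestronglyMeasurable
    have hm : Measurable fun z : E3 × E3 =>
        ⟪z.1 - z.2, φ (s n • z.1) • z.1 - φ (s n • z.2) • z.2⟫ :=
      Continuous.measurable (by fun_prop)
    fun_prop
  · rw [norm_mul, Real.norm_eq_abs, Real.norm_eq_abs]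
    refine mul_le_mul_of_nonneg_right ?_ (abs_nonneg _)
    simpa using abs_inv_mul_inner_sub_le (lipschitzWith_comp_smul_smul hL (hpos n)) le_rfl z
  · filter_upwards [ae_fst_ne_snd] with z hz
    have hne : ‖z.1 - z.2‖ ^ 2 ≠ 0 := by simpa [sub_eq_zero] using hz
    have h1 : Tendsto (fun n => φ (s n • z.1) • z.1 - φ (s n • z.2) • z.2) atTop
        (𝓝 (z.1 - z.2)) := by
      simpa using ((hφs z.1).smul_const z.1).sub ((hφs z.2).smul_const z.2)
    have h2 := ((tendsto_const_nhds (x := z.1 - z.2)).inner (𝕜 := ℝ) h1).const_mul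
      (‖z.1 - z.2‖ ^ 2)⁻¹
    rw [real_inner_self_eq_norm_sq, inv_mul_cancel₀ hne] at h2
    simpa using h2.mul_const (f z.1 * f z.2)

/-- Theorem 14 (Pohozaev-type identity): if `w, K ∈ C¹(ℝ³)`, `Ke^{3w} ∈ L¹`,
`x·∇K e^{3w} ∈ L¹`, and `w(x) = (1/2π²)∫ log(|y|/|x−y|) K(y) e^{3w(y)} dy` (the integral
converging absolutely for every `x`), then with `α := (1/2π²)∫ K e^{3w}` one has
`α(α−2) = (1/3π²)∫ x·∇K(x) e^{3w(x)} dx`. -/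
theorem pohozaev_identity (w K : E3 → ℝ)
    (hw : ContDiff ℝ 1 w) (hK : ContDiff ℝ 1 K)
    (h1 : Integrable (fun x => K x * Real.exp (3 * w x)) volume)
    (h2 : Integrable (fun x : E3 => ⟪x, gradient K x⟫ * Real.exp (3 * w x)) volume)
    (habs : ∀ x : E3, Integrable
      (fun y : E3 => Real.log (‖y‖ / ‖x - y‖) * (K y * Real.exp (3 * w y))) volume)
    (heq : ∀ x : E3, w x =
      (1 / (2 * Real.pi ^ 2)) * ∫ y, Real.log (‖y‖ / ‖x - y‖) * (K y * Real.exp (3 * w y))) :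
    ((1 / (2 * Real.pi ^ 2)) * ∫ x, K x * Real.exp (3 * w x)) *
        (((1 / (2 * Real.pi ^ 2)) * ∫ x, K x * Real.exp (3 * w x)) - 2) =
      (1 / (3 * Real.pi ^ 2)) * ∫ x : E3, ⟪x, gradient K x⟫ * Real.exp (3 * w x) := by
  have hD (x : E3) : ⟪x, gradient K x⟫ = fderiv ℝ K x x := by
    rw [real_inner_comm, inner_gradient_left]
  simp_rw [hD] at h2 ⊢
  obtain ⟨φ, hφ, hφc, hφ0⟩ := exists_contDiff_hasCompactSupport_apply_zero_eq_one
  obtain ⟨L, hL⟩ := ContDiff.lipschitzWith_of_hasCompactSupport (𝕂 := ℝ) (n := 1)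
    (f := fun x => φ x • x) hφc.smul_right (hφ.smul contDiff_id) one_ne_zero
  have hpos (n : ℕ) : 0 < 1 / ((n : ℝ) + 1) := Nat.one_div_pos_of_nat
  have hs : Tendsto (fun n : ℕ => 1 / ((n : ℝ) + 1)) atTop (𝓝 0) :=
    tendsto_one_div_add_atTop_nhds_zero_nat
  have hf : ContDiff ℝ 1 fun x => K x * Real.exp (3 * w x) :=
    hK.mul (contDiff_const.mul hw).exp
  have hlhs := tendsto_integral_cutoff _ _ φ h1 ((h1.const_mul 3).add h2) hφ hφc hφ0 hs
  have hrhs := tendsto_integral_prod_cutoff _ φ h1 hφ.continuous hφ0 hL hpos hs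
  have hφs (n : ℕ) : ContDiff ℝ 1 fun x : E3 => φ ((1 / ((n : ℝ) + 1)) • x) :=
    hφ.comp (contDiff_const_smul _)
  have hφsc (n : ℕ) : HasCompactSupport fun x : E3 => φ ((1 / ((n : ℝ) + 1)) • x) :=
    hφc.comp_smul (hpos n).ne'
  have key := tendsto_nhds_unique hlhs.neg <|
    (hrhs.const_mul (3 * -((1 / (2 * Real.pi ^ 2)) / 2))).congr fun n => by
      have e1 := three_mul_integral_mul_fderiv_self w K _ hw hK (hφs n) (hφsc n)
      have e2 := integral_mul_fderiv_self_logPotential w _ _ _ hw hf h1 habs heq (hφs n) (hφsc n)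
        (lipschitzWith_comp_smul_smul hL (hpos n))
      simp_rw [fderiv_comp_smul_apply_self] at e1
      rw [mul_assoc, ← e2, e1]
      rfl
  have hadd : ∫ x, ((fun x => 3 * (K x * Real.exp (3 * w x))) +
      fun x => fderiv ℝ K x x * Real.exp (3 * w x)) x =
      3 * (∫ x, K x * Real.exp (3 * w x)) + ∫ x, fderiv ℝ K x x * Real.exp (3 * w x) := by
    rw [← integral_const_mul]
    exact integral_add (h1.const_mul 3) h2
  rw [hadd] at key
  have hpi := Real.pi_ne_zero
  field_simp at key ⊢
  linarith
end
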